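/- Let Ω ⊆ ℂ be a bounded open connected set with C^∞ smooth boundary, and let D = B(w₀, ε) be an open disc whose closure is contained in Ω. Then for every m ∈ ℕ and every δ > 0 there exists a function g, C^∞ on an open neighborhood of closure(Ω), holomorphic on Ω, injective on closure(Ω), and (m, δ)-close to the identity on closure(Ω), such that g(Ω) is a quadrature domain whose quadrature identity uses only simple point evaluations at points of D: there exist N ≥ 1, points w_1, …, w_N ∈ D ∩ g(Ω), and complex numbers c_1, …, c_N such that ∫_{g(Ω)} f dA = Σ_{j=1}^N c_j f(w_j) for every f ∈ A²(g(Ω)). -/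

import Mathlib

open MeasureTheory Complex ComplexConjugate Metric Set

noncomputable section

/-- `f` belongs to the Bergman space `A²(Ω)`. -/
def BergmanFun (Ω : Set ℂ) (f : ℂ → ℂ) : Prop :=
  DifferentiableOn ℂ f Ω ∧ IntegrableOn (fun z => ‖f z‖ ^ 2) Ω volume

/-- `Ω` is a finitely connected domain none of whose complementary components is a point. -/
def IsFinConnDomain (Ω : Set ℂ) : Prop :=
  IsOpen Ω ∧ IsConnected Ω ∧
  {C : Set ℂ | ∃ x ∈ Ωᶜ, C = connectedComponentIn Ωᶜ x}.Finite ∧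
  ∀ x ∈ Ωᶜ, ¬ (connectedComponentIn Ωᶜ x).Subsingleton

/-- `Ω` is a quadrature domain. -/
def IsQuadratureDomain (Ω : Set ℂ) : Prop :=
  ∃ N : ℕ, 0 < N ∧ ∃ (w : Fin N → ℂ) (n : Fin N → ℕ) (c : Fin N → ℕ → ℂ),
    (∀ j, w j ∈ Ω) ∧
    ∀ f : ℂ → ℂ, BergmanFun Ω f →
      (∫ z in Ω, f z) =
        ∑ j, ∑ k ∈ Finset.range (n j + 1), c j k * iteratedDerivWithin k f Ω (w j)

/-- `fa` is an Ahlfors map of `Ω` at `a`. -/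
def IsAhlforsMap (Ω : Set ℂ) (a : ℂ) (fa : ℂ → ℂ) : Prop :=
  DifferentiableOn ℂ fa Ω ∧ (∀ z ∈ Ω, ‖fa z‖ < 1) ∧
  (deriv fa a).im = 0 ∧ 0 < (deriv fa a).re ∧
  ∀ g : ℂ → ℂ, DifferentiableOn ℂ g Ω → (∀ z ∈ Ω, ‖g z‖ < 1) →
    ‖deriv g a‖ ≤ (deriv fa a).re

/-- `Ω` is bounded with `C^∞` smooth boundary consisting of finitely many disjoint
simple closed curves. -/
def HasSmoothBoundary (Ω : Set ℂ) : Prop :=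
  Bornology.IsBounded Ω ∧
  ∃ (n : ℕ) (γ : Fin n → ℝ → ℂ),
    (∀ i, ContDiff ℝ (⊤ : ℕ∞) (γ i)) ∧
    (∀ i, Function.Periodic (γ i) (2 * Real.pi)) ∧
    (∀ i, InjOn (γ i) (Ico 0 (2 * Real.pi))) ∧
    (∀ i t, deriv (γ i) t ≠ 0) ∧
    (Pairwise fun i j => Disjoint (range (γ i)) (range (γ j))) ∧
    frontier Ω = ⋃ i, range (γ i)

/-- Partial derivative in the `x`-direction of a real-valued function on `ℂ`. -/
def pdx (u : ℂ → ℝ) (z : ℂ) : ℝ := deriv (fun t : ℝ => u (z + (t : ℂ))) 0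

/-- Partial derivative in the `y`-direction of a real-valued function on `ℂ`. -/
def pdy (u : ℂ → ℝ) (z : ℂ) : ℝ := deriv (fun t : ℝ => u (z + (t : ℂ) * Complex.I)) 0

/-- `f` is a proper holomorphic map of `Ω` onto the open unit disc. -/
def IsProperOntoDisc (Ω : Set ℂ) (f : ℂ → ℂ) : Prop :=
  DifferentiableOn ℂ f Ω ∧ f '' Ω = ball (0 : ℂ) 1 ∧
  ∀ L : Set ℂ, L ⊆ ball (0 : ℂ) 1 → IsCompact L → IsCompact (Ω ∩ f ⁻¹' L)

/-- `g` is `(m, δ)`-close to the identity on `closure Ω`. -/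
def CloseToId (Ω : Set ℂ) (m : ℕ) (δ : ℝ) (g : ℂ → ℂ) : Prop :=
  ∀ k ≤ m, ∀ z ∈ closure Ω, ‖iteratedFDeriv ℝ k (fun w => g w - w) z‖ ≤ δ

/-- `σ : [0,1] → ℂ` is a piecewise continuously differentiable curve. -/
def PiecewiseC1On01 (σ : ℝ → ℂ) : Prop :=
  ContinuousOn σ (Icc 0 1) ∧ ∃ s : Finset ℝ, ContDiffOn ℝ 1 σ (Icc (0 : ℝ) 1 \ s)

/-- `Ω` is a generalized quadrature domain. -/
def IsGenQuadratureDomain (Ω : Set ℂ) : Prop :=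
  ∃ (N M : ℕ) (w : Fin N → ℂ) (n : Fin N → ℕ) (c : Fin N → ℕ → ℂ)
    (b : Fin M → ℂ) (σ : Fin M → ℝ → ℂ),
    (∀ j, w j ∈ Ω) ∧
    (∀ m, PiecewiseC1On01 (σ m)) ∧
    (∀ m, ∀ t ∈ Icc (0 : ℝ) 1, σ m t ∈ Ω) ∧
    ∀ f : ℂ → ℂ, BergmanFun Ω f →
      (∫ z in Ω, f z) =
        (∑ j, ∑ k ∈ Finset.range (n j + 1), c j k * iteratedDerivWithin k f Ω (w j)) +
        ∑ m, b m * ∫ t in (0 : ℝ)..1, f (σ m t) * deriv (σ m) t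

/-- The Wirtinger derivative with respect to the conjugate variable. -/
def dbar {F : Type} [NormedAddCommGroup F] [NormedSpace ℂ F] (f : ℂ → F) (z : ℂ) : F :=
  (1 / 2 : ℂ) • (fderiv ℝ f z 1 + I • fderiv ℝ f z I)

/-- The solid Cauchy transform. -/
def cauchyT {F : Type} [NormedAddCommGroup F] [NormedSpace ℂ F] (f : ℂ → F) (z : ℂ) : F :=
  (1 / (Real.pi : ℂ)) • ∫ ζ : ℂ, ζ⁻¹ • f (z - ζ)

theorem lintegral_inv_closedBall_lt_top (R : ℝ) :
    ∫⁻ z in closedBall (0 : ℂ) R, ‖z⁻¹‖ₑ < ⊤ := by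
  rw [← lintegral_indicator measurableSet_closedBall, ← Complex.lintegral_comp_polarCoord_symm]
  calc _ ≤ ∫⁻ p in polarCoord.target, (Ioc 0 R ×ˢ Ioc (-Real.pi) Real.pi).indicator (fun _ => 1) p := by
        refine setLIntegral_mono' polarCoord.open_target.measurableSet fun p hp => ?_
        rw [polarCoord_target] at hp
        have hp1 : 0 < p.1 := hp.1
        have hp2 : -Real.pi < p.2 ∧ p.2 < Real.pi := hp.2
        by_cases h : p.1 ≤ R
        · rw [indicator_of_mem (by simpa [abs_of_pos hp1] using h),
            indicator_of_mem (by exact ⟨⟨hp1, h⟩, ⟨hp2.1, hp2.2.le⟩⟩)]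
          rw [← ofReal_norm, norm_inv, Complex.norm_polarCoord_symm, abs_of_pos hp1,
            smul_eq_mul, ← ENNReal.ofReal_mul hp1.le, mul_inv_cancel₀ hp1.ne']
          simp
        · rw [indicator_of_notMem (by simpa [abs_of_pos hp1] using h)]
          simp
    _ ≤ ∫⁻ p, (Ioc 0 R ×ˢ Ioc (-Real.pi) Real.pi).indicator (fun _ => 1) p :=
        setLIntegral_le_lintegral _ _
    _ < ⊤ := by
        rw [lintegral_indicator (measurableSet_Ioc.prod measurableSet_Ioc)]
        simp only [lintegral_const, MeasurableSet.univ, Measure.restrict_apply, univ_inter, one_mul]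
        rw [Measure.volume_eq_prod, Measure.prod_prod]
        simp [ENNReal.mul_lt_top]

theorem integrableOn_inv_closedBall (R : ℝ) :
    IntegrableOn (fun z : ℂ => z⁻¹) (closedBall 0 R) :=
  ⟨measurable_inv.aestronglyMeasurable, lintegral_inv_closedBall_lt_top R⟩

theorem locallyIntegrable_inv : LocallyIntegrable (fun z : ℂ => z⁻¹) := by
  refine (locallyIntegrable_iff).2 fun K hK => ?_
  obtain ⟨R, hR⟩ := hK.isBounded.subset_closedBall (0 : ℂ)
  exact (integrableOn_inv_closedBall R).mono_set hR

section Pompeiu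

variable {F : Type} [NormedAddCommGroup F] [NormedSpace ℂ F]

theorem dbar_def (f : ℂ → F) (z : ℂ) :
    dbar f z = (1 / 2 : ℂ) • (fderiv ℝ f z 1 + I • fderiv ℝ f z I) := rfl

theorem exp_inv_smul_dbar (L : ℂ →L[ℝ] F) (θ : ℝ) :
    (exp (θ * I))⁻¹ • (L 1 + I • L I) = L (exp (θ * I)) + I • L (I * exp (θ * I)) := by
  have h : ∀ w : ℂ, L w = w.re • L 1 + w.im • L I := fun w => by
    conv_lhs => rw [← re_add_im w]
    rw [map_add, ← map_smul, ← map_smul]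
    simp [mul_comm]
  have h' : ∀ w : ℂ, L w = (w.re : ℂ) • L 1 + (w.im : ℂ) • L I := fun w => by
    rw [h w]; simp
  rw [h' (exp (θ * I)), h' (I * exp (θ * I)), ← exp_neg]
  simp only [smul_add, smul_smul, mul_re, mul_im, I_re, I_im, exp_ofReal_mul_I_re,
    exp_ofReal_mul_I_im]
  rw [show -((θ : ℂ) * I) = ((-θ : ℝ) : ℂ) * I by push_cast; ring]
  have h2 : exp (((-θ : ℝ) : ℂ) * I) = Real.cos θ - Real.sin θ * I := by
    rw [exp_mul_I, ← ofReal_cos, ← ofReal_sin]; simp; ring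
  rw [h2]
  have e1 : ((Real.cos θ : ℂ) - Real.sin θ * I) = Real.cos θ + I * ((0 * Real.cos θ - 1 * Real.sin θ : ℝ) : ℂ) := by
    push_cast; ring
  have e2 : ((Real.cos θ : ℂ) - Real.sin θ * I) * I = Real.sin θ + I * ((0 * Real.sin θ + 1 * Real.cos θ : ℝ) : ℂ) := by
    push_cast; linear_combination (-(Complex.sin (θ:ℂ))) * I_sq
  rw [e2]
  conv_lhs => rw [e1]
  simp only [add_smul]
  abel

variable [CompleteSpace F]

theorem integral_inv_smul_dbar {f : ℂ → F} (hf : ContDiff ℝ 1 f) (hc : HasCompactSupport f) :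
    ∫ ζ : ℂ, ζ⁻¹ • dbar f ζ = -(Real.pi : ℂ) • f 0 := by
  obtain ⟨R, hR⟩ := hc.isCompact.isBounded.subset_closedBall (0 : ℂ)
  have hcD := hf.continuous_fderiv one_ne_zero
  set e : ℝ → ℂ := fun θ => exp (θ * I) with he
  have hec : Continuous e := by fun_prop
  have hen : ∀ θ, ‖e θ‖ = 1 := fun θ => norm_exp_ofReal_mul_I θ
  have he0 : ∀ θ, e θ ≠ 0 := fun θ => exp_ne_zero _
  set A : ℝ × ℝ → F := fun p => fderiv ℝ f (p.1 * e p.2) (e p.2) with hA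
  set B : ℝ × ℝ → F := fun p => fderiv ℝ f (p.1 * e p.2) (I * e p.2) with hB
  have hcarg : Continuous fun p : ℝ × ℝ => ((p.1 : ℂ) * e p.2) := by fun_prop
  have hAc : Continuous A := (hcD.comp hcarg).clm_apply (by fun_prop)
  have hBc : Continuous B := (hcD.comp hcarg).clm_apply (by fun_prop)
  have hzero : ∀ p : ℝ × ℝ, R < p.1 → fderiv ℝ f (p.1 * e p.2) = 0 := fun p hp => by
    have : (p.1 * e p.2 : ℂ) ∉ tsupport f := fun h => by
      have := hR h
      simp only [mem_closedBall, dist_zero_right, norm_mul, hen, mul_one, norm_real] at this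
      exact absurd (le_trans (le_abs_self _) this) (not_le.2 hp)
    exact (image_eq_zero_of_notMem_tsupport fun h => this (tsupport_fderiv_subset ℝ h))
  have hinteg : ∀ C : ℝ × ℝ → F, Continuous C → (∀ p : ℝ × ℝ, R < p.1 → C p = 0) →
      IntegrableOn C (Ioi 0 ×ˢ Ioo (-Real.pi) Real.pi) (volume.prod volume) := by
    intro C hC h0
    have : IntegrableOn C (Icc 0 R ×ˢ Icc (-Real.pi) Real.pi) (volume.prod volume) :=
      hC.continuousOn.integrableOn_compact (isCompact_Icc.prod isCompact_Icc)
    refine this.of_forall_sdiff_eq_zero (measurableSet_Ioi.prod measurableSet_Ioo) ?_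
    rintro ⟨r, θ⟩ ⟨⟨h1, h2⟩, h3⟩
    refine h0 _ (not_le.1 fun h => h3 ⟨⟨le_of_lt h1, h⟩, ⟨h2.1.le, h2.2.le⟩⟩)
  have hAi := hinteg A hAc fun p hp => by simp [hA, hzero p hp]
  have hBi := hinteg B hBc fun p hp => by simp [hB, hzero p hp]
  have hfd : ∀ z, HasFDerivAt f (fderiv ℝ f z) z := fun z =>
    (hf.differentiable one_ne_zero z).hasFDerivAt
  have hIA : ∫ p in Ioi 0 ×ˢ Ioo (-Real.pi) Real.pi, A p ∂(volume.prod volume)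
      = -(2 * Real.pi) • f 0 := by
    rw [← setIntegral_prod_swap, setIntegral_prod (fun z => A z.swap) hAi.swap]
    have : ∀ θ : ℝ, ∫ r in Ioi (0 : ℝ), A (r, θ) = - f 0 := fun θ => by
      have hd : ∀ r : ℝ, HasDerivAt (fun r : ℝ => f (r * e θ)) (A (r, θ)) r := fun r => by
        have h1 : HasDerivAt (fun r : ℝ => (r : ℂ) * e θ) (e θ) r := by
          simpa using (ofRealCLM.hasDerivAt (x := r)).mul_const (e θ)
        exact (hfd _).comp_hasDerivAt r h1
      have h2 := HasCompactSupport.integral_Ioi_deriv_eq (f := fun r : ℝ => f (r * e θ))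
        (hf.comp (ofRealCLM.contDiff.mul contDiff_const)) ?_ 0
      · rw [← show deriv (fun r : ℝ => f (r * e θ)) = fun r => A (r, θ) from
          funext fun r => (hd r).deriv]
        simpa using h2
      · refine HasCompactSupport.of_support_subset_isCompact (isCompact_Icc (a := -R) (b := R)) ?_
        intro r hr
        have := hR (subset_tsupport _ hr)
        simp only [mem_closedBall, dist_zero_right, norm_mul, hen, mul_one, norm_real] at this
        exact abs_le.1 this
    simp only [Prod.swap_prod_mk, this]
    simp [Real.pi_pos.le, two_mul, Measure.real]
    module
  have hIB : ∫ p in Ioi 0 ×ˢ Ioo (-Real.pi) Real.pi, B p ∂(volume.prod volume) = 0 := by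
    rw [setIntegral_prod _ hBi]
    refine setIntegral_eq_zero_of_forall_eq_zero fun r hr => ?_
    have hr : (0 : ℝ) < r := hr
    rw [← integral_Ioc_eq_integral_Ioo, ← intervalIntegral.integral_of_le (by linarith [Real.pi_pos])]
    have hd : ∀ θ : ℝ, HasDerivAt (fun θ : ℝ => r⁻¹ • f (r * e θ)) (B (r, θ)) θ := fun θ => by
      have h1 : HasDerivAt (fun θ : ℝ => (r : ℂ) * e θ) (r * (e θ * I)) θ := by
        have : HasDerivAt (fun θ : ℝ => (θ : ℂ) * I) I θ := by
          simpa using (ofRealCLM.hasDerivAt (x := θ)).mul_const I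
        exact this.cexp.const_mul (r : ℂ)
      have h2 := ((hfd _).comp_hasDerivAt θ h1).const_smul r⁻¹
      refine h2.congr_deriv ?_
      symm
      change fderiv ℝ f (r * e θ) (I * e θ) = _
      rw [← map_smul]
      congr 1
      rw [real_smul]
      have hr' : (r : ℂ) ≠ 0 := by exact_mod_cast hr.ne'
      push_cast
      field_simp
    rw [intervalIntegral.integral_eq_sub_of_hasDerivAt (fun θ _ => hd θ)
      ((hBc.comp (by fun_prop : Continuous fun θ : ℝ => (r, θ))).intervalIntegrable _ _)]
    have : e Real.pi = e (-Real.pi) := by simp [he, exp_neg]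
    rw [this, sub_self]
  rw [← Complex.integral_comp_polarCoord_symm]
  have heq : ∀ p ∈ polarCoord.target,
      p.1 • ((Complex.polarCoord.symm p)⁻¹ • dbar f (Complex.polarCoord.symm p)) =
        (1 / 2 : ℂ) • (A p + I • B p) := by
    intro p hp
    rw [polarCoord_target] at hp
    have hp1 : (0 : ℝ) < p.1 := hp.1
    have h1 : Complex.polarCoord.symm p = p.1 * e p.2 := by
      rw [Complex.polarCoord_symm_apply, he]
      simp only
      rw [exp_mul_I, ← ofReal_cos, ← ofReal_sin]
    rw [h1, dbar_def, hA, hB, smul_comm _ (1 / 2 : ℂ), smul_comm _ (1 / 2 : ℂ)]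
    congr 1
    simp only
    rw [← exp_inv_smul_dbar, ← Complex.coe_smul, smul_smul, mul_inv, ← mul_assoc,
      mul_inv_cancel₀ (by exact_mod_cast hp1.ne'), one_mul]
  rw [setIntegral_congr_fun polarCoord.open_target.measurableSet heq, polarCoord_target,
    integral_smul]
  rw [Measure.volume_eq_prod, integral_add (f := A) (g := fun a => I • B a) hAi (hBi.smul I), integral_smul, hIA, hIB, smul_zero,
    add_zero, ← Complex.coe_smul, smul_smul]
  congr 1
  push_cast
  ring

end Pompeiu

section CauchyTransform

variable {F : Type} [NormedAddCommGroup F] [NormedSpace ℂ F]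

theorem dbar_sub_left {f : ℂ → F} (z ζ : ℂ) :
    dbar (fun ζ => f (z - ζ)) ζ = - dbar f (z - ζ) := by
  have h : fderiv ℝ (fun ζ => f (z - ζ)) ζ = - fderiv ℝ f (z - ζ) := by
    have h1 : f = fun w => (fun ζ => f (z - ζ)) (z - w) := by simp
    by_cases hf : DifferentiableAt ℝ f (z - ζ)
    · have h2 := hf.hasFDerivAt.comp ζ ((hasFDerivAt_id (𝕜 := ℝ) ζ).const_sub z)
      refine h2.fderiv.trans ?_
      ext; simp
    · rw [fderiv_zero_of_not_differentiableAt hf, neg_zero, fderiv_zero_of_not_differentiableAt]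
      intro h
      refine hf ?_
      have h3 : DifferentiableAt ℝ (fun w : ℂ => z - w) (z - ζ) := by fun_prop
      rw [h1]
      refine DifferentiableAt.comp (g := fun ζ => f (z - ζ)) (z - ζ) ?_ h3
      simpa using h
  simp only [dbar, h, neg_apply]
  module

theorem cauchyT_eq (f : ℂ → F) (z : ℂ) :
    cauchyT f z = (1 / (Real.pi : ℂ)) • ∫ ζ : ℂ, (z - ζ)⁻¹ • f ζ := by
  rw [cauchyT, ← integral_sub_left_eq_self _ volume z]
  simp

theorem cauchyT_eq_convolution (f : ℂ → F) (z : ℂ) :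
    cauchyT f z = (1 / (Real.pi : ℂ)) •
      convolution (fun ζ : ℂ => ζ⁻¹) f (ContinuousLinearMap.lsmul ℝ ℂ) volume z := by
  simp [cauchyT, convolution]

theorem integrable_inv_smul {f : ℂ → F} (hf : Continuous f) (hc : HasCompactSupport f) (z : ℂ) :
    Integrable fun ζ : ℂ => ζ⁻¹ • f (z - ζ) :=
  hc.convolutionExists_right (ContinuousLinearMap.lsmul ℝ ℂ) locallyIntegrable_inv hf z

theorem HasCompactSupport.dbar {f : ℂ → F} (hc : HasCompactSupport f) :
    HasCompactSupport (dbar f) := by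
  refine (hc.fderiv ℝ).mono' (Function.support_subset_iff'.2 fun z hz => ?_)
  simp [_root_.dbar, image_eq_zero_of_notMem_tsupport hz]

theorem ContDiff.dbar {f : ℂ → F} (hf : ContDiff ℝ (⊤ : ℕ∞) f) :
    ContDiff ℝ (⊤ : ℕ∞) (dbar f) := by
  have := hf.fderiv_right (m := (⊤ : ℕ∞)) (by simp)
  exact ((this.clm_apply contDiff_const).add ((this.clm_apply contDiff_const).const_smul I)).const_smul
    (1 / 2 : ℂ)

theorem cauchyT_dbar [CompleteSpace F] {f : ℂ → F} (hf : ContDiff ℝ 1 f) (hc : HasCompactSupport f) (z : ℂ) :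
    cauchyT (dbar f) z = f z := by
  have h1 : ContDiff ℝ 1 fun ζ => f (z - ζ) := hf.comp (by fun_prop)
  have h2 : HasCompactSupport fun ζ => f (z - ζ) :=
    hc.comp_homeomorph (Homeomorph.subLeft z)
  have h := integral_inv_smul_dbar h1 h2
  simp only [dbar_sub_left, smul_neg, integral_neg, sub_zero, neg_smul, neg_inj] at h
  rw [cauchyT, h, smul_smul, one_div, inv_mul_cancel₀ (by exact_mod_cast Real.pi_ne_zero), one_smul]

theorem hasFDerivAt_cauchyT {f : ℂ → F} (hf : ContDiff ℝ 1 f) (hc : HasCompactSupport f) (z : ℂ) :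
    HasFDerivAt (cauchyT f) (cauchyT (fderiv ℝ f) z) z := by
  have h := (hc.hasFDerivAt_convolution_right (ContinuousLinearMap.lsmul ℝ ℂ)
    locallyIntegrable_inv hf z).const_smul (1 / (Real.pi : ℂ))
  rw [show cauchyT f = _ from funext (cauchyT_eq_convolution f)]
  refine h.congr_fderiv ?_
  rw [cauchyT_eq_convolution]
  rfl

theorem fderiv_cauchyT {f : ℂ → F} (hf : ContDiff ℝ 1 f) (hc : HasCompactSupport f) :
    fderiv ℝ (cauchyT f) = cauchyT (fderiv ℝ f) :=
  funext fun z => (hasFDerivAt_cauchyT hf hc z).fderiv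

theorem contDiff_cauchyT {f : ℂ → F} (hf : ContDiff ℝ (⊤ : ℕ∞) f) (hc : HasCompactSupport f) :
    ContDiff ℝ (⊤ : ℕ∞) (cauchyT f) := by
  rw [show cauchyT f = _ from funext (cauchyT_eq_convolution f)]
  exact (hc.contDiff_convolution_right (ContinuousLinearMap.lsmul ℝ ℂ)
    locallyIntegrable_inv hf).const_smul _

theorem dbar_cauchyT [CompleteSpace F] {f : ℂ → F} (hf : ContDiff ℝ 1 f) (hc : HasCompactSupport f) (z : ℂ) :
    dbar (cauchyT f) z = f z := by
  have hi := integrable_inv_smul (hf.continuous_fderiv one_ne_zero) (hc.fderiv ℝ) z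
  have key : ∀ v : ℂ, fderiv ℝ (cauchyT f) z v = cauchyT (fun w => fderiv ℝ f w v) z := by
    intro v
    rw [fderiv_cauchyT hf hc, cauchyT, cauchyT, smul_apply,
      ContinuousLinearMap.integral_apply hi]
    rfl
  have hv : ∀ v : ℂ, Integrable fun ζ : ℂ => ζ⁻¹ • fderiv ℝ f (z - ζ) v := fun v =>
    (ContinuousLinearMap.apply ℝ F v).integrable_comp hi
  rw [← cauchyT_dbar hf hc z, dbar_def, key, key]
  simp only [cauchyT]
  rw [smul_comm I, ← smul_add, ← integral_smul,
    ← integral_add (g := fun a => I • a⁻¹ • (fderiv ℝ f (z - a)) I) (hv 1) ((hv I).smul I),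
    smul_comm, ← integral_smul]
  congr 2
  ext ζ
  simp only [dbar]
  module

theorem integral_dbar {f : ℂ → ℂ} (hf : ContDiff ℝ 1 f) (hc : HasCompactSupport f) :
    ∫ z, dbar f z = 0 := by
  have h := integral_inv_smul_dbar (f := fun z => z * f z) (contDiff_id.mul hf) hc.mul_left
  simp only [zero_mul, smul_zero] at h
  rw [← h]
  refine integral_congr_ae ?_
  have : ({0} : Set ℂ)ᶜ ∈ ae (volume : Measure ℂ) := by
    rw [mem_ae_iff, compl_compl]; simp
  filter_upwards [this] with z hz
  have hz : z ≠ 0 := hz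
  have hd : fderiv ℝ (fun z => z * f z) z = z • fderiv ℝ f z + f z • ContinuousLinearMap.id ℝ ℂ := by
    exact ((hasFDerivAt_id z).mul (hf.differentiable one_ne_zero z).hasFDerivAt).fderiv
  simp only [dbar, hd, smul_eq_mul, add_apply, smul_apply,
    ContinuousLinearMap.id_apply]
  field_simp
  linear_combination (-f z) * I_sq

theorem norm_cauchyT_le {f : ℂ → F} {R M : ℝ} (hR : Function.support f ⊆ closedBall 0 R) (hM0 : 0 ≤ M)
    (hM : ∀ z, ‖f z‖ ≤ M) (z : ℂ) :
    ‖cauchyT f z‖ ≤ ((∫ ζ in closedBall (0 : ℂ) 1, ‖ζ⁻¹‖) + volume.real (closedBall (0 : ℂ) R)) * M := by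
  have i1 : Integrable ((closedBall (0 : ℂ) 1).indicator fun ζ => ‖ζ⁻¹‖) :=
    (integrable_indicator_iff measurableSet_closedBall).2 (integrableOn_inv_closedBall 1).norm
  have i2 : Integrable ((closedBall z R).indicator fun _ : ℂ => (1 : ℝ)) :=
    (integrable_indicator_iff measurableSet_closedBall).2
      (integrableOn_const (by exact (measure_closedBall_lt_top).ne))
  have h1 : ‖∫ ζ : ℂ, ζ⁻¹ • f (z - ζ)‖ ≤ ∫ ζ : ℂ,
      ((closedBall (0 : ℂ) 1).indicator (fun ζ => ‖ζ⁻¹‖) ζ + (closedBall z R).indicator (fun _ => 1) ζ) * M := by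
    refine norm_integral_le_of_norm_le ((i1.add i2).mul_const M) (Filter.Eventually.of_forall fun ζ => ?_)
    by_cases hf : f (z - ζ) = 0
    · rw [hf, smul_zero, norm_zero]
      refine mul_nonneg (add_nonneg (indicator_nonneg (fun _ _ => norm_nonneg _) _)
        (indicator_nonneg (fun _ _ => zero_le_one) _)) hM0
    · have hz : ζ ∈ closedBall z R := by
        have := hR (Function.mem_support.2 hf)
        rwa [mem_closedBall_zero_iff, ← dist_eq_norm, dist_comm, ← mem_closedBall] at this
      rw [norm_smul, indicator_of_mem hz]
      refine mul_le_mul ?_ (hM _) (norm_nonneg _) (add_nonneg (indicator_nonneg (fun _ _ => norm_nonneg _) _) zero_le_one)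
      by_cases h : ζ ∈ closedBall (0 : ℂ) 1
      · rw [indicator_of_mem h]; simp
      · rw [indicator_of_notMem h, zero_add, norm_inv]
        simp only [mem_closedBall, dist_zero_right, not_le] at h
        exact inv_le_one_of_one_le₀ h.le
  rw [integral_mul_const, integral_add i1 i2, integral_indicator measurableSet_closedBall,
    integral_indicator measurableSet_closedBall] at h1
  have h3 : ∫ x in closedBall z R, (1 : ℝ) = volume.real (closedBall (0 : ℂ) R) := by
    simp [Measure.real]
  rw [h3] at h1
  rw [cauchyT, norm_smul]
  have : ‖(1 / (Real.pi : ℂ))‖ ≤ 1 := by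
    rw [norm_div, norm_one, norm_real, Real.norm_of_nonneg Real.pi_pos.le, div_le_one Real.pi_pos]
    linarith [Real.two_le_pi]
  nlinarith [norm_nonneg (∫ ζ : ℂ, ζ⁻¹ • f (z - ζ))]

theorem norm_iteratedFDeriv_cauchyT_le (R : ℝ) : ∃ C : ℝ, 0 ≤ C ∧
    ∀ (k : ℕ) {F : Type} [NormedAddCommGroup F] [NormedSpace ℂ F] [CompleteSpace F] (f : ℂ → F) (M : ℝ),
      ContDiff ℝ (⊤ : ℕ∞) f → tsupport f ⊆ closedBall 0 R → (∀ z, ‖iteratedFDeriv ℝ k f z‖ ≤ M) →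
      ∀ z, ‖iteratedFDeriv ℝ k (cauchyT f) z‖ ≤ C * M := by
  refine ⟨(∫ ζ in closedBall (0 : ℂ) 1, ‖ζ⁻¹‖) + volume.real (closedBall (0 : ℂ) R),
    add_nonneg (integral_nonneg fun _ => norm_nonneg _) measureReal_nonneg, fun k => ?_⟩
  induction k with
  | zero =>
    intro F _ _ _ f M hf hs hM z
    simp only [norm_iteratedFDeriv_zero] at hM ⊢
    exact norm_cauchyT_le ((subset_tsupport f).trans hs) ((norm_nonneg _).trans (hM 0)) hM z
  | succ k ih =>
    intro F _ _ _ f M hf hs hM z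
    have hc : HasCompactSupport f :=
      (isCompact_closedBall _ _).of_isClosed_subset (isClosed_tsupport _) hs
    rw [← norm_iteratedFDeriv_fderiv, fderiv_cauchyT (hf.of_le (by simp)) hc]
    refine ih (fderiv ℝ f) M (hf.fderiv_right (by simp)) ((tsupport_fderiv_subset ℝ).trans hs) ?_ z
    intro z
    rw [norm_iteratedFDeriv_fderiv]
    exact hM z

end CauchyTransform

section Dbar

theorem dbar_sub {f g : ℂ → ℂ} {z : ℂ} (hf : DifferentiableAt ℝ f z) (hg : DifferentiableAt ℝ g z) :
    dbar (fun z => f z - g z) z = dbar f z - dbar g z := by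
  rw [dbar, fderiv_fun_sub hf hg]
  simp only [dbar, sub_apply, smul_eq_mul]
  ring

theorem dbar_mul {f g : ℂ → ℂ} {z : ℂ} (hf : DifferentiableAt ℝ f z) (hg : DifferentiableAt ℝ g z) :
    dbar (fun z => f z * g z) z = f z * dbar g z + g z * dbar f z := by
  rw [dbar, fderiv_fun_mul hf hg]
  simp only [dbar, add_apply, smul_apply, smul_eq_mul]
  ring

theorem dbar_eq_zero_of_differentiableAt {f : ℂ → ℂ} {z : ℂ} (hf : DifferentiableAt ℂ f z) :
    dbar f z = 0 := by
  rw [dbar, (differentiableAt_complex_iff_differentiableAt_real.1 hf).2]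
  simp only [smul_eq_mul]
  linear_combination (1 / 2 : ℂ) * (fderiv ℝ f z 1) * I_sq

theorem differentiableAt_of_dbar_eq_zero {f : ℂ → ℂ} {z : ℂ} (hf : DifferentiableAt ℝ f z)
    (h : dbar f z = 0) : DifferentiableAt ℂ f z := by
  refine differentiableAt_complex_iff_differentiableAt_real.2 ⟨hf, ?_⟩
  simp only [dbar, smul_eq_mul] at h ⊢
  linear_combination (-2 * I) * h + (fderiv ℝ f z I) * I_sq

/-- The chain rule for a holomorphic outer function. -/
theorem dbar_comp_holomorphic {f g : ℂ → ℂ} {z : ℂ} (hf : DifferentiableAt ℂ f (g z))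
    (hg : DifferentiableAt ℝ g z) : dbar (fun z => f (g z)) z = deriv f (g z) * dbar g z := by
  have h : HasFDerivAt (fun z => f (g z)) _ z :=
    (hf.hasDerivAt.hasFDerivAt.restrictScalars ℝ).comp z hg.hasFDerivAt
  rw [dbar, h.fderiv]
  simp [dbar]
  ring

end Dbar

section Flat

variable {E F G : Type} [NormedAddCommGroup E] [NormedSpace ℝ E] [NormedAddCommGroup F]
  [NormedSpace ℝ F] [NormedAddCommGroup G] [NormedSpace ℝ G]

/-- All derivatives of `f` vanish at `z`. -/
def FlatAt (f : ℂ → F) (z : ℂ) : Prop := ∀ k, iteratedFDeriv ℝ k f z = 0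

theorem FlatAt.eq_zero {f : ℂ → F} {z : ℂ} (h : FlatAt f z) : f z = 0 := by
  have := congrArg norm (h 0)
  rwa [norm_iteratedFDeriv_zero, norm_zero, norm_eq_zero] at this

theorem FlatAt.fderiv {f : ℂ → F} {z : ℂ} (h : FlatAt f z) : FlatAt (fderiv ℝ f) z := fun k => by
  rw [← norm_eq_zero, norm_iteratedFDeriv_fderiv, h, norm_zero]

theorem FlatAt.fderiv_eq_zero {f : ℂ → F} {z : ℂ} (h : FlatAt f z) : _root_.fderiv ℝ f z = 0 :=
  h.fderiv.eq_zero

theorem FlatAt.congr {f g : ℂ → F} {z : ℂ} (h : FlatAt f z) (hfg : g =ᶠ[nhds z] f) :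
    FlatAt g z := fun k => by
  rw [(hfg.iteratedFDeriv ℝ k).eq_of_nhds, h]

theorem flatAt_zero (z : ℂ) : FlatAt (fun _ => (0 : F)) z := fun k => by
  simp

theorem flatAt_of_notMem_tsupport {f : ℂ → F} {z : ℂ} (h : z ∉ tsupport f) : FlatAt f z :=
  (flatAt_zero z).congr (notMem_tsupport_iff_eventuallyEq.1 h)

theorem FlatAt.add {f g : ℂ → F} {z : ℂ} (hf : ContDiffAt ℝ (⊤ : ℕ∞) f z)
    (hg : ContDiffAt ℝ (⊤ : ℕ∞) g z)
    (h : FlatAt f z) (h' : FlatAt g z) : FlatAt (fun z => f z + g z) z := fun k => by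
  change iteratedFDeriv ℝ k (f + g) z = 0
  rw [iteratedFDeriv_add_apply (hf.of_le (by exact_mod_cast le_top))
    (hg.of_le (by exact_mod_cast le_top)), h, h', add_zero]

theorem FlatAt.clm_comp {f : ℂ → F} {z : ℂ} (L : F →L[ℝ] G) (hf : ContDiffAt ℝ (⊤ : ℕ∞) f z)
    (h : FlatAt f z) : FlatAt (fun z => L (f z)) z := fun k => by
  have := L.norm_iteratedFDeriv_comp_left (n := k) hf (by exact_mod_cast le_top)
  rw [h, norm_zero, mul_zero] at this
  exact norm_le_zero_iff.1 this

theorem FlatAt.bilinear (B : E →L[ℝ] F →L[ℝ] G) {f : ℂ → E} {g : ℂ → F} {V : Set ℂ} {z : ℂ}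
    (hV : IsOpen V) (hz : z ∈ V) (hf : ContDiffOn ℝ (⊤ : ℕ∞) f V) (hg : ContDiffOn ℝ (⊤ : ℕ∞) g V)
    (h : FlatAt f z) : FlatAt (fun z => B (f z) (g z)) z := fun k => by
  have := B.norm_iteratedFDerivWithin_le_of_bilinear hf hg hV.uniqueDiffOn hz (n := k)
    (by exact_mod_cast le_top)
  rw [iteratedFDerivWithin_of_isOpen k hV hz, Finset.sum_eq_zero, mul_zero] at this
  · exact norm_le_zero_iff.1 this
  · intro i _
    rw [iteratedFDerivWithin_of_isOpen i hV hz, h i]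
    simp

theorem FlatAt.comp {f : ℂ → F} {g : ℂ → ℂ} {V W : Set ℂ} {z : ℂ}
    (hV : IsOpen V) (hW : IsOpen W) (hz : z ∈ V) (hm : MapsTo g V W)
    (hf : ContDiffOn ℝ (⊤ : ℕ∞) f W) (hg : ContDiffOn ℝ (⊤ : ℕ∞) g V)
    (h : FlatAt f (g z)) : FlatAt (fun z => f (g z)) z := fun k => by
  have := norm_iteratedFDerivWithin_comp_le (n := k) hf hg (by exact_mod_cast le_top)
    hW.uniqueDiffOn hV.uniqueDiffOn hm hz (C := 0)
    (D := 1 + ∑ i ∈ Finset.range (k + 1), ‖iteratedFDerivWithin ℝ i g V z‖) ?_ ?_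
  · rw [iteratedFDerivWithin_of_isOpen k hV hz] at this
    simp only [mul_zero, zero_mul] at this
    exact norm_le_zero_iff.1 this
  · intro i _
    rw [iteratedFDerivWithin_of_isOpen i hW (hm hz), h i, norm_zero]
  · intro i hi hik
    have h1 : ‖iteratedFDerivWithin ℝ i g V z‖ ≤ ∑ i ∈ Finset.range (k + 1), ‖iteratedFDerivWithin ℝ i g V z‖ :=
      Finset.single_le_sum (f := fun i => ‖iteratedFDerivWithin ℝ i g V z‖)
        (fun _ _ => norm_nonneg _) (Finset.mem_range.2 (by omega))
    have h2 : (0:ℝ) ≤ ∑ i ∈ Finset.range (k + 1), ‖iteratedFDerivWithin ℝ i g V z‖ :=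
      Finset.sum_nonneg fun _ _ => norm_nonneg _
    calc _ ≤ 1 + ∑ i ∈ Finset.range (k + 1), ‖iteratedFDerivWithin ℝ i g V z‖ := by linarith
      _ ≤ _ := le_self_pow₀ (by linarith) (by omega)

theorem hasFDerivAt_indicator_of_flat {f : ℂ → F} {Ω : Set ℂ} (hf : Differentiable ℝ f)
    (hflat : ∀ z ∈ frontier Ω, FlatAt f z) (z : ℂ) :
    HasFDerivAt (Ω.indicator f) (Ω.indicator (fderiv ℝ f) z) z := by
  by_cases hz : z ∈ frontier Ω
  · have h0 := (hflat z hz).fderiv_eq_zero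
    have : Ω.indicator (fderiv ℝ f) z = 0 := by
      by_cases h : z ∈ Ω <;> simp [h, h0]
    rw [this]
    have h1 := (hf z).hasFDerivAt
    rw [h0] at h1
    have hz0 := (hflat z hz).eq_zero
    have hi : Ω.indicator f z = 0 := by
      by_cases h : z ∈ Ω <;> simp [h, hz0]
    rw [hasFDerivAt_iff_isLittleO] at h1 ⊢
    refine Asymptotics.IsBigO.trans_isLittleO (Asymptotics.IsBigO.of_bound 1 ?_) h1
    refine Filter.Eventually.of_forall fun w => ?_
    rw [hi, hz0]
    simpa using norm_indicator_le_norm_self f w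
  · by_cases h : z ∈ Ω
    · have hzi : z ∈ interior Ω := by
        by_contra h'
        exact hz ⟨subset_closure h, h'⟩
      rw [indicator_of_mem h]
      refine (hf z).hasFDerivAt.congr_of_eventuallyEq ?_
      filter_upwards [isOpen_interior.mem_nhds hzi] with w hw
      exact indicator_of_mem (interior_subset hw) _
    · have hzc : z ∉ closure Ω := fun h' => hz ⟨h', fun h'' => h (interior_subset h'')⟩
      rw [indicator_of_notMem h]
      refine (hasFDerivAt_const (0 : F) z).congr_of_eventuallyEq ?_
      filter_upwards [isClosed_closure.isOpen_compl.mem_nhds hzc] with w hw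
      exact indicator_of_notMem (fun h => hw (subset_closure h)) _

theorem fderiv_indicator_of_flat {f : ℂ → F} {Ω : Set ℂ} (hf : Differentiable ℝ f)
    (hflat : ∀ z ∈ frontier Ω, FlatAt f z) :
    fderiv ℝ (Ω.indicator f) = Ω.indicator (fderiv ℝ f) :=
  funext fun z => (hasFDerivAt_indicator_of_flat hf hflat z).fderiv

theorem contDiff_nat_indicator_of_flat (k : ℕ) : ∀ {F : Type} [NormedAddCommGroup F] [NormedSpace ℝ F]
    {f : ℂ → F} {Ω : Set ℂ}, ContDiff ℝ (⊤ : ℕ∞) f → (∀ z ∈ frontier Ω, FlatAt f z) →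
    ContDiff ℝ k (Ω.indicator f) := by
  induction k with
  | zero =>
    intro F _ _ f Ω hf hflat
    refine contDiff_zero.2 ?_
    refine Differentiable.continuous (𝕜 := ℝ) fun z => ?_
    exact (hasFDerivAt_indicator_of_flat (hf.differentiable (by simp)) hflat z).differentiableAt
  | succ k ih =>
    intro F _ _ f Ω hf hflat
    have hd : Differentiable ℝ f := hf.differentiable (by simp)
    refine contDiff_succ_iff_fderiv.2 ⟨fun z =>
      (hasFDerivAt_indicator_of_flat hd hflat z).differentiableAt, fun h => absurd h (WithTop.natCast_ne_top k), ?_⟩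
    rw [fderiv_indicator_of_flat hd hflat]
    exact ih (hf.fderiv_right (by simp)) fun z hz => (hflat z hz).fderiv

theorem contDiff_indicator_of_flat {f : ℂ → F} {Ω : Set ℂ} (hf : ContDiff ℝ (⊤ : ℕ∞) f)
    (hflat : ∀ z ∈ frontier Ω, FlatAt f z) : ContDiff ℝ (⊤ : ℕ∞) (Ω.indicator f) :=
  contDiff_infty.2 fun k => contDiff_nat_indicator_of_flat k hf hflat

theorem norm_iteratedFDeriv_indicator_of_flat (k : ℕ) : ∀ {F : Type} [NormedAddCommGroup F]
    [NormedSpace ℝ F] {f : ℂ → F} {Ω : Set ℂ}, ContDiff ℝ (⊤ : ℕ∞) f →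
    (∀ z ∈ frontier Ω, FlatAt f z) → ∀ z,
    ‖iteratedFDeriv ℝ k (Ω.indicator f) z‖ = Ω.indicator (fun z => ‖iteratedFDeriv ℝ k f z‖) z := by
  induction k with
  | zero =>
    intro F _ _ f Ω hf hflat z
    simp [norm_indicator_eq_indicator_norm]
  | succ k ih =>
    intro F _ _ f Ω hf hflat z
    have hd : Differentiable ℝ f := hf.differentiable (by simp)
    rw [← norm_iteratedFDeriv_fderiv, fderiv_indicator_of_flat hd hflat,
      ih (hf.fderiv_right (by simp)) fun z hz => (hflat z hz).fderiv]
    simp only [norm_iteratedFDeriv_fderiv]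

theorem norm_le_infDist_pow_of_flat (L : ℕ) {S : Set ℂ} (hS : IsClosed S) (hne : S.Nonempty) {M : ℝ} :
    ∀ {F : Type} [NormedAddCommGroup F] [NormedSpace ℝ F] {f : ℂ → F}, ContDiff ℝ (⊤ : ℕ∞) f →
    (∀ z ∈ S, FlatAt f z) → (∀ z, ‖iteratedFDeriv ℝ L f z‖ ≤ M) → ∀ z, ‖f z‖ ≤ M * infDist z S ^ L := by
  induction L with
  | zero =>
    intro F _ _ f hf _ hM z
    simpa using hM z
  | succ L ih =>
    intro F _ _ f hf hflat hM z
    obtain ⟨p, hp, hpd⟩ := hS.exists_infDist_eq_dist hne z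
    have hM0 : 0 ≤ M := (norm_nonneg _).trans (hM 0)
    have hb : ∀ w ∈ segment ℝ p z, ‖fderiv ℝ f w‖ ≤ M * infDist z S ^ L := by
      intro w hw
      refine (ih (hf.fderiv_right (by simp)) (fun z hz => (hflat z hz).fderiv)
        (fun z => by rw [norm_iteratedFDeriv_fderiv]; exact hM z) w).trans ?_
      gcongr
      · exact infDist_nonneg
      · refine (infDist_le_dist_of_mem hp).trans ?_
        rw [hpd, dist_comm, dist_comm z]
        have := dist_add_dist_of_mem_segment hw
        linarith [dist_nonneg (x := w) (y := z)]
    have := (convex_segment p z).norm_image_sub_le_of_norm_fderiv_le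
      (fun w _ => (hf.differentiable (by simp)) w) hb (left_mem_segment _ _ _) (right_mem_segment _ _ _)
    rw [(hflat p hp).eq_zero, sub_zero, ← dist_eq_norm, ← hpd] at this
    rwa [pow_succ, ← mul_assoc]

end Flat

section Profile

/-- The profile `e^{-x}`, cut off to the left of `-1`. -/
def profile (x : ℝ) : ℝ := Real.exp (-x) * Real.smoothTransition (2 * x + 2)

theorem profile_eq_exp {x : ℝ} (hx : -(1 / 2) ≤ x) : profile x = Real.exp (-x) := by
  rw [profile, Real.smoothTransition.one_of_one_le (by linarith), mul_one]

theorem exists_iterate_deriv_profile (j : ℕ) : ∃ q : ℝ → ℝ, ContDiff ℝ (⊤ : ℕ∞) q ∧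
    (∀ x < -1, q x = 0) ∧ (∃ c, ∀ x > -(1 / 2), q x = c) ∧
    deriv^[j] profile = fun x => Real.exp (-x) * q x := by
  induction j with
  | zero =>
    refine ⟨fun x => Real.smoothTransition (2 * x + 2), ?_, ?_, ⟨1, ?_⟩, rfl⟩
    · exact Real.smoothTransition.contDiff.comp (by fun_prop)
    · intro x hx
      exact Real.smoothTransition.zero_of_nonpos (by linarith)
    · intro x hx
      exact Real.smoothTransition.one_of_one_le (by linarith)
  | succ j ih =>
    obtain ⟨q, hq, h0, ⟨c, hc⟩, hj⟩ := ih
    have hd : ContDiff ℝ (⊤ : ℕ∞) (deriv q) := (contDiff_infty_iff_deriv.1 hq).2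
    refine ⟨fun x => deriv q x - q x, hd.sub hq, ?_, ⟨-c, ?_⟩, ?_⟩
    · intro x hx
      have : deriv q x = 0 := by
        have : q =ᶠ[nhds x] fun _ => 0 := by
          filter_upwards [Iio_mem_nhds hx] with y hy using h0 y hy
        rw [this.deriv_eq, deriv_const]
      simp only [this, h0 x hx, sub_zero]
    · intro x hx
      have : deriv q x = 0 := by
        have : q =ᶠ[nhds x] fun _ => c := by
          filter_upwards [Ioi_mem_nhds hx] with y hy using hc y hy
        rw [this.deriv_eq, deriv_const]
      simp only [this, hc x hx, zero_sub]
    · rw [Function.iterate_succ_apply', hj]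
      ext x
      have h1 : HasDerivAt (fun x : ℝ => Real.exp (-x)) (-Real.exp (-x)) x := by
        simpa using (hasDerivAt_neg x).exp
      refine (h1.mul ((hq.differentiable (by simp)) x).hasDerivAt).deriv.trans ?_
      ring

theorem contDiff_iterate_deriv_profile (j : ℕ) : ContDiff ℝ (⊤ : ℕ∞) (deriv^[j] profile) := by
  obtain ⟨q, hq, -, -, hj⟩ := exists_iterate_deriv_profile j
  rw [hj]
  exact (Real.contDiff_exp.comp contDiff_neg).mul hq

theorem exists_abs_iterate_deriv_profile_le (j : ℕ) : ∃ C : ℝ, 0 ≤ C ∧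
    ∀ x, |(deriv^[j] profile) x| ≤ C * Real.exp (-x) ∧ |(deriv^[j] profile) x| ≤ C := by
  obtain ⟨q, hq, h0, ⟨c, hc⟩, hj⟩ := exists_iterate_deriv_profile j
  obtain ⟨M, hM⟩ := (isCompact_Icc (a := (-1 : ℝ)) (b := 0)).exists_bound_of_continuousOn
    hq.continuous.continuousOn
  have hM0 : 0 ≤ M := (norm_nonneg _).trans (hM 0 (by simp))
  have hb : ∀ x, |q x| ≤ M := by
    intro x
    by_cases h1 : x < -1
    · rw [h0 x h1]; simpa using hM0
    by_cases h2 : x ≤ 0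
    · exact hM x ⟨by linarith, h2⟩
    · rw [hc x (by linarith), ← hc 0 (by norm_num)]
      exact hM 0 (by simp)
  have h1e : 1 ≤ Real.exp 1 := Real.one_le_exp (by norm_num)
  refine ⟨Real.exp 1 * M, by positivity, fun x => ?_⟩
  have hx : |(deriv^[j] profile) x| = Real.exp (-x) * |q x| := by
    rw [hj, abs_mul, abs_of_pos (Real.exp_pos _)]
  rw [hx]
  constructor
  · have : Real.exp (-x) * |q x| ≤ Real.exp (-x) * M := by gcongr; exact hb x
    nlinarith [mul_nonneg (Real.exp_pos (-x)).le hM0]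
  · by_cases h1 : x < -1
    · rw [h0 x h1]; simp; positivity
    · gcongr
      · linarith
      · exact hb x

end Profile

section Tame

theorem contDiff_of_contDiffAt_tsupport {F : Type} [NormedAddCommGroup F] [NormedSpace ℝ F]
    {f : ℂ → F} (hf : ∀ z ∈ tsupport f, ContDiffAt ℝ (⊤ : ℕ∞) f z) : ContDiff ℝ (⊤ : ℕ∞) f := by
  refine contDiff_iff_contDiffAt.2 fun z => ?_
  by_cases hz : z ∈ tsupport f
  · exact hf z hz
  · exact contDiffAt_const.congr_of_eventuallyEq (notMem_tsupport_iff_eventuallyEq.1 hz)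

/-- Smooth functions supported in a compact subset of `V` and flat along `S`. -/
structure Adm {F : Type} [NormedAddCommGroup F] [NormedSpace ℝ F] (V S : Set ℂ) (φ : ℂ → F) :
    Prop where
  contDiff : ContDiff ℝ (⊤ : ℕ∞) φ
  compact : HasCompactSupport φ
  subset : tsupport φ ⊆ V
  flat : ∀ z ∈ S, FlatAt φ z

theorem Adm.fderiv {F : Type} [NormedAddCommGroup F] [NormedSpace ℝ F] {V S : Set ℂ} {φ : ℂ → F}
    (h : Adm V S φ) : Adm V S (fderiv ℝ φ) where
  contDiff := h.contDiff.fderiv_right (by simp)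
  compact := h.compact.fderiv ℝ
  subset := (tsupport_fderiv_subset ℝ).trans h.subset
  flat := fun z hz => (h.flat z hz).fderiv

theorem Adm.bilinear {E F G : Type} [NormedAddCommGroup E] [NormedSpace ℝ E]
    [NormedAddCommGroup F] [NormedSpace ℝ F] [NormedAddCommGroup G] [NormedSpace ℝ G]
    {V S : Set ℂ} (hV : IsOpen V) {φ : ℂ → F}
    (h : Adm V S φ) (B : F →L[ℝ] G →L[ℝ] E) {g : ℂ → G} (hg : ContDiffOn ℝ (⊤ : ℕ∞) g V) :
    Adm V S fun z => B (φ z) (g z) := by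
  have hs : tsupport (fun z => B (φ z) (g z)) ⊆ tsupport φ := by
    refine closure_mono fun z hz => ?_
    contrapose! hz
    simp only [Function.mem_support, not_not] at hz
    simp [hz]
  refine ⟨contDiff_of_contDiffAt_tsupport fun z hz => ?_, h.compact.of_isClosed_subset (isClosed_tsupport _) hs,
    hs.trans h.subset, fun z hz => ?_⟩
  · have hzV := h.subset (hs hz)
    exact ((B.contDiff.comp h.contDiff).contDiffAt).clm_apply (hg.contDiffAt (hV.mem_nhds hzV))
  · by_cases hzV : z ∈ V
    · exact FlatAt.bilinear B hV hzV h.contDiff.contDiffOn hg (h.flat z hz)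
    · exact flatAt_of_notMem_tsupport fun h' => hzV (h.subset (hs h'))

variable {F : Type} [NormedAddCommGroup F] [NormedSpace ℂ F]

/-- The functions `X ^ n h(nσ) φ`. -/
def tame (X : ℂ → ℂ) (σ : ℂ → ℝ) (h : ℝ → ℝ) (n : ℤ) (φ : ℂ → F) (z : ℂ) : F :=
  (X z ^ n * (h (n * σ z) : ℂ)) • φ z

/-- The bilinear map `(v, L) ↦ (w ↦ L w • v)`. -/
def smulRightB (F : Type) [NormedAddCommGroup F] [NormedSpace ℂ F] :
    F →L[ℝ] (ℂ →L[ℝ] ℂ) →L[ℝ] (ℂ →L[ℝ] F) :=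
  (ContinuousLinearMap.compL ℝ ℂ ℂ F).comp (ContinuousLinearMap.lsmul ℝ ℂ : ℂ →L[ℝ] F →L[ℝ] F).flip

theorem smulRightB_apply (v : F) (L : ℂ →L[ℝ] ℂ) (w : ℂ) : smulRightB F v L w = L w • v := rfl

variable {V : Set ℂ} {X : ℂ → ℂ} {σ : ℂ → ℝ} {h : ℝ → ℝ}

theorem tame_eq_zero {n : ℤ} {φ : ℂ → F} {z : ℂ} (hz : φ z = 0) : tame X σ h n φ z = 0 := by
  simp [tame, hz]

theorem tsupport_tame_subset (n : ℤ) (φ : ℂ → F) : tsupport (tame X σ h n φ) ⊆ tsupport φ := by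
  refine closure_mono fun z hz => ?_
  contrapose! hz
  simp only [Function.mem_support, not_not] at hz ⊢
  exact tame_eq_zero hz

theorem contDiffOn_tame_coeff (hX : ContDiffOn ℝ (⊤ : ℕ∞) X V) (hX0 : ∀ z ∈ V, X z ≠ 0)
    (hσ : ContDiffOn ℝ (⊤ : ℕ∞) σ V) (hh : ContDiff ℝ (⊤ : ℕ∞) h) (n : ℤ) :
    ContDiffOn ℝ (⊤ : ℕ∞) (fun z => X z ^ n * (h (n * σ z) : ℂ)) V := by
  have h2 : ContDiffOn ℝ (⊤ : ℕ∞) (fun z => (h (n * σ z) : ℂ)) V :=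
    (ofRealCLM.contDiff.comp hh).comp_contDiffOn (contDiffOn_const.mul hσ)
  refine ContDiffOn.mul ?_ h2
  obtain ⟨m, rfl | rfl⟩ := n.eq_nat_or_neg
  · simpa using hX.pow m
  · have := (hX.pow m).inv fun z hz => pow_ne_zero _ (hX0 z hz)
    simp only [zpow_neg, zpow_natCast]
    exact this

theorem Adm.tame {S : Set ℂ} (hV : IsOpen V) (hX : ContDiffOn ℝ (⊤ : ℕ∞) X V)
    (hX0 : ∀ z ∈ V, X z ≠ 0) (hσ : ContDiffOn ℝ (⊤ : ℕ∞) σ V) (hh : ContDiff ℝ (⊤ : ℕ∞) h)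
    (n : ℤ) {φ : ℂ → F} (hφ : Adm V S φ) : Adm V S (tame X σ h n φ) :=
  hφ.bilinear hV (ContinuousLinearMap.lsmul ℝ ℂ : ℂ →L[ℝ] F →L[ℝ] F).flip
    (contDiffOn_tame_coeff hX hX0 hσ hh n)

theorem fderiv_tame {S : Set ℂ} (hV : IsOpen V) (hX : ContDiffOn ℝ (⊤ : ℕ∞) X V)
    (hX0 : ∀ z ∈ V, X z ≠ 0) (hσ : ContDiffOn ℝ (⊤ : ℕ∞) σ V) (hh : ContDiff ℝ (⊤ : ℕ∞) h)
    (n : ℤ) {φ : ℂ → F} (hφ : Adm V S φ) :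
    fderiv ℝ (tame X σ h n φ) = tame X σ h n (fderiv ℝ φ) +
      ((n : ℂ) • tame X σ h n (fun z => smulRightB F (φ z) ((X z)⁻¹ • fderiv ℝ X z)) +
      (n : ℂ) • tame X σ (deriv h) n (fun z => smulRightB F (φ z) (ofRealCLM.comp (fderiv ℝ σ z)))) := by
  ext1 z
  simp only [Pi.add_apply, Pi.smul_apply]
  by_cases hz : z ∈ V
  · have hXd : HasFDerivAt X (fderiv ℝ X z) z :=
      ((hX.contDiffAt (hV.mem_nhds hz)).differentiableAt (by simp)).hasFDerivAt
    have hσd : HasFDerivAt σ (fderiv ℝ σ z) z :=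
      ((hσ.contDiffAt (hV.mem_nhds hz)).differentiableAt (by simp)).hasFDerivAt
    have h1 : HasFDerivAt (fun z => X z ^ n) (((n : ℂ) * X z ^ (n - 1)) • fderiv ℝ X z) z := by
      have := (hasDerivAt_zpow n (X z) (Or.inl (hX0 z hz))).hasFDerivAt.restrictScalars ℝ
      refine (this.comp z hXd).congr_fderiv ?_
      ext v
      simp [mul_comm]
    have h2 : HasFDerivAt (fun z => (h (n * σ z) : ℂ))
        ((deriv h (n * σ z) * n) • (ofRealCLM.comp (fderiv ℝ σ z))) z := by
      have hd : HasDerivAt h (deriv h (n * σ z)) (n * σ z) :=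
        ((hh.differentiable (by simp)) _).hasDerivAt
      have h3 := hd.comp_hasFDerivAt z (hσd.const_mul (n : ℝ))
      refine (ofRealCLM.hasFDerivAt.comp z h3).congr_fderiv ?_
      ext v
      simp [mul_assoc]
    have h3 : HasFDerivAt φ (fderiv ℝ φ z) z :=
      (hφ.contDiff.differentiable (by simp) z).hasFDerivAt
    have h4 := (h1.mul h2).smul h3
    refine h4.fderiv.trans ?_
    ext v
    simp only [_root_.tame, add_apply, smul_apply, smulRightB_apply, ContinuousLinearMap.smulRight_apply,
      smul_eq_mul, zpow_sub_one₀ (hX0 z hz), ContinuousLinearMap.coe_comp, Function.comp,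
      ofRealCLM_apply, real_smul, Pi.mul_apply]
    push_cast
    module
  · have h0 : φ z = 0 := image_eq_zero_of_notMem_tsupport fun h => hz (hφ.subset h)
    have h1 : fderiv ℝ (tame X σ h n φ) z = 0 :=
      (flatAt_of_notMem_tsupport fun h => hz (hφ.subset (tsupport_tame_subset n φ h))).fderiv_eq_zero
    have h2 : fderiv ℝ φ z = 0 :=
      (flatAt_of_notMem_tsupport fun h => hz (hφ.subset h)).fderiv_eq_zero
    rw [h1]
    simp [_root_.tame, h0, h2]

theorem norm_iteratedFDeriv_add_smul_le {f g u : ℂ → F} (hf : ContDiff ℝ (⊤ : ℕ∞) f)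
    (hg : ContDiff ℝ (⊤ : ℕ∞) g) (hu : ContDiff ℝ (⊤ : ℕ∞) u) (c : ℂ) (k : ℕ) (z : ℂ) :
    ‖iteratedFDeriv ℝ k (f + (c • g + c • u)) z‖ ≤ ‖iteratedFDeriv ℝ k f z‖ +
      (‖c‖ * ‖iteratedFDeriv ℝ k g z‖ + ‖c‖ * ‖iteratedFDeriv ℝ k u z‖) := by
  have hk : (k : WithTop ℕ∞) ≤ (⊤ : ℕ∞) := by exact_mod_cast le_top
  have hf' := (hf.of_le hk).contDiffAt (x := z)
  have hg' := (hg.of_le hk).contDiffAt (x := z)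
  have hu' := (hu.of_le hk).contDiffAt (x := z)
  have hcg : ContDiffAt ℝ k (c • g) z := hg'.const_smul c
  have hcu : ContDiffAt ℝ k (c • u) z := hu'.const_smul c
  have hs : ContDiffAt ℝ k (c • g + c • u) z := hcg.add hcu
  rw [iteratedFDeriv_add_apply hf' hs, iteratedFDeriv_add_apply hcg hcu,
    iteratedFDeriv_const_smul_apply hg', iteratedFDeriv_const_smul_apply hu', ← norm_smul,
    ← norm_smul]
  exact (norm_add_le _ _).trans (add_le_add_right (norm_add_le _ _) _)

theorem exists_norm_iteratedFDeriv_tame_le {S E : Set ℂ} {N : Set ℤ} {w : ℤ → ℝ} (hw : ∀ n, 0 ≤ w n)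
    (hV : IsOpen V) (hX : ContDiffOn ℝ (⊤ : ℕ∞) X V)
    (hX0 : ∀ z ∈ V, X z ≠ 0) (hσ : ContDiffOn ℝ (⊤ : ℕ∞) σ V) (hh : ContDiff ℝ (⊤ : ℕ∞) h)
    (hbase : ∀ (j : ℕ) {F : Type} [NormedAddCommGroup F] [NormedSpace ℂ F] {φ : ℂ → F}, Adm V S φ →
      ∃ C : ℝ, 0 ≤ C ∧ ∀ n ∈ N, ∀ z ∈ E, ‖tame X σ (deriv^[j] h) n φ z‖ ≤ C * w n)
    (k : ℕ) : ∀ (j : ℕ) {F : Type} [NormedAddCommGroup F] [NormedSpace ℂ F] {φ : ℂ → F}, Adm V S φ →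
      ∃ C : ℝ, 0 ≤ C ∧ ∀ n ∈ N, ∀ z ∈ E,
        ‖iteratedFDeriv ℝ k (tame X σ (deriv^[j] h) n φ) z‖ ≤ C * ((1 + |(n : ℝ)|) ^ k * w n) := by
  have hhj : ∀ j, ContDiff ℝ (⊤ : ℕ∞) (deriv^[j] h) := fun j => by
    induction j with
    | zero => exact hh
    | succ j ih => rw [Function.iterate_succ_apply']; exact (contDiff_infty_iff_deriv.1 ih).2
  induction k with
  | zero =>
    intro j F _ _ φ hφ
    obtain ⟨C, hC, h⟩ := hbase j hφ
    exact ⟨C, hC, fun n hn z hz => by simpa using h n hn z hz⟩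
  | succ k ih =>
    intro j F _ _ φ hφ
    have hlX : ContDiffOn ℝ (⊤ : ℕ∞) (fun z => (X z)⁻¹ • fderiv ℝ X z) V :=
      (hX.inv hX0).smul (hX.fderiv_of_isOpen hV (by simp))
    have hlσ : ContDiffOn ℝ (⊤ : ℕ∞) (fun z => ofRealCLM.comp (fderiv ℝ σ z)) V :=
      contDiffOn_const.clm_comp (hσ.fderiv_of_isOpen hV (by simp))
    have a1 := hφ.fderiv
    have a2 := hφ.bilinear hV (smulRightB F) hlX
    have a3 := hφ.bilinear hV (smulRightB F) hlσ
    obtain ⟨C1, hC1, h1⟩ := ih j a1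
    obtain ⟨C2, hC2, h2⟩ := ih j a2
    obtain ⟨C3, hC3, h3⟩ := ih (j + 1) a3
    refine ⟨C1 + (C2 + C3), by positivity, fun n hn z hz => ?_⟩
    have t1 := (a1.tame hV hX hX0 hσ (hhj j) n).contDiff
    have t2 := (a2.tame hV hX hX0 hσ (hhj j) n).contDiff
    have t3 := (a3.tame hV hX hX0 hσ (hhj (j + 1)) n).contDiff
    rw [← norm_iteratedFDeriv_fderiv, fderiv_tame hV hX hX0 hσ (hhj j) n hφ,
      ← Function.iterate_succ_apply' deriv]
    refine (norm_iteratedFDeriv_add_smul_le t1 t2 t3 n k z).trans ?_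
    have e1 := h1 n hn z hz
    have e2 := h2 n hn z hz
    have e3 := h3 n hn z hz
    rw [norm_intCast]
    set W := (1 + |(n : ℝ)|) ^ k * w n
    have hW : 0 ≤ W := mul_nonneg (by positivity) (hw n)
    have hpow : (1 + |(n : ℝ)|) ^ (k + 1) * w n = (1 + |(n : ℝ)|) * W := by
      simp only [W]; ring
    rw [hpow]
    have ha : 0 ≤ |(n : ℝ)| := abs_nonneg _
    have e2' := mul_le_mul_of_nonneg_left e2 ha
    have e3' := mul_le_mul_of_nonneg_left e3 ha
    nlinarith [mul_nonneg hC1 (mul_nonneg ha hW), mul_nonneg hC2 hW, mul_nonneg hC3 hW]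

end Tame

section TameBase

variable {V : Set ℂ} {X : ℂ → ℂ} {σ : ℂ → ℝ}

theorem exists_norm_iteratedFDeriv_tame_profile_le (hV : IsOpen V) (hX : ContDiffOn ℝ (⊤ : ℕ∞) X V)
    (hX1 : ∀ z ∈ V, ‖X z‖ = 1) (hσ : ContDiffOn ℝ (⊤ : ℕ∞) σ V) {F : Type} [NormedAddCommGroup F]
    [NormedSpace ℂ F] {φ : ℂ → F} (hφ : Adm V ∅ φ) (k : ℕ) :
    ∃ C : ℝ, 0 ≤ C ∧ ∀ (n : ℤ) (z : ℂ),
      ‖iteratedFDeriv ℝ k (tame X σ profile n φ) z‖ ≤ C * (1 + |(n : ℝ)|) ^ k := by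
  have hX0 : ∀ z ∈ V, X z ≠ 0 := fun z hz h => by simpa [h] using hX1 z hz
  obtain ⟨C, hC, h⟩ := exists_norm_iteratedFDeriv_tame_le (S := ∅) (E := univ) (N := univ)
    (w := fun _ => 1) (fun _ => zero_le_one) hV hX hX0 hσ (contDiff_iterate_deriv_profile 0)
    (fun j {F} _ _ {φ} hφ => by
      obtain ⟨C, hC, h⟩ := exists_abs_iterate_deriv_profile_le j
      obtain ⟨M, hM⟩ := hφ.compact.exists_bound_of_continuous hφ.contDiff.continuous
      have hM0 : 0 ≤ M := (norm_nonneg _).trans (hM 0)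
      refine ⟨C * M, by positivity, fun n _ z _ => ?_⟩
      by_cases hz : z ∈ V
      · rw [tame, norm_smul, norm_mul, norm_zpow, hX1 z hz, one_zpow, one_mul, norm_real, mul_one]
        exact mul_le_mul (h _).2 (hM z) (norm_nonneg _) hC
      · rw [tame_eq_zero (image_eq_zero_of_notMem_tsupport fun h => hz (hφ.subset h)), norm_zero]
        positivity) k 0 hφ
  exact ⟨C, hC, fun n z => by simpa using h n trivial z trivial⟩

theorem exists_norm_iteratedFDeriv_tame_profile_le_of_flat (hV : IsOpen V)
    (hX : ContDiffOn ℝ (⊤ : ℕ∞) X V)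
    (hX1 : ∀ z ∈ V, ‖X z‖ = 1) (hσ : ContDiffOn ℝ (⊤ : ℕ∞) σ V) {S Ω : Set ℂ} (hS : IsClosed S)
    (hne : S.Nonempty) (hσ0 : ∀ z ∈ V ∩ Ω, 0 ≤ σ z) {B : ℝ} (hB0 : 0 ≤ B)
    (hB : ∀ z ∈ V ∩ Ω, infDist z S ≤ B * σ z) {F : Type} [NormedAddCommGroup F]
    [NormedSpace ℂ F] {φ : ℂ → F} (hφ : Adm V S φ) (k l : ℕ) :
    ∃ C : ℝ, 0 ≤ C ∧ ∀ n : ℤ, 0 ≤ n → ∀ z ∈ Ω,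
      ‖iteratedFDeriv ℝ k (tame X σ profile n φ) z‖ ≤ C * ((1 + |(n : ℝ)|) ^ l)⁻¹ := by
  have hX0 : ∀ z ∈ V, X z ≠ 0 := fun z hz h => by simpa [h] using hX1 z hz
  obtain ⟨C, hC, h⟩ := exists_norm_iteratedFDeriv_tame_le (S := S) (E := Ω) (N := Ici 0)
    (w := fun n => ((1 + |(n : ℝ)|) ^ (l + k))⁻¹) (fun _ => by positivity) hV hX hX0 hσ
    (contDiff_iterate_deriv_profile 0)
    (fun j {F} _ _ {φ} hφ => by
      obtain ⟨C, hC, h⟩ := exists_abs_iterate_deriv_profile_le j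
      obtain ⟨M, hM⟩ := (hφ.compact.iteratedFDeriv (𝕜 := ℝ) (l + k)).exists_bound_of_continuous
        (hφ.contDiff.continuous_iteratedFDeriv (m := (l + k : ℕ)) (by exact_mod_cast le_top))
      have hM0 : 0 ≤ M := (norm_nonneg _).trans (hM 0)
      obtain ⟨R, hR⟩ := hφ.compact.exists_bound_of_continuousOn (hσ.continuousOn.mono hφ.subset)
      refine ⟨C * (M * (B ^ (l + k) * (Real.exp R * (l + k).factorial))), by positivity,
        fun n hn z hz => ?_⟩
      by_cases hzs : z ∈ tsupport φ
      · have hzV := hφ.subset hzs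
        have hφz := norm_le_infDist_pow_of_flat (l + k) hS hne hφ.contDiff hφ.flat hM z
        rw [tame, norm_smul, norm_mul, norm_zpow, hX1 z hzV, one_zpow, one_mul, norm_real]
        have hs := hσ0 z ⟨hzV, hz⟩
        have hsR : σ z ≤ R := (le_abs_self _).trans (hR z hzs)
        have hn0 : (0 : ℝ) ≤ n := by exact_mod_cast hn
        rw [abs_of_nonneg hn0]
        have h1 : ‖φ z‖ ≤ M * (B ^ (l + k) * σ z ^ (l + k)) := by
          refine hφz.trans ?_
          rw [← mul_pow]
          gcongr
          · exact infDist_nonneg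
          · exact hB z ⟨hzV, hz⟩
        have h2 : σ z ^ (l + k) * Real.exp (-(n * σ z)) ≤
            Real.exp R * (l + k).factorial * ((1 + (n : ℝ)) ^ (l + k))⁻¹ := by
          rw [← div_eq_mul_inv, le_div_iff₀ (by positivity)]
          have h3 : ((1 + (n : ℝ)) * σ z) ^ (l + k) ≤ (l + k).factorial * Real.exp (R + n * σ z) := by
            have := Real.pow_div_factorial_le_exp ((1 + (n : ℝ)) * σ z) (by positivity) (l + k)
            rw [div_le_iff₀' (by positivity)] at this
            refine this.trans ?_
            gcongr
            linarith
          rw [mul_pow] at h3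
          calc σ z ^ (l + k) * Real.exp (-(n * σ z)) * (1 + (n : ℝ)) ^ (l + k)
              = ((1 + (n : ℝ)) ^ (l + k) * σ z ^ (l + k)) * Real.exp (-(n * σ z)) := by ring
            _ ≤ ((l + k).factorial * Real.exp (R + n * σ z)) * Real.exp (-(n * σ z)) := by gcongr
            _ = Real.exp R * (l + k).factorial := by
              rw [mul_assoc, ← Real.exp_add]
              ring_nf
        calc ‖(deriv^[j] profile) (n * σ z)‖ * ‖φ z‖
            ≤ (C * Real.exp (-(n * σ z))) * (M * (B ^ (l + k) * σ z ^ (l + k))) := by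
              gcongr
              exact (h _).1
          _ = C * (M * (B ^ (l + k) * (σ z ^ (l + k) * Real.exp (-(n * σ z))))) := by ring
          _ ≤ C * (M * (B ^ (l + k) * (Real.exp R * (l + k).factorial *
              ((1 + (n : ℝ)) ^ (l + k))⁻¹))) := by gcongr
          _ = _ := by ring
      · rw [tame_eq_zero (image_eq_zero_of_notMem_tsupport hzs), norm_zero]
        positivity) k 0 hφ
  refine ⟨C, hC, fun n hn z hz => (h n hn z hz).trans_eq ?_⟩
  have : (1 + |(n : ℝ)|) ≠ 0 := by positivity
  field_simp
  ring

end TameBase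

section Fourier

/-- The Fourier coefficients of a `2π`-periodic function. -/
def fc (q : ℝ → ℂ) (n : ℤ) : ℂ :=
  (1 / (2 * Real.pi) : ℂ) * ∫ t in (0 : ℝ)..2 * Real.pi, q t * exp (-(n * t * I))

theorem norm_exp_int_mul_I (n : ℤ) (t : ℝ) : ‖exp (n * t * I)‖ = 1 := by
  have : (n * t * I : ℂ) = ((n * t : ℝ) : ℂ) * I := by push_cast; ring
  rw [this, norm_exp_ofReal_mul_I]

theorem norm_exp_neg_int_mul_I (n : ℤ) (t : ℝ) : ‖exp (-(n * t * I))‖ = 1 := by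
  rw [exp_neg, norm_inv, norm_exp_int_mul_I, inv_one]

theorem norm_fc_le {q : ℝ → ℂ} {M : ℝ} (h : ∀ t, ‖q t‖ ≤ M) (n : ℤ) : ‖fc q n‖ ≤ M := by
  have h1 := intervalIntegral.norm_integral_le_of_norm_le_const (a := 0) (b := 2 * Real.pi) (C := M)
    (f := fun t => q t * exp (-(n * t * I)))
    fun t _ => by rw [norm_mul, norm_exp_neg_int_mul_I, mul_one]; exact h t
  have hp := Real.pi_pos
  rw [sub_zero, abs_of_pos (by positivity)] at h1
  rw [fc, norm_mul]
  have h2 : ‖(1 / (2 * Real.pi) : ℂ)‖ = 1 / (2 * Real.pi) := by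
    rw [norm_div, norm_mul, norm_real, Real.norm_of_nonneg hp.le]; simp
  rw [h2]
  calc _ ≤ 1 / (2 * Real.pi) * (M * (2 * Real.pi)) := by gcongr
    _ = M := by field_simp

theorem fc_congr {p q : ℝ → ℂ} (h : ∀ t, p t = q t) (n : ℤ) : fc p n = fc q n := by
  rw [funext h]

theorem continuous_exp_neg_int_mul_I (n : ℤ) : Continuous fun t : ℝ => exp (-(n * t * I)) := by
  fun_prop

theorem fc_add {p q : ℝ → ℂ} (hp : Continuous p) (hq : Continuous q) (n : ℤ) :
    fc (fun t => p t + q t) n = fc p n + fc q n := by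
  simp only [fc, add_mul]
  rw [intervalIntegral.integral_add, mul_add]
  · exact (hp.mul (continuous_exp_neg_int_mul_I n)).intervalIntegrable _ _
  · exact (hq.mul (continuous_exp_neg_int_mul_I n)).intervalIntegrable _ _

theorem fc_sub {p q : ℝ → ℂ} (hp : Continuous p) (hq : Continuous q) (n : ℤ) :
    fc (fun t => p t - q t) n = fc p n - fc q n := by
  simp only [fc, sub_mul]
  rw [intervalIntegral.integral_sub, mul_sub]
  · exact (hp.mul (continuous_exp_neg_int_mul_I n)).intervalIntegrable _ _
  · exact (hq.mul (continuous_exp_neg_int_mul_I n)).intervalIntegrable _ _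

theorem fc_const_mul (c : ℂ) (q : ℝ → ℂ) (n : ℤ) : fc (fun t => c * q t) n = c * fc q n := by
  simp only [fc, mul_assoc]
  rw [intervalIntegral.integral_const_mul]
  ring

theorem hasSum_fc {ι : Type*} [Countable ι] {q : ι → ℝ → ℂ} {u : ι → ℝ} (hq : ∀ i, Continuous (q i))
    (hu : Summable u) (h : ∀ i t, ‖q i t‖ ≤ u i) (n : ℤ) :
    HasSum (fun i => fc (q i) n) (fc (fun t => ∑' i, q i t) n) := by
  refine HasSum.mul_left _ ?_
  refine intervalIntegral.hasSum_integral_of_dominated_convergence (fun i _ => u i) (fun i => ?_)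
    (fun i => ?_) ?_ ?_ ?_
  · exact ((hq i).mul (continuous_exp_neg_int_mul_I n)).aestronglyMeasurable
  · refine Filter.Eventually.of_forall fun t _ => ?_
    rw [norm_mul, norm_exp_neg_int_mul_I, mul_one]
    exact h i t
  · exact Filter.Eventually.of_forall fun t _ => hu
  · simp
  · refine Filter.Eventually.of_forall fun t _ => ?_
    exact (Summable.of_norm_bounded hu fun i => h i t).hasSum.mul_right _

theorem fc_of_hasDerivAt {q q' : ℝ → ℂ} (hq : ∀ t, HasDerivAt q (q' t) t) (hq' : Continuous q')
    (hp : Function.Periodic q (2 * Real.pi)) (n : ℤ) : fc q' n = n * I * fc q n := by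
  have he : ∀ t : ℝ, HasDerivAt (fun t : ℝ => exp (-(n * t * I))) (-(n * I) * exp (-(n * t * I))) t := by
    intro t
    have h1 : HasDerivAt (fun t : ℝ => (-(n * t * I) : ℂ)) (-(n * I)) t := by
      have := ((hasDerivAt_id t).ofReal_comp.const_mul (n : ℂ)).mul_const I |>.neg
      simp only [id, mul_one, ofReal_one] at this
      exact this
    simpa [mul_comm] using h1.cexp
  have h := intervalIntegral.integral_mul_deriv_eq_deriv_mul (a := 0) (b := 2 * Real.pi)
    (fun t _ => hq t) (fun t _ => he t) (hq'.intervalIntegrable _ _)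
    ((continuous_const.mul (continuous_exp_neg_int_mul_I n)).intervalIntegrable _ _)
  have h0 : q (2 * Real.pi) = q 0 := by simpa using hp 0
  have h1 : exp (-((n : ℂ) * ((2 * Real.pi : ℝ) : ℂ) * I)) = 1 := by
    rw [exp_neg, inv_eq_one, exp_eq_one_iff]
    exact ⟨n, by push_cast; ring⟩
  rw [h0, h1] at h
  simp only [ofReal_zero, mul_zero, zero_mul, neg_zero, exp_zero, sub_self, zero_sub] at h
  have h2 : ∫ t in (0 : ℝ)..2 * Real.pi, q t * (-(n * I) * exp (-(n * t * I))) =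
      -(n * I) * ∫ t in (0 : ℝ)..2 * Real.pi, q t * exp (-(n * t * I)) := by
    rw [← intervalIntegral.integral_const_mul]
    congr 1; ext t; ring
  rw [h2] at h
  rw [fc, fc, ← neg_neg (∫ t in (0 : ℝ)..2 * Real.pi, q' t * exp (-(n * t * I))), ← h]
  ring

theorem hasSum_fc_mul_exp {q : ℝ → ℂ} (hq : Continuous q) (hp : Function.Periodic q (2 * Real.pi))
    (hs : Summable (fc q)) (t : ℝ) : HasSum (fun n : ℤ => fc q n * exp (n * t * I)) (q t) := by
  have : Fact (0 < 2 * Real.pi) := ⟨Real.two_pi_pos⟩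
  have hπ : (Real.pi : ℂ) ≠ 0 := by exact_mod_cast Real.pi_ne_zero
  let f : C(AddCircle (2 * Real.pi), ℂ) := ⟨hp.lift, continuous_coinduced_dom.mpr hq⟩
  have hf : ∀ s : ℝ, f (s : AddCircle (2 * Real.pi)) = q s := fun s => hp.lift_coe s
  have he : ∀ (n : ℤ) (s : ℝ), fourier n (s : AddCircle (2 * Real.pi)) = exp (n * s * I) := by
    intro n s
    rw [fourier_coe_apply]
    congr 1
    push_cast
    field_simp
  have hc : ∀ n, fourierCoeff f n = fc q n := by
    intro n
    rw [fourierCoeff_eq_intervalIntegral f n 0, fc, zero_add, real_smul]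
    push_cast
    congr 2
    ext s
    rw [hf, he, smul_eq_mul, mul_comm]
    congr 2
    push_cast
    ring
  have := has_pointwise_sum_fourier_series_of_summable (f := f) (by simpa only [funext hc] using hs) t
  rw [hf] at this
  simpa only [he, hc, smul_eq_mul] using this

theorem fc_exp (m n : ℤ) : fc (fun t => exp (m * t * I)) n = if n = m then 1 else 0 := by
  have hπ : (Real.pi : ℂ) ≠ 0 := by exact_mod_cast Real.pi_ne_zero
  have h : ∀ t : ℝ, exp (m * t * I) * exp (-(n * t * I)) = exp (((m - n : ℤ) * I) * t) := by
    intro t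
    rw [← exp_add]
    congr 1
    push_cast
    ring
  simp only [fc, h]
  split_ifs with hmn
  · subst hmn
    simp
    field_simp
  · have hc : ((m - n : ℤ) * I : ℂ) ≠ 0 :=
      mul_ne_zero (by exact_mod_cast sub_ne_zero.2 (Ne.symm hmn)) I_ne_zero
    rw [integral_exp_mul_complex hc]
    have h1 : exp (((m - n : ℤ) * I : ℂ) * ((2 * Real.pi : ℝ) : ℂ)) = 1 := by
      rw [exp_eq_one_iff]
      exact ⟨m - n, by push_cast; ring⟩
    rw [h1]
    simp

theorem pow_mul_norm_fc {L : ℕ} {q : ℝ → ℂ} (hq : ContDiff ℝ (⊤ : ℕ∞) q)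
    (hp : Function.Periodic q (2 * Real.pi)) (n : ℤ) :
    |(n : ℝ)| ^ L * ‖fc q n‖ = ‖fc (iteratedDeriv L q) n‖ := by
  induction L generalizing q with
  | zero => simp
  | succ L ih =>
    have hd := contDiff_infty_iff_deriv.1 hq
    have hp' : Function.Periodic (deriv q) (2 * Real.pi) := fun t => by
      rw [← deriv_comp_add_const, funext hp]
    rw [iteratedDeriv_succ', ← ih hd.2 hp',
      fc_of_hasDerivAt (fun t => (hd.1 t).hasDerivAt) hd.2.continuous hp]
    simp only [norm_mul, norm_I, norm_intCast, mul_one]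
    ring

theorem summable_inv_one_add_abs_sq : Summable fun n : ℤ => ((1 + |(n : ℝ)|) ^ 2)⁻¹ := by
  have h := (Real.summable_one_div_int_add_rpow 0 2).2 (by norm_num)
  refine Summable.of_nonneg_of_le (fun n => by positivity) ?_ (h.add (summable_of_ne_finset_zero (s := {0})
    (f := fun n : ℤ => if n = 0 then (1 : ℝ) else 0) (by intro b hb; simp at hb; simp [hb])))
  intro n
  by_cases hn : n = 0
  · subst hn; simp
  · have : 0 < |(n : ℝ)| := abs_pos.2 (by exact_mod_cast hn)
    simp only [add_zero, hn, if_false, one_div]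
    rw [show (2 : ℝ) = ((2 : ℕ) : ℝ) by norm_num, Real.rpow_natCast]
    gcongr
    linarith

end Fourier

section FourierDecay

theorem norm_fc_le_of_pow_mul {L : ℕ} {x : ℂ} {M : ℝ} {n : ℤ} (h0 : ‖x‖ ≤ M)
    (h1 : |(n : ℝ)| ^ L * ‖x‖ ≤ M) : ‖x‖ ≤ 2 ^ (L + 1) * M * ((1 + |(n : ℝ)|) ^ L)⁻¹ := by
  rw [← div_eq_mul_inv, le_div_iff₀ (by positivity), mul_comm]
  have h2 : (1 + |(n : ℝ)|) ^ L ≤ 2 ^ L * (1 + |(n : ℝ)| ^ L) := by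
    have := add_pow_le (zero_le_one) (abs_nonneg (n : ℝ)) L
    rw [one_pow] at this
    refine this.trans ?_
    gcongr
    · norm_num
    · omega
  calc (1 + |(n : ℝ)|) ^ L * ‖x‖ ≤ 2 ^ L * (1 + |(n : ℝ)| ^ L) * ‖x‖ := by gcongr
    _ = 2 ^ L * (‖x‖ + |(n : ℝ)| ^ L * ‖x‖) := by ring
    _ ≤ 2 ^ L * (M + M) := by gcongr
    _ = _ := by ring

theorem norm_fc_le_of_iteratedDeriv {L : ℕ} {q : ℝ → ℂ} (hq : ContDiff ℝ (⊤ : ℕ∞) q)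
    (hp : Function.Periodic q (2 * Real.pi)) {M : ℝ} (h0 : ∀ t, ‖q t‖ ≤ M)
    (h1 : ∀ t, ‖iteratedDeriv L q t‖ ≤ M) (n : ℤ) :
    ‖fc q n‖ ≤ 2 ^ (L + 1) * M * ((1 + |(n : ℝ)|) ^ L)⁻¹ :=
  norm_fc_le_of_pow_mul (norm_fc_le h0 n) ((pow_mul_norm_fc hq hp n).trans_le (norm_fc_le h1 n))

theorem Function.Periodic.iteratedFDeriv_two_pi {F : Type*} [NormedAddCommGroup F]
    [NormedSpace ℝ F] {q : ℝ → F} {T : ℝ} (hp : Function.Periodic q T) (k : ℕ) :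
    Function.Periodic (iteratedFDeriv ℝ k q) T := fun t => by
  rw [← iteratedFDeriv_comp_add_right, funext hp]

theorem exists_norm_le_of_periodic {F : Type*} [NormedAddCommGroup F] {q : ℝ → F}
    (hq : Continuous q) (hp : Function.Periodic q (2 * Real.pi)) :
    ∃ C : ℝ, 0 ≤ C ∧ ∀ t, ‖q t‖ ≤ C := by
  obtain ⟨C, hC⟩ := (isCompact_Icc (a := (0 : ℝ)) (b := 2 * Real.pi)).exists_bound_of_continuousOn
    hq.continuousOn
  refine ⟨C, (norm_nonneg _).trans (hC 0 ⟨le_rfl, Real.two_pi_pos.le⟩), fun t => ?_⟩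
  obtain ⟨s, hs, hst⟩ := hp.exists_mem_Ico₀ Real.two_pi_pos t
  rw [hst]
  exact hC s ⟨hs.1, hs.2.le⟩

theorem exists_norm_fc_le {q : ℝ → ℂ} (hq : ContDiff ℝ (⊤ : ℕ∞) q)
    (hp : Function.Periodic q (2 * Real.pi)) (L : ℕ) :
    ∃ C : ℝ, 0 ≤ C ∧ ∀ n : ℤ, ‖fc q n‖ ≤ C * ((1 + |(n : ℝ)|) ^ L)⁻¹ := by
  obtain ⟨C0, hC0, h0⟩ := exists_norm_le_of_periodic hq.continuous hp
  obtain ⟨C1, hC1, h1⟩ := exists_norm_le_of_periodic (hq.continuous_iteratedFDeriv (m := L)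
    (by exact_mod_cast le_top)) (hp.iteratedFDeriv_two_pi L)
  refine ⟨2 ^ (L + 1) * max C0 C1, by positivity, norm_fc_le_of_iteratedDeriv hq hp
    (fun t => (h0 t).trans (le_max_left _ _)) fun t => ?_⟩
  rw [← norm_iteratedFDeriv_eq_norm_iteratedDeriv]
  exact (h1 t).trans (le_max_right _ _)

theorem summable_fc {q : ℝ → ℂ} (hq : ContDiff ℝ (⊤ : ℕ∞) q)
    (hp : Function.Periodic q (2 * Real.pi)) : Summable (fc q) := by
  obtain ⟨C, -, h⟩ := exists_norm_fc_le hq hp 2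
  exact Summable.of_norm_bounded (summable_inv_one_add_abs_sq.mul_left C) h

variable {γ : ℝ → ℂ}

theorem exists_norm_fc_comp_le (hγ : ContDiff ℝ (⊤ : ℕ∞) γ)
    (hp : Function.Periodic γ (2 * Real.pi)) (L : ℕ) :
    ∃ C : ℝ, 0 ≤ C ∧ ∀ (v : ℂ → ℂ) (M : ℝ), ContDiff ℝ (⊤ : ℕ∞) v →
      (∀ k ≤ L, ∀ z, ‖iteratedFDeriv ℝ k v z‖ ≤ M) → ∀ n : ℤ,
      ‖fc (fun t => v (γ t)) n‖ ≤ C * M * ((1 + |(n : ℝ)|) ^ L)⁻¹ := by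
  have h1 : ∀ k : ℕ, ∃ D : ℝ, 0 ≤ D ∧ ∀ t, ‖iteratedFDeriv ℝ k γ t‖ ≤ D := fun k =>
    exists_norm_le_of_periodic (hγ.continuous_iteratedFDeriv (m := k)
      (by exact_mod_cast le_top)) (hp.iteratedFDeriv_two_pi k)
  choose D hD0 hD using h1
  set E : ℝ := 1 + ∑ k ∈ Finset.range (L + 1), D k with hE
  have hE1 : 1 ≤ E := by
    rw [hE]; linarith [Finset.sum_nonneg fun k (_ : k ∈ Finset.range (L + 1)) => hD0 k]
  have hDE : ∀ k ≤ L, D k ≤ E := fun k hk => by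
    have := Finset.single_le_sum (fun k _ => hD0 k) (Finset.mem_range.2 (Nat.lt_succ_of_le hk))
    linarith
  refine ⟨2 ^ (L + 1) * (1 + L.factorial * E ^ L), by positivity, fun v M hv hM n => ?_⟩
  have hM0 : 0 ≤ M := (norm_nonneg _).trans (hM 0 (Nat.zero_le _) 0)
  have := norm_fc_le_of_iteratedDeriv (L := L) (M := (1 + L.factorial * E ^ L) * M)
    (hv.comp hγ) (fun t => by simp [hp t]) ?_ ?_ n
  · rw [mul_assoc (2 ^ (L + 1))]
    exact this
  · intro t
    have := hM 0 (Nat.zero_le _) (γ t)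
    rw [norm_iteratedFDeriv_zero] at this
    exact this.trans (le_mul_of_one_le_left hM0 (le_add_of_nonneg_right (by positivity)))
  · intro t
    rw [← norm_iteratedFDeriv_eq_norm_iteratedDeriv]
    have := norm_iteratedFDeriv_comp_le (n := L) hv hγ (by exact_mod_cast le_top) t (C := M) (D := E)
      (fun i hi => hM i hi _) (fun i hi1 hi => (hD i t).trans ((hDE i hi).trans
        (le_self_pow₀ hE1 (by omega))))
    refine this.trans ?_
    nlinarith

theorem infDist_range_pos (hγ : Continuous γ) (hp : Function.Periodic γ (2 * Real.pi)) {ζ : ℂ}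
    (hζ : ζ ∉ range γ) : 0 < infDist ζ (range γ) := by
  have hc : IsClosed (range γ) := by
    have : range γ = γ '' Icc 0 (0 + 2 * Real.pi) := (hp.image_Icc Real.two_pi_pos 0).symm
    rw [this]
    exact (isCompact_Icc.image hγ).isClosed
  exact (hc.notMem_iff_infDist_pos (range_nonempty γ)).1 hζ

theorem pow_mul_norm_fc_resolvent_le (hγ : ContDiff ℝ (⊤ : ℕ∞) γ)
    (hp : Function.Periodic γ (2 * Real.pi)) {R : ℝ} (hR : 0 ≤ R) (L : ℕ) :
    ∀ (l : ℕ) {q : ℝ → ℂ}, ContDiff ℝ (⊤ : ℕ∞) q → Function.Periodic q (2 * Real.pi) →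
      ∃ C : ℝ, 0 ≤ C ∧ ∀ ζ ∉ range γ, infDist ζ (range γ) ≤ R → ∀ n : ℤ,
        |(n : ℝ)| ^ L * ‖fc (fun t => q t * (γ t - ζ)⁻¹ ^ l) n‖ ≤
          C * (infDist ζ (range γ))⁻¹ ^ (l + L) := by
  induction L with
  | zero =>
    intro l q hq hpq
    obtain ⟨C, hC, h⟩ := exists_norm_le_of_periodic hq.continuous hpq
    refine ⟨C, hC, fun ζ hζ _ n => ?_⟩
    rw [pow_zero, one_mul, add_zero]
    refine norm_fc_le (fun t => ?_) n
    have hd := infDist_range_pos hγ.continuous hp hζ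
    rw [norm_mul, norm_pow, norm_inv]
    gcongr
    · exact h t
    · rw [← dist_eq_norm, dist_comm]
      exact infDist_le_dist_of_mem (mem_range_self t)
  | succ L ih =>
    intro l q hq hpq
    have hq' := contDiff_infty_iff_deriv.1 hq
    have hγ' := contDiff_infty_iff_deriv.1 hγ
    have hpq' : Function.Periodic (deriv q) (2 * Real.pi) := fun t => by
      rw [← deriv_comp_add_const, funext hpq]
    have hpγ' : Function.Periodic (deriv γ) (2 * Real.pi) := fun t => by
      rw [← deriv_comp_add_const, funext hp]
    obtain ⟨C1, hC1, h1⟩ := ih l hq'.2 hpq'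
    obtain ⟨C2, hC2, h2⟩ := ih (l + 1) (contDiff_const.mul (hq.mul hγ'.2) :
      ContDiff ℝ (⊤ : ℕ∞) fun t => -(l : ℂ) * (q t * deriv γ t)) fun t => by rw [hpq t, hpγ' t]
    refine ⟨R * C1 + C2, by positivity, fun ζ hζ hζR n => ?_⟩
    have hd := infDist_range_pos hγ.continuous hp hζ
    set d := infDist ζ (range γ)
    have hne : ∀ t, γ t - ζ ≠ 0 := fun t h => hζ ⟨t, sub_eq_zero.1 h⟩
    have hcr : ∀ l : ℕ, Continuous fun t => (γ t - ζ)⁻¹ ^ l := fun l =>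
      ((hγ.continuous.sub continuous_const).inv₀ hne).pow l
    have hder : ∀ t, HasDerivAt (fun t => q t * (γ t - ζ)⁻¹ ^ l)
        (deriv q t * (γ t - ζ)⁻¹ ^ l + (-(l : ℂ) * (q t * deriv γ t)) * (γ t - ζ)⁻¹ ^ (l + 1)) t := by
      intro t
      have e1 := ((hγ'.1 t).hasDerivAt.sub_const ζ).inv (hne t)
      have e2 := (hq'.1 t).hasDerivAt.mul (e1.pow l)
      refine e2.congr_deriv ?_
      rcases l with _ | l
      · simp
      · simp only [Nat.add_sub_cancel, Pi.inv_apply, Pi.pow_apply, div_eq_mul_inv, ← inv_pow]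
        push_cast
        ring
    have hc1 : Continuous fun t => deriv q t * (γ t - ζ)⁻¹ ^ l := hq'.2.continuous.mul (hcr l)
    have hc2 : Continuous fun t => (-(l : ℂ) * (q t * deriv γ t)) * (γ t - ζ)⁻¹ ^ (l + 1) :=
      (continuous_const.mul (hq.continuous.mul hγ'.2.continuous)).mul (hcr _)
    have key := fc_of_hasDerivAt hder (hc1.add hc2) (fun t => by simp only [hpq t, hp t]) n
    rw [fc_add hc1 hc2] at key
    have e1 := h1 ζ hζ hζR n
    have e2 := h2 ζ hζ hζR n
    have hn : |(n : ℝ)| * ‖fc (fun t => q t * (γ t - ζ)⁻¹ ^ l) n‖ ≤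
        ‖fc (fun t => deriv q t * (γ t - ζ)⁻¹ ^ l) n‖ +
        ‖fc (fun t => (-(l : ℂ) * (q t * deriv γ t)) * (γ t - ζ)⁻¹ ^ (l + 1)) n‖ := by
      refine le_trans (le_of_eq ?_) ((congrArg norm key).symm.le.trans (norm_add_le _ _))
      simp
    have e3 : d⁻¹ ^ (l + L) ≤ R * d⁻¹ ^ (l + (L + 1)) := by
      rw [← add_assoc, pow_succ, mul_comm _ d⁻¹, ← mul_assoc]
      refine le_mul_of_one_le_left (by positivity) ?_
      rw [← div_eq_mul_inv, one_le_div hd]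
      exact hζR
    calc |(n : ℝ)| ^ (L + 1) * ‖fc (fun t => q t * (γ t - ζ)⁻¹ ^ l) n‖
        = |(n : ℝ)| ^ L * (|(n : ℝ)| * ‖fc (fun t => q t * (γ t - ζ)⁻¹ ^ l) n‖) := by ring
      _ ≤ |(n : ℝ)| ^ L * (‖fc (fun t => deriv q t * (γ t - ζ)⁻¹ ^ l) n‖ +
        ‖fc (fun t => (-(l : ℂ) * (q t * deriv γ t)) * (γ t - ζ)⁻¹ ^ (l + 1)) n‖) := by gcongr
      _ ≤ C1 * d⁻¹ ^ (l + L) + C2 * d⁻¹ ^ (l + 1 + L) := by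
        rw [mul_add]; exact add_le_add e1 e2
      _ ≤ C1 * (R * d⁻¹ ^ (l + (L + 1))) + C2 * d⁻¹ ^ (l + (L + 1)) := by
        rw [show l + 1 + L = l + (L + 1) by ring]
        gcongr
      _ = _ := by ring

/-- Decay of the Fourier coefficients of the Cauchy kernel. -/
theorem exists_norm_fc_cauchy_le (hγ : ContDiff ℝ (⊤ : ℕ∞) γ)
    (hp : Function.Periodic γ (2 * Real.pi)) {R : ℝ} (hR : 0 ≤ R) (L : ℕ) :
    ∃ C : ℝ, 0 ≤ C ∧ ∀ ζ ∉ range γ, infDist ζ (range γ) ≤ R → ∀ n : ℤ,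
        ‖fc (fun t => (γ t - ζ)⁻¹) n‖ ≤
          C * (infDist ζ (range γ))⁻¹ ^ (1 + L) * ((1 + |(n : ℝ)|) ^ L)⁻¹ := by
  obtain ⟨C0, hC0, h0⟩ := pow_mul_norm_fc_resolvent_le hγ hp hR 0 1 (q := fun _ => 1)
    contDiff_const (fun _ => rfl)
  obtain ⟨C1, hC1, h1⟩ := pow_mul_norm_fc_resolvent_le hγ hp hR L 1 (q := fun _ => 1)
    contDiff_const (fun _ => rfl)
  refine ⟨2 ^ (L + 1) * (R ^ L * C0 + C1), by positivity, fun ζ hζ hζR n => ?_⟩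
  have e0 := h0 ζ hζ hζR n
  have e1 := h1 ζ hζ hζR n
  have hd := infDist_range_pos hγ.continuous hp hζ
  set d := infDist ζ (range γ)
  simp only [one_mul, pow_one, pow_zero, add_zero] at e0 e1
  have e3 : d⁻¹ ≤ R ^ L * d⁻¹ ^ (1 + L) := by
    rw [pow_add, pow_one, mul_comm d⁻¹, ← mul_assoc, ← mul_pow]
    refine le_mul_of_one_le_left (by positivity) (one_le_pow₀ ?_)
    rw [← div_eq_mul_inv, one_le_div hd]
    exact hζR
  have e4 := norm_fc_le_of_pow_mul (L := L) (M := (R ^ L * C0 + C1) * d⁻¹ ^ (1 + L))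
    (e0.trans ?_) (e1.trans ?_)
  · rw [← mul_assoc] at e4
    exact e4
  · have : 0 ≤ C1 * d⁻¹ ^ (1 + L) := by positivity
    nlinarith [mul_le_mul_of_nonneg_left e3 hC0]
  · have : 0 ≤ R ^ L * C0 * d⁻¹ ^ (1 + L) := by positivity
    nlinarith

end FourierDecay

section Extension

theorem exists_bump {K V : Set ℂ} (hK : IsCompact K) (hV : IsOpen V) (hKV : K ⊆ V) :
    ∃ χ : ℂ → ℂ, Adm V ∅ χ ∧ (∀ z ∈ K, ∀ᶠ w in nhds z, χ w = 1) ∧ ∀ z, ‖χ z‖ ≤ 1 := by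
  obtain ⟨L, hL, hKL, hLV⟩ := exists_compact_between hK hV hKV
  obtain ⟨f, h1, h0, h01⟩ := exists_contMDiffMap_one_nhds_of_subset_interior
    (n := (⊤ : ℕ∞)) (modelWithCornersSelf ℝ ℂ) hK.isClosed hKL
  have hts : tsupport (fun z => (f z : ℂ)) ⊆ L := by
    refine closure_minimal (fun z hz => ?_) hL.isClosed
    by_contra h
    exact hz (by simp [h0 z h])
  refine ⟨fun z => (f z : ℂ), ⟨ofRealCLM.contDiff.comp f.contMDiff.contDiff,
    hL.of_isClosed_subset (isClosed_tsupport _) hts, hts.trans hLV, fun _ h => h.elim⟩, ?_, ?_⟩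
  · intro z hz
    filter_upwards [Filter.eventually_of_mem (nhds_le_nhdsSet hz h1) fun _ h => h] with w hw
    rw [hw, ofReal_one]
  · intro z
    rw [norm_real, Real.norm_of_nonneg (h01 z).1]
    exact (h01 z).2

/-- The complex linear part of the derivative. -/
def del (f : ℂ → ℂ) (z : ℂ) : ℂ := (1 / 2 : ℂ) * (fderiv ℝ f z 1 - I * fderiv ℝ f z I)

theorem fderiv_apply_eq (f : ℂ → ℂ) (z v : ℂ) :
    fderiv ℝ f z v = del f z * v + dbar f z * conj v := by
  have h : v = v.re • (1 : ℂ) + v.im • I := by simp [re_add_im]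
  have h2 : conj v = v.re - v.im * I := by
    apply Complex.ext <;> simp
  rw [h2]
  conv_lhs => rw [h, map_add, map_smul, map_smul]
  simp only [del, dbar, smul_eq_mul, real_smul]
  conv_rhs => rw [← re_add_im v]
  ring_nf
  simp only [I_sq, add_re, mul_re, ofReal_re, ofReal_im, I_re, I_im, add_im, mul_im]
  ring_nf

/-- The real linear map extracting the conjugate linear part. -/
def dbarL : (ℂ →L[ℝ] ℂ) →L[ℝ] ℂ :=
  (1 / 2 : ℂ) • (ContinuousLinearMap.apply ℝ ℂ (1 : ℂ) +
    I • ContinuousLinearMap.apply ℝ ℂ (I : ℂ))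

theorem dbarL_apply (L : ℂ →L[ℝ] ℂ) : dbarL L = (1 / 2 : ℂ) • (L 1 + I • L I) := rfl

theorem dbar_eq_comp (f : ℂ → ℂ) : dbar f = dbarL ∘ fderiv ℝ f := rfl

theorem norm_iteratedFDeriv_dbar_le {f : ℂ → ℂ} (hf : ContDiff ℝ (⊤ : ℕ∞) f) (k : ℕ) (z : ℂ) :
    ‖iteratedFDeriv ℝ k (dbar f) z‖ ≤ ‖dbarL‖ * ‖iteratedFDeriv ℝ (k + 1) f z‖ := by
  rw [← norm_iteratedFDeriv_fderiv, dbar_eq_comp]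
  exact dbarL.norm_iteratedFDeriv_comp_left (N := (⊤ : ℕ∞))
    (hf.fderiv_right (by simp)).contDiffAt (by exact_mod_cast le_top)

theorem ContDiffOn.dbar {f : ℂ → ℂ} {V : Set ℂ} (hV : IsOpen V) (hf : ContDiffOn ℝ (⊤ : ℕ∞) f V) :
    ContDiffOn ℝ (⊤ : ℕ∞) (dbar f) V :=
  dbarL.contDiff.comp_contDiffOn (hf.fderiv_of_isOpen hV (by simp))

theorem ContDiffOn.del {f : ℂ → ℂ} {V : Set ℂ} (hV : IsOpen V) (hf : ContDiffOn ℝ (⊤ : ℕ∞) f V) :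
    ContDiffOn ℝ (⊤ : ℕ∞) (del f) V := by
  have h := hf.fderiv_of_isOpen hV (m := (⊤ : ℕ∞)) (by simp)
  exact contDiffOn_const.mul ((h.clm_apply contDiffOn_const).sub
    (contDiffOn_const.mul (h.clm_apply contDiffOn_const)))

theorem dbar_congr {f g : ℂ → ℂ} {z : ℂ} (h : f =ᶠ[nhds z] g) : dbar f z = dbar g z := by
  rw [dbar_def, dbar_def, h.fderiv_eq]

theorem flatAt_dbar_tsum {f : ℤ → ℂ → ℂ} {v : ℕ → ℤ → ℝ} (hf : ∀ n, ContDiff ℝ (⊤ : ℕ∞) (f n))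
    (hv : ∀ k, Summable (v k)) (h : ∀ k n z, ‖iteratedFDeriv ℝ k (f n) z‖ ≤ v k n) {z : ℂ}
    (hz : ∀ n, FlatAt (dbar (f n)) z) : FlatAt (dbar fun z => ∑' n, f n z) z := by
  have h1 : (dbar fun z => ∑' n, f n z) = fun z => ∑' n, dbar (f n) z := by
    ext w
    rw [dbar_eq_comp, Function.comp, fderiv_tsum_apply (u := v 1) (x₀ := w) (hv 1)
      (fun n => (hf n).differentiable (by simp)) ?_ ?_]
    · rw [dbarL.map_tsum]
      · rfl
      · refine Summable.of_norm_bounded (hv 1) fun n => ?_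
        rw [← norm_iteratedFDeriv_one]
        exact h 1 n w
    · intro n x
      rw [← norm_iteratedFDeriv_one]
      exact h 1 n x
    · refine Summable.of_norm_bounded (hv 0) fun n => ?_
      simpa using h 0 n w
  intro k
  rw [h1, iteratedFDeriv_tsum (N := (⊤ : ℕ∞)) (v := fun k n => ‖dbarL‖ * v (k + 1) n)
    (fun n => (hf n).dbar) (fun k _ => (hv _).mul_left _)
    (fun k n x _ => (norm_iteratedFDeriv_dbar_le (hf n) k x).trans
      (by gcongr; exact h _ _ _)) (by exact_mod_cast le_top)]
  simp only [hz _ k, tsum_zero]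

theorem contDiffOn_div_norm : ContDiffOn ℝ (⊤ : ℕ∞) (fun w : ℂ => w / (‖w‖ : ℂ)) {0}ᶜ := by
  intro w hw
  have h1 : ContDiffAt ℝ (⊤ : ℕ∞) (fun w : ℂ => (‖w‖ : ℂ)) w :=
    ofRealCLM.contDiff.contDiffAt.comp w (contDiffAt_norm ℝ hw)
  have h2 : ContDiffAt ℝ (⊤ : ℕ∞) (fun w : ℂ => w / (‖w‖ : ℂ)) w := by
    simp only [div_eq_mul_inv]
    exact contDiffAt_id.mul (h1.inv (by simpa using hw))
  exact h2.contDiffWithinAt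

theorem contDiffOn_neg_log_norm : ContDiffOn ℝ (⊤ : ℕ∞) (fun w : ℂ => -Real.log ‖w‖) {0}ᶜ := by
  intro w hw
  exact (((contDiffAt_norm ℝ hw).log (by simpa using hw)).neg).contDiffWithinAt

theorem tame_profile_eq {X : ℂ → ℂ} {σ : ℂ → ℝ} {w Z : ℂ} (hw : Z ≠ 0)
    (hX : X w = Z / (‖Z‖ : ℂ)) (hσ : σ w = -Real.log ‖Z‖) {n : ℤ} (hn : -(1 / 2) ≤ n * σ w)
    (φ : ℂ → ℂ) : tame X σ profile n φ w = Z ^ n * φ w := by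
  have hw' : 0 < ‖Z‖ := norm_pos_iff.2 hw
  rw [tame, profile_eq_exp hn, smul_eq_mul, hX, hσ]
  congr 1
  have : Real.exp (-(n * -Real.log ‖Z‖)) = ‖Z‖ ^ n := by
    rw [show -((n : ℝ) * -Real.log ‖Z‖) = Real.log ‖Z‖ * n by ring, Real.exp_mul,
      Real.exp_log hw', Real.rpow_intCast]
  rw [this, div_zpow, ofReal_zpow, div_mul_cancel₀]
  exact zpow_ne_zero _ (by exact_mod_cast hw'.ne')

/-- A smooth periodic function extends from the unit circle, holomorphic to infinite order. -/
theorem exists_almost_holomorphic_extension {γ : ℝ → ℂ} (hγ : ContDiff ℝ (⊤ : ℕ∞) γ)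
    (hp : Function.Periodic γ (2 * Real.pi)) :
    ∃ G : ℂ → ℂ, ContDiff ℝ (⊤ : ℕ∞) G ∧ HasCompactSupport G ∧ (∀ t : ℝ, G (exp (t * I)) = γ t) ∧
      ∀ t : ℝ, FlatAt (dbar G) (exp (t * I)) := by
  obtain ⟨φ, hφ, h1, -⟩ := exists_bump (K := sphere (0 : ℂ) 1) (V := {0}ᶜ) (isCompact_sphere _ _)
    isOpen_compl_singleton fun z hz => by rintro rfl; simp at hz
  set X : ℂ → ℂ := fun w => w / (‖w‖ : ℂ)
  set σ : ℂ → ℝ := fun w => -Real.log ‖w‖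
  have hX1 : ∀ w ∈ ({0}ᶜ : Set ℂ), ‖X w‖ = 1 := fun w hw => by
    have : ‖w‖ ≠ 0 := norm_ne_zero_iff.2 hw
    simp [X, div_self this]
  have hX0 : ∀ w ∈ ({0}ᶜ : Set ℂ), X w ≠ 0 := fun w hw h => by
    have := hX1 w hw
    simp [h] at this
  have hb := exists_norm_iteratedFDeriv_tame_profile_le isOpen_compl_singleton
    contDiffOn_div_norm hX1 contDiffOn_neg_log_norm hφ
  choose C hC hb using hb
  set f : ℤ → ℂ → ℂ := fun n => fc γ n • tame X σ profile n φ
  have ht : ∀ n, Adm {0}ᶜ ∅ (tame X σ profile n φ) := fun n =>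
    hφ.tame isOpen_compl_singleton contDiffOn_div_norm hX0 contDiffOn_neg_log_norm
      (contDiff_iterate_deriv_profile 0) n
  have hf : ∀ n, ContDiff ℝ (⊤ : ℕ∞) (f n) := fun n =>
    contDiff_const.smul (ht n).contDiff
  choose D hD0 hD using exists_norm_fc_le hγ hp
  set v : ℕ → ℤ → ℝ := fun k n => (D (k + 2) * C k) * ((1 + |(n : ℝ)|) ^ 2)⁻¹
  have hv : ∀ k, Summable (v k) := fun k => summable_inv_one_add_abs_sq.mul_left _
  have hfv : ∀ k n z, ‖iteratedFDeriv ℝ k (f n) z‖ ≤ v k n := by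
    intro k n z
    rw [iteratedFDeriv_const_smul_apply (((ht n).contDiff.of_le (by exact_mod_cast le_top)).contDiffAt),
      norm_smul]
    calc _ ≤ (D (k + 2) * ((1 + |(n : ℝ)|) ^ (k + 2))⁻¹) * (C k * (1 + |(n : ℝ)|) ^ k) :=
          mul_le_mul (hD _ n) (hb k n z) (norm_nonneg _)
            (mul_nonneg (hD0 _) (by positivity))
      _ = v k n := by
          have : (1 + |(n : ℝ)|) ≠ 0 := by positivity
          simp only [v]
          field_simp
          ring
  have hloc : ∀ (t : ℝ) (n : ℤ), ∀ᶠ w in nhds (exp (t * I)), f n w = fc γ n * w ^ n := by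
    intro t n
    have hne : exp (t * I) ≠ 0 := exp_ne_zero _
    have hc : ContinuousAt (fun w => n * σ w) (exp (t * I)) :=
      continuousAt_const.mul ((contDiffOn_neg_log_norm.continuousOn.continuousAt
        (isOpen_compl_singleton.mem_nhds hne)))
    have h0 : (n : ℝ) * σ (exp (t * I)) = 0 := by simp [σ, norm_exp_ofReal_mul_I]
    have : ∀ᶠ w in nhds (exp (t * I)), -(1 / 2) < n * σ w :=
      hc.eventually_const_lt (by simp only [h0]; norm_num)
    filter_upwards [this, h1 (exp (t * I)) (by simp [norm_exp_ofReal_mul_I]),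
      isOpen_compl_singleton.mem_nhds hne] with w hw hφw hw0
    simp only [f, Pi.smul_apply, smul_eq_mul]
    rw [tame_profile_eq (X := X) (σ := σ) (w := w) (Z := w) hw0 rfl rfl hw.le, hφw, mul_one]
  refine ⟨fun w => ∑' n, f n w, ?_, ?_, ?_, ?_⟩
  · exact contDiff_tsum (N := (⊤ : ℕ∞)) hf (fun k _ => hv k) fun k n z _ => hfv k n z
  · refine hφ.compact.mono fun w hw => ?_
    contrapose! hw
    simp only [Function.mem_support, not_not] at hw ⊢
    simp [f, tame_eq_zero hw]
  · intro t
    have h2 := (hasSum_fc_mul_exp hγ.continuous hp (summable_fc hγ hp) t).tsum_eq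
    rw [← h2]
    refine tsum_congr fun n => ?_
    rw [(hloc t n).self_of_nhds, ← exp_int_mul, mul_assoc]
  · intro t
    refine flatAt_dbar_tsum hf hv hfv fun n => (flatAt_zero _).congr ?_
    filter_upwards [(hloc t n).eventually_nhds, isOpen_compl_singleton.mem_nhds (exp_ne_zero (t * I))]
      with w hw hw0
    rw [dbar_congr hw]
    exact dbar_eq_zero_of_differentiableAt
      ((differentiableAt_zpow.2 (Or.inl hw0)).const_mul (fc γ n))

end Extension

section Collar

/-- A smooth coordinate `Z` on a neighbourhood `V` of the curve `γ`, mapping `γ` to the unit circle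
and holomorphic to infinite order along `γ`. -/
structure Collar (γ : ℝ → ℂ) (V : Set ℂ) (Z : ℂ → ℂ) : Prop where
  isOpen : IsOpen V
  smooth : ContDiffOn ℝ (⊤ : ℕ∞) Z V
  ne_zero : ∀ z ∈ V, Z z ≠ 0
  mem : ∀ t, γ t ∈ V
  apply : ∀ t : ℝ, Z (γ t) = exp (t * I)
  flat : ∀ t, FlatAt (dbar Z) (γ t)
  dist : ∃ B : ℝ, 0 ≤ B ∧ ∀ z ∈ V, infDist z (range γ) ≤ B * |Real.log ‖Z z‖|

theorem exists_equiv_of_norm_dbar_lt {G : ℂ → ℂ} {w : ℂ} (h : ‖dbar G w‖ < ‖del G w‖) :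
    ∃ e : ℂ ≃L[ℝ] ℂ, (e : ℂ →L[ℝ] ℂ) = fderiv ℝ G w := by
  have hinj : Function.Injective (fderiv ℝ G w : ℂ →ₗ[ℝ] ℂ) := by
    refine (injective_iff_map_eq_zero _).2 fun v hv => ?_
    by_contra hv0
    have h1 : del G w * v = -(dbar G w * conj v) := by
      rw [eq_neg_iff_add_eq_zero, ← fderiv_apply_eq]
      exact hv
    have h2 := congrArg norm h1
    rw [norm_neg, norm_mul, norm_mul, RCLike.norm_conj] at h2
    exact h.ne' (mul_right_cancel₀ (norm_ne_zero_iff.2 hv0) h2)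
  refine ⟨(LinearEquiv.ofInjectiveEndo _ hinj).toContinuousLinearEquiv, ?_⟩
  ext v
  rfl

theorem isPreconnected_annulus {s : Set ℝ} (hs : IsPreconnected s) (h0 : ∀ x ∈ s, 0 ≤ x) :
    IsPreconnected {w : ℂ | ‖w‖ ∈ s} := by
  have : {w : ℂ | ‖w‖ ∈ s} = (fun p : ℝ × ℝ => (p.1 : ℂ) * exp (p.2 * I)) '' (s ×ˢ univ) := by
    ext w
    constructor
    · intro hw
      exact ⟨(‖w‖, arg w), ⟨hw, trivial⟩, norm_mul_exp_arg_mul_I w⟩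
    · rintro ⟨⟨ρ, t⟩, ⟨hρ, -⟩, rfl⟩
      simpa [norm_exp_ofReal_mul_I, abs_of_nonneg (h0 ρ hρ)] using hρ
  rw [this]
  exact (hs.prod isPreconnected_univ).image _ (by fun_prop)

theorem exists_annulus_subset {U : Set ℂ} (hU : IsOpen U) (h : sphere (0 : ℂ) 1 ⊆ U) :
    ∃ r : ℝ, 0 < r ∧ r ≤ 1 / 2 ∧ {w : ℂ | ‖w‖ ∈ Ioo (1 - r) (1 + r)} ⊆ U := by
  obtain ⟨δ, hδ, hsub⟩ := (isCompact_sphere (0 : ℂ) 1).exists_thickening_subset_open hU h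
  refine ⟨min δ (1 / 2), by positivity, min_le_right _ _, fun w hw => hsub ?_⟩
  have h1 := min_le_left δ (1 / 2 : ℝ)
  have h2 := min_le_right δ (1 / 2 : ℝ)
  have hw0 : 0 < ‖w‖ := by linarith [hw.1]
  refine mem_thickening_iff.2 ⟨w / (‖w‖ : ℂ), by simp [div_self hw0.ne'], ?_⟩
  have : w - w / (‖w‖ : ℂ) = w / (‖w‖ : ℂ) * ((‖w‖ - 1 : ℝ) : ℂ) := by
    have : (‖w‖ : ℂ) ≠ 0 := by exact_mod_cast hw0.ne'
    push_cast
    field_simp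
  rw [dist_eq_norm, this, norm_mul, norm_div, norm_real, norm_norm, div_self hw0.ne', one_mul,
    norm_real, Real.norm_eq_abs, abs_lt]
  constructor <;> linarith [hw.1, hw.2]

theorem abs_sub_one_le_log {x : ℝ} (h0 : 0 < x) (h1 : x ≤ 2) : |x - 1| ≤ 2 * |Real.log x| := by
  rcases le_total x 1 with h | h
  · rw [abs_of_nonpos (by linarith), abs_of_nonpos (Real.log_nonpos h0.le h)]
    linarith [Real.log_le_sub_one_of_pos h0, Real.log_nonpos h0.le h]
  · rw [abs_of_nonneg (by linarith), abs_of_nonneg (Real.log_nonneg h)]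
    have := Real.one_sub_inv_le_log_of_pos h0
    have h2 : (x - 1) / 2 ≤ 1 - x⁻¹ := by
      have : 1 - x⁻¹ = (x - 1) / x := by field_simp
      rw [this]
      gcongr
    linarith

theorem exists_collar {γ : ℝ → ℂ} (hγ : ContDiff ℝ (⊤ : ℕ∞) γ)
    (hp : Function.Periodic γ (2 * Real.pi)) (hinj : InjOn γ (Ico 0 (2 * Real.pi)))
    (hder : ∀ t, deriv γ t ≠ 0) {O : Set ℂ} (hO : IsOpen O) (hγO : ∀ t, γ t ∈ O) :
    ∃ V Z, Collar γ V Z ∧ V ⊆ O ∧ IsPreconnected {z ∈ V | ‖Z z‖ < 1} ∧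
      IsPreconnected {z ∈ V | 1 < ‖Z z‖} ∧
      ∀ t, γ t ∈ closure {z ∈ V | ‖Z z‖ < 1} ∧ γ t ∈ closure {z ∈ V | 1 < ‖Z z‖} := by
  obtain ⟨G, hG, hGc, hGγ, hflat⟩ := exists_almost_holomorphic_extension hγ hp
  have hGd : Differentiable ℝ G := hG.differentiable (by simp)
  have hsph : ∀ w ∈ sphere (0 : ℂ) 1, ∃ t : ℝ, t ∈ Ico 0 (2 * Real.pi) ∧ w = exp (t * I) := by
    intro w hw
    have hw1 : ‖w‖ = 1 := by simpa using hw
    have h1 : exp (arg w * I) = w := by simpa [hw1] using norm_mul_exp_arg_mul_I w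
    have hper : Function.Periodic (fun t : ℝ => exp (t * I)) (2 * Real.pi) := fun t => by
      simp only [ofReal_add, add_mul, exp_add]
      simp
    obtain ⟨s, hs, hst⟩ := hper.exists_mem_Ico₀ Real.two_pi_pos (arg w)
    exact ⟨s, hs, by rw [← h1]; exact hst⟩
  have hdel : ∀ t : ℝ, del G (exp (t * I)) ≠ 0 := by
    intro t h0
    have h1 : HasDerivAt (fun t : ℝ => exp (t * I)) (exp (t * I) * I) t := by
      have := ((hasDerivAt_id t).ofReal_comp.mul_const I).cexp
      simpa using this
    have h2 := (hGd (exp (t * I))).hasFDerivAt.comp_hasDerivAt t h1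
    have h3 : HasDerivAt γ 0 t := by
      refine (h2.congr_of_eventuallyEq (Filter.Eventually.of_forall fun s => (hGγ s).symm)).congr_deriv ?_
      rw [fderiv_apply_eq, h0, (hflat t).eq_zero]
      simp
    exact hder t h3.deriv
  set U : Set ℂ := {w | ‖dbar G w‖ < ‖del G w‖} with hUdef
  have hdelc : Continuous (del G) :=
    (contDiffOn_univ.1 (ContDiffOn.del isOpen_univ hG.contDiffOn)).continuous
  have hUo : IsOpen U := isOpen_lt hG.dbar.continuous.norm hdelc.norm
  have hUs : sphere (0 : ℂ) 1 ⊆ U := by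
    intro w hw
    obtain ⟨t, -, rfl⟩ := hsph w hw
    simp only [hUdef, mem_ofPred_eq, (hflat t).eq_zero, norm_zero]
    exact norm_pos_iff.2 (hdel t)
  have hstrict : ∀ w, HasStrictFDerivAt G (fderiv ℝ G w) w := fun w =>
    hG.contDiffAt.hasStrictFDerivAt (by simp)
  obtain ⟨T, hT, hTinj⟩ := InjOn.exists_mem_nhdsSet (f := G) (s := sphere (0 : ℂ) 1)
    (by
      intro w hw w' hw' h
      obtain ⟨t, ht, rfl⟩ := hsph w hw
      obtain ⟨t', ht', rfl⟩ := hsph w' hw'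
      rw [hGγ, hGγ] at h
      rw [hinj ht ht' h]) (isCompact_sphere _ _) (fun w _ => hG.continuous.continuousAt)
    (by
      intro w hw
      obtain ⟨e, he⟩ := exists_equiv_of_norm_dbar_lt (hUs hw)
      have hs := hstrict w
      rw [← he] at hs
      exact ⟨_, (hs.toOpenPartialHomeomorph G).open_source.mem_nhds
        hs.mem_toOpenPartialHomeomorph_source, (hs.toOpenPartialHomeomorph G).injOn⟩)
  obtain ⟨r, hr0, hr2, hr⟩ := exists_annulus_subset
    ((isOpen_interior (s := T)).inter (hUo.inter (hO.preimage hG.continuous)))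
    (subset_inter (subset_interior_iff_mem_nhdsSet.2 hT) (subset_inter hUs fun w hw => by
      obtain ⟨t, -, rfl⟩ := hsph w hw
      simpa [hGγ] using hγO t))
  set A : Set ℂ := {w : ℂ | ‖w‖ ∈ Ioo (1 - r) (1 + r)} with hA
  have hAo : IsOpen A := isOpen_Ioo.preimage continuous_norm
  have hAinj : InjOn G A := hTinj.mono fun w hw => interior_subset (hr hw).1
  have hAU : A ⊆ U := fun w hw => (hr hw).2.1
  have hA0 : ∀ w ∈ A, w ≠ 0 := by
    rintro w hw rfl
    have := hw.1
    simp at this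
    linarith
  have hcirc : ∀ t : ℝ, exp (t * I) ∈ A := fun t => by
    simp only [hA, mem_ofPred_eq, norm_exp_ofReal_mul_I]
    constructor <;> linarith
  have hopen : ∀ B ⊆ A, IsOpen B → IsOpen (G '' B) := by
    intro B hB hBo
    rw [isOpen_iff_mem_nhds]
    rintro _ ⟨w, hw, rfl⟩
    obtain ⟨e, he⟩ := exists_equiv_of_norm_dbar_lt (hAU (hB hw))
    have hs := hstrict w
    rw [← he] at hs
    rw [← hs.map_nhds_eq_of_equiv]
    exact Filter.image_mem_map (hBo.mem_nhds hw)
  set Z := Function.invFunOn G A with hZ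
  have hZG : ∀ w ∈ A, Z (G w) = w := fun w hw => hAinj.leftInvOn_invFunOn hw
  have hZsmooth : ContDiffOn ℝ (⊤ : ℕ∞) Z (G '' A) := by
    rintro _ ⟨w, hw, rfl⟩
    refine ContDiffAt.contDiffWithinAt ?_
    obtain ⟨e, he⟩ := exists_equiv_of_norm_dbar_lt (hAU hw)
    have hs := hstrict w
    rw [← he] at hs
    have h1 := hG.contDiffAt.to_localInverse (n := (⊤ : ℕ∞)) hs.hasFDerivAt (by simp)
    refine h1.congr_of_eventuallyEq ?_
    have h2 : ContDiffAt ℝ (⊤ : ℕ∞) G w := hG.contDiffAt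
    have h3 := h2.hasStrictFDerivAt' hs.hasFDerivAt (by simp)
    have h4 : h2.localInverse hs.hasFDerivAt (by simp) (G w) = w := h3.localInverse_apply_image
    have h5 : ContinuousAt (h2.localInverse hs.hasFDerivAt (by simp)) (G w) := h1.continuousAt
    filter_upwards [h3.eventually_right_inverse, h5.preimage_mem_nhds
      (by rw [h4]; exact hAo.mem_nhds hw)] with z hz hzA
    change Z z = h2.localInverse hs.hasFDerivAt (by simp) z
    conv_lhs => rw [← hz]
    exact hZG _ hzA
  have hVo := hopen A subset_rfl hAo
  have hhalf : ∀ P : ℝ → Prop, {z ∈ G '' A | P ‖Z z‖} = G '' {w : ℂ | ‖w‖ ∈ Ioo (1 - r) (1 + r) ∧ P ‖w‖} := by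
    intro P
    ext z
    constructor
    · rintro ⟨⟨w, hw, rfl⟩, h⟩
      rw [hZG w hw] at h
      exact ⟨w, ⟨hw, h⟩, rfl⟩
    · rintro ⟨w, ⟨hw, h⟩, rfl⟩
      exact ⟨⟨w, hw, rfl⟩, by rwa [hZG w hw]⟩
  have hlow : {w : ℂ | ‖w‖ ∈ Ioo (1 - r) (1 + r) ∧ ‖w‖ < 1} = {w : ℂ | ‖w‖ ∈ Ioo (1 - r) 1} := by
    ext w
    simp only [mem_ofPred_eq, mem_Ioo]
    constructor
    · rintro ⟨⟨h1, h2⟩, h3⟩; exact ⟨h1, h3⟩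
    · rintro ⟨h1, h3⟩; exact ⟨⟨h1, by linarith⟩, h3⟩
  have hhigh : {w : ℂ | ‖w‖ ∈ Ioo (1 - r) (1 + r) ∧ 1 < ‖w‖} = {w : ℂ | ‖w‖ ∈ Ioo 1 (1 + r)} := by
    ext w
    simp only [mem_ofPred_eq, mem_Ioo]
    constructor
    · rintro ⟨⟨h1, h2⟩, h3⟩; exact ⟨h3, h2⟩
    · rintro ⟨h1, h3⟩; exact ⟨⟨by linarith, h3⟩, h1⟩
  have hclos : ∀ (t : ℝ) (s : Set ℝ), (∀ x ∈ s, 0 ≤ x) → 1 ∈ closure s →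
      γ t ∈ closure (G '' {w : ℂ | ‖w‖ ∈ s}) := by
    intro t s hs h1
    have h2 : γ t ∈ (fun ρ : ℝ => G (ρ * exp (t * I))) '' closure s :=
      ⟨1, h1, by simp [hGγ]⟩
    refine closure_mono ?_ (image_closure_subset_closure_image
      (hG.continuous.comp (by fun_prop)) h2)
    rintro _ ⟨ρ, hρ, rfl⟩
    refine ⟨_, ?_, rfl⟩
    simpa [norm_exp_ofReal_mul_I, abs_of_nonneg (hs ρ hρ)] using hρ
  refine ⟨G '' A, Z, ⟨hVo, hZsmooth, ?_, ?_, ?_, ?_, ?_⟩, ?_, ?_, ?_, ?_⟩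
  · rintro _ ⟨w, hw, rfl⟩
    rw [hZG w hw]
    exact hA0 w hw
  · exact fun t => ⟨_, hcirc t, hGγ t⟩
  · intro t
    rw [← hGγ, hZG _ (hcirc t)]
  · intro t
    have hγV : γ t ∈ G '' A := ⟨_, hcirc t, hGγ t⟩
    have hmaps : MapsTo Z (G '' A) A := by
      rintro _ ⟨w, hw, rfl⟩
      rwa [hZG w hw]
    have hdel0 : ∀ w ∈ A, del G w ≠ 0 := fun w hw h => by
      have := hAU hw
      simp only [hUdef, mem_ofPred_eq, h, norm_zero] at this
      exact absurd this (not_lt.2 (norm_nonneg _))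
    have hfor : ∀ z ∈ G '' A, dbar Z z = dbar G (Z z) * (-(conj (del Z z)) / del G (Z z)) := by
      intro z hz
      have hd : HasFDerivAt Z (fderiv ℝ Z z) z :=
        ((hZsmooth.contDiffAt (hVo.mem_nhds hz)).differentiableAt (by simp)).hasFDerivAt
      have h1 : HasFDerivAt (fun z => G (Z z)) ((fderiv ℝ G (Z z)).comp (fderiv ℝ Z z)) z :=
        (hGd (Z z)).hasFDerivAt.comp z hd
      have h2 : HasFDerivAt (fun z => G (Z z)) (ContinuousLinearMap.id ℝ ℂ) z := by
        refine (hasFDerivAt_id z).congr_of_eventuallyEq ?_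
        filter_upwards [hVo.mem_nhds hz] with y hy
        obtain ⟨w, hw, rfl⟩ := hy
        rw [hZG w hw, id]
      have h3 := h1.unique h2
      have e1 := DFunLike.congr_fun h3 1
      have e2 := DFunLike.congr_fun h3 I
      simp only [ContinuousLinearMap.comp_apply, ContinuousLinearMap.id_apply, fderiv_apply_eq, map_one,
        mul_one, conj_I, map_add, map_mul, map_neg] at e1 e2
      have h4 := hdel0 _ (hmaps hz)
      field_simp
      linear_combination (1 / 2 : ℂ) * e1 + (I / 2) * e2 + (
        -(1 / 2 : ℂ) * (del G (Z z) * (del Z z - dbar Z z) + dbar G (Z z) * (conj (dbar Z z) - conj (del Z z))) + 1 / 2) * I_sq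
    refine FlatAt.congr (FlatAt.bilinear (ContinuousLinearMap.mul ℝ ℂ) hVo hγV
      (f := fun z => dbar G (Z z)) (g := fun z => -(conj (del Z z)) / del G (Z z))
      (hG.dbar.comp_contDiffOn hZsmooth) ?_ ?_) ?_
    · have h1 : ContDiffOn ℝ (⊤ : ℕ∞) (del G) univ := ContDiffOn.del isOpen_univ hG.contDiffOn
      simp only [div_eq_mul_inv]
      exact ((conjCLE.contDiff.comp_contDiffOn (ContDiffOn.del hVo hZsmooth)).neg).mul
        (((contDiffOn_univ.1 h1).comp_contDiffOn hZsmooth).inv fun z hz => hdel0 _ (hmaps hz))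
    · refine FlatAt.comp hVo isOpen_univ hγV (mapsTo_univ _ _) hG.dbar.contDiffOn hZsmooth ?_
      rw [← hGγ, hZG _ (hcirc t)]
      exact hflat t
    · filter_upwards [hVo.mem_nhds hγV] with z hz
      rw [hfor z hz]
      rfl
  · obtain ⟨K, hK⟩ := hG.lipschitzWith_of_hasCompactSupport hGc (by simp)
    refine ⟨K * 2, by positivity, ?_⟩
    rintro _ ⟨w, hw, rfl⟩
    rw [hZG w hw]
    have hw0 : 0 < ‖w‖ := norm_pos_iff.2 (hA0 w hw)
    have hwu : w / (‖w‖ : ℂ) ∈ sphere (0 : ℂ) 1 := by simp [div_self hw0.ne']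
    obtain ⟨t, -, ht⟩ := hsph _ hwu
    refine (infDist_le_dist_of_mem (mem_range_self t)).trans ?_
    rw [← hGγ, ← ht, mul_assoc]
    refine (hK.dist_le_mul _ _).trans ?_
    gcongr
    refine le_trans (le_of_eq ?_) (abs_sub_one_le_log hw0 (by linarith [hw.2]))
    have : w - w / (‖w‖ : ℂ) = w / (‖w‖ : ℂ) * ((‖w‖ - 1 : ℝ) : ℂ) := by
      have : (‖w‖ : ℂ) ≠ 0 := by exact_mod_cast hw0.ne'
      push_cast
      field_simp
    rw [dist_eq_norm, this, norm_mul, norm_div, norm_real, norm_norm, div_self hw0.ne', one_mul,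
      norm_real, Real.norm_eq_abs]
  · rintro _ ⟨w, hw, rfl⟩
    exact (hr hw).2.2
  · rw [hhalf fun x => x < 1, hlow]
    exact (isPreconnected_annulus isPreconnected_Ioo fun x hx => by linarith [hx.1]).image _
      hG.continuous.continuousOn
  · rw [hhalf fun x => 1 < x, hhigh]
    exact (isPreconnected_annulus isPreconnected_Ioo fun x hx => by linarith [hx.1]).image _
      hG.continuous.continuousOn
  · intro t
    constructor
    · rw [hhalf fun x => x < 1, hlow]
      refine hclos t _ (fun x hx => by linarith [hx.1]) ?_
      rw [closure_Ioo (by linarith)]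
      constructor <;> linarith
    · rw [hhalf fun x => 1 < x, hhigh]
      refine hclos t _ (fun x hx => by linarith [hx.1]) ?_
      rw [closure_Ioo (by linarith)]
      constructor <;> linarith

end Collar

section OneSided

theorem dbar_fderiv {χ : ℂ → ℂ} (h : ContDiff ℝ (⊤ : ℕ∞) χ) :
    dbar (fderiv ℝ χ) = fderiv ℝ (dbar χ) := by
  have hd : Differentiable ℝ (fderiv ℝ χ) :=
    (h.fderiv_right (m := (⊤ : ℕ∞)) (by simp)).differentiable (by simp)
  ext z v
  have hs : IsSymmSndFDerivAt ℝ χ z := h.contDiffAt.isSymmSndFDerivAt (by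
    simpa using (show ((2 : ℕ∞) : WithTop ℕ∞) ≤ ((⊤ : ℕ∞) : WithTop ℕ∞) by exact_mod_cast le_top))
  have h1 : HasFDerivAt (dbar χ) (dbarL.comp (fderiv ℝ (fderiv ℝ χ) z)) z := by
    rw [dbar_eq_comp]
    exact dbarL.hasFDerivAt.comp z (hd z).hasFDerivAt
  rw [h1.fderiv, dbar_def]
  simp [dbarL_apply, hs 1 v, hs I v, mul_add]

/-- A domain cannot contain both sides of a curve disjoint from it near that curve. -/
theorem Collar.not_both_sides {γ : ℝ → ℂ} {V Ω : Set ℂ} {Z : ℂ → ℂ} (h : Collar γ V Z)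
    (hγ : Continuous γ) (hp : Function.Periodic γ (2 * Real.pi)) (hΩo : IsOpen Ω)
    (hΩ : IsPreconnected Ω) (hγΩ : ∀ t, γ t ∉ Ω)
    (hin : {z ∈ V | ‖Z z‖ < 1} ⊆ Ω) (hout : {z ∈ V | 1 < ‖Z z‖} ⊆ Ω)
    (hcl : γ 0 ∈ closure {z ∈ V | ‖Z z‖ < 1} ∧ γ 0 ∈ closure {z ∈ V | 1 < ‖Z z‖}) : False := by
  have hK : IsCompact (range γ) := by
    have := hp.image_Icc (by positivity) 0
    rw [← this]
    exact isCompact_Icc.image hγ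
  obtain ⟨χ, hχ, hχ1, -⟩ := exists_bump hK h.isOpen (range_subset_iff.2 h.mem)
  have hmem : ∀ z ∈ V, ‖Z z‖ = 1 → z ∈ range γ := by
    intro z hz hz1
    obtain ⟨B, hB0, hB⟩ := h.dist
    have := hB z hz
    rw [hz1, Real.log_one, abs_zero, mul_zero] at this
    exact hK.isClosed.closure_eq ▸ (mem_closure_iff_infDist_zero (range_nonempty γ)).2
      (le_antisymm this infDist_nonneg)
  have hcont : ContinuousOn (fun z => ‖Z z‖) V := h.smooth.continuousOn.norm
  set Vp : Set ℂ := {z ∈ V | 1 < ‖Z z‖} with hVp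
  set Vm : Set ℂ := {z ∈ V | ‖Z z‖ < 1} with hVm
  have hVpo : IsOpen Vp := hcont.isOpen_inter_preimage h.isOpen isOpen_Ioi
  have hVmo : IsOpen Vm := hcont.isOpen_inter_preimage h.isOpen isOpen_Iio
  have hdisj : Disjoint Vp Vm := by
    rw [Set.disjoint_left]
    rintro z ⟨_, h1⟩ ⟨_, h2⟩
    exact absurd (h1.trans h2) (lt_irrefl _)
  have hm0 : ∀ {F : Type} [Zero F] (f : ℂ → F), ∀ z ∈ Vm, Vp.indicator f =ᶠ[nhds z] 0 := by
    intro F _ f z hz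
    filter_upwards [hVmo.mem_nhds hz] with y hy
    exact indicator_of_notMem (fun h => Set.disjoint_left.1 hdisj h hy) _
  have hp0 : ∀ {F : Type} [Zero F] (f : ℂ → F), ∀ z ∈ Vp, Vp.indicator f =ᶠ[nhds z] f := by
    intro F _ f z hz
    filter_upwards [hVpo.mem_nhds hz] with y hy
    exact indicator_of_mem hy _
  have ht0 : ∀ {F : Type} [NormedAddCommGroup F] (f : ℂ → F), ∀ z ∉ tsupport f,
      Vp.indicator f =ᶠ[nhds z] f := by
    intro F _ f z hz
    filter_upwards [notMem_tsupport_iff_eventuallyEq.1 hz] with y hy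
    rw [hy]
    simp [indicator, hy]
  have hcase : ∀ z, z ∈ range γ ∨ z ∈ Vp ∨ z ∈ Vm ∨ z ∉ tsupport χ := by
    intro z
    by_cases hz : z ∈ V
    · rcases lt_trichotomy ‖Z z‖ 1 with h1 | h1 | h1
      · exact Or.inr (Or.inr (Or.inl ⟨hz, h1⟩))
      · exact Or.inl (hmem z hz h1)
      · exact Or.inr (Or.inl ⟨hz, h1⟩)
    · exact Or.inr (Or.inr (Or.inr fun h' => hz (hχ.subset h')))
  have hdχ : Differentiable ℝ χ := hχ.contDiff.differentiable (by simp)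
  set Λ : ℂ → ℂ →L[ℝ] ℂ := Vp.indicator (fderiv ℝ χ) with hΛ
  have hΛc : ∀ z, Λ =ᶠ[nhds z] fderiv ℝ χ ∨ Λ =ᶠ[nhds z] fun _ => 0 := by
    intro z
    rcases hcase z with ⟨t, rfl⟩ | hz | hz | hz
    · right
      filter_upwards [(hχ1 _ ⟨t, rfl⟩).eventually_nhds] with y hy
      have : fderiv ℝ χ y = 0 := by
        rw [Filter.EventuallyEq.fderiv_eq (f := fun _ => (1 : ℂ)) hy]
        simp
      simp [hΛ, indicator, this]
    · exact Or.inl (hp0 _ z hz)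
    · exact Or.inr (hm0 _ z hz)
    · refine Or.inl (ht0 _ z fun h' => hz (tsupport_fderiv_subset ℝ h'))
  have hdχs : ContDiff ℝ (⊤ : ℕ∞) (fderiv ℝ χ) := hχ.contDiff.fderiv_right (by simp)
  have hΛs : ContDiff ℝ (⊤ : ℕ∞) Λ := by
    refine contDiff_iff_contDiffAt.2 fun z => ?_
    rcases hΛc z with hz | hz
    · exact hdχs.contDiffAt.congr_of_eventuallyEq hz
    · exact contDiffAt_const.congr_of_eventuallyEq hz
  have hΛsupp : HasCompactSupport Λ :=
    (hχ.compact.fderiv ℝ).mono (support_indicator.trans_subset inter_subset_right)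
  set q : ℂ → ℂ := dbarL ∘ Λ with hq
  have hqs : ContDiff ℝ (⊤ : ℕ∞) q := dbarL.contDiff.comp hΛs
  have hqc : HasCompactSupport q := hΛsupp.comp_left (map_zero dbarL)
  have hqΛ : fderiv ℝ q = dbar Λ := by
    ext1 z
    rcases hΛc z with hz | hz
    · have h1 : q =ᶠ[nhds z] dbar χ := by
        filter_upwards [hz] with y hy
        rw [hq, Function.comp_apply, hy, dbar_eq_comp, Function.comp_apply]
      rw [h1.fderiv_eq, ← dbar_fderiv hχ.contDiff, dbar_def, dbar_def, hz.fderiv_eq]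
    · have h1 : q =ᶠ[nhds z] fun _ => 0 := by
        filter_upwards [hz] with y hy
        rw [hq, Function.comp_apply, hy, map_zero]
      rw [h1.fderiv_eq, dbar_def, hz.fderiv_eq]
      simp
  set φ := cauchyT q with hφ
  have hφs : ContDiff ℝ (⊤ : ℕ∞) φ := contDiff_cauchyT hqs hqc
  have hφd : ∀ z, fderiv ℝ φ z = Λ z := by
    intro z
    rw [hφ, fderiv_cauchyT (hqs.of_le (by simp)) hqc, hqΛ,
      cauchyT_dbar (hΛs.of_le (by simp)) hΛsupp]
  set lam := Vp.indicator χ with hlam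
  have hlamd : ∀ z, z ∉ range γ → HasFDerivAt lam (Λ z) z := by
    intro z hz
    rcases hcase z with h1 | h1 | h1 | h1
    · exact absurd h1 hz
    · rw [hΛ, indicator_of_mem h1]
      exact (hdχ z).hasFDerivAt.congr_of_eventuallyEq (hp0 _ z h1)
    · rw [hΛ, (hm0 (fderiv ℝ χ) z h1).eq_of_nhds]
      exact (hasFDerivAt_const (0 : ℂ) z).congr_of_eventuallyEq (hm0 _ z h1)
    · have h2 : z ∉ tsupport (fderiv ℝ χ) := fun h' => h1 (tsupport_fderiv_subset ℝ h')
      rw [hΛ, (ht0 _ z h2).eq_of_nhds]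
      exact (hdχ z).hasFDerivAt.congr_of_eventuallyEq (ht0 _ z h1)
  have hΩγ : ∀ z ∈ Ω, z ∉ range γ := by
    rintro z hz ⟨t, rfl⟩
    exact hγΩ t hz
  have hmu : ∀ z ∈ Ω, HasFDerivAt (fun z => φ z - lam z) (0 : ℂ →L[ℝ] ℂ) z := by
    intro z hz
    have := ((hφs.differentiable (by simp)) z).hasFDerivAt.sub (hlamd z (hΩγ z hz))
    rwa [hφd, sub_self] at this
  obtain ⟨c, hc⟩ : ∃ c, ∀ z ∈ Ω, φ z - lam z = c := by
    have := hΩo.exists_is_const_of_fderiv_eq_zero hΩ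
      (fun z hz => (hmu z hz).differentiableAt.differentiableWithinAt)
      (fun z hz => (hmu z hz).fderiv)
    exact this
  have hcφ : Filter.Tendsto φ (nhds (γ 0)) (nhds (φ (γ 0))) := hφs.continuous.continuousAt
  have e1 : φ (γ 0) = c := by
    refine isClosed_singleton.mem_of_frequently_of_tendsto (s := {c})
      ((mem_closure_iff_frequently.1 hcl.1).mono fun z hz => ?_) hcφ
    have := hc z (hin hz)
    rwa [hlam, (hm0 χ z hz).eq_of_nhds, Pi.zero_apply, sub_zero] at this
  have e2 : φ (γ 0) = c + 1 := by
    refine isClosed_singleton.mem_of_frequently_of_tendsto (s := {c + 1})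
      (((mem_closure_iff_frequently.1 hcl.2).and_eventually (hχ1 _ ⟨0, rfl⟩)).mono
        fun z hz => ?_) hcφ
    have := hc z (hout hz.1)
    rw [hlam, (hp0 χ z hz.1).eq_of_nhds, hz.2] at this
    rw [mem_singleton_iff, ← this, sub_add_cancel]
  rw [e1] at e2
  simp at e2

theorem Collar.inv {γ : ℝ → ℂ} {V : Set ℂ} {Z : ℂ → ℂ} (h : Collar γ V Z) :
    Collar (fun t => γ (-t)) V fun z => (Z z)⁻¹ where
  isOpen := h.isOpen
  smooth := h.smooth.inv h.ne_zero
  ne_zero z hz := inv_ne_zero (h.ne_zero z hz)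
  mem t := h.mem _
  apply t := by
    rw [h.apply, ← exp_neg]
    push_cast
    ring_nf
  flat t := by
    have h1 : ContDiffOn ℝ (⊤ : ℕ∞) (fun z => -((Z z)⁻¹ ^ 2)) V :=
      ((h.smooth.inv h.ne_zero).pow 2).neg
    refine FlatAt.congr (FlatAt.bilinear (ContinuousLinearMap.mul ℝ ℂ) h.isOpen (h.mem (-t))
      (ContDiffOn.dbar h.isOpen h.smooth) h1 (h.flat (-t))) ?_
    filter_upwards [h.isOpen.mem_nhds (h.mem (-t))] with z hz
    have h0 := h.ne_zero z hz
    rw [dbar_comp_holomorphic (f := fun w => w⁻¹) (differentiableAt_inv h0)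
      ((h.smooth.contDiffAt (h.isOpen.mem_nhds hz)).differentiableAt (by simp)), deriv_inv]
    simp
    ring
  dist := by
    obtain ⟨B, hB0, hB⟩ := h.dist
    refine ⟨B, hB0, fun z hz => ?_⟩
    have : range (fun t => γ (-t)) = range γ := (Equiv.neg ℝ).surjective.range_comp γ
    rw [this, norm_inv, Real.log_inv, abs_neg]
    exact hB z hz

/-- Near a boundary curve of a domain, the domain lies on the inner side of a suitable collar. -/
theorem exists_inner_collar {Ω O : Set ℂ} {γ : ℝ → ℂ} (hΩo : IsOpen Ω) (hΩ : IsPreconnected Ω)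
    (hγ : ContDiff ℝ (⊤ : ℕ∞) γ) (hp : Function.Periodic γ (2 * Real.pi))
    (hinj : InjOn γ (Ico 0 (2 * Real.pi))) (hder : ∀ t, deriv γ t ≠ 0) (hO : IsOpen O)
    (hγO : ∀ t, γ t ∈ O) (hOΩ : O ∩ frontier Ω ⊆ range γ) (hγΩ : range γ ⊆ frontier Ω) :
    ∃ (γ' : ℝ → ℂ) (V : Set ℂ) (Z : ℂ → ℂ), ContDiff ℝ (⊤ : ℕ∞) γ' ∧
      Function.Periodic γ' (2 * Real.pi) ∧ range γ' = range γ ∧ Collar γ' V Z ∧ V ⊆ O ∧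
      ∀ z ∈ V ∩ Ω, ‖Z z‖ < 1 := by
  obtain ⟨V, Z, h, hVO, hpm, hpp, hcl⟩ := exists_collar hγ hp hinj hder hO hγO
  have hγΩ' : ∀ t, γ t ∉ Ω := fun t ht =>
    (hΩo.inter_frontier_eq ▸ (⟨ht, hγΩ ⟨t, rfl⟩⟩ : γ t ∈ Ω ∩ frontier Ω) : γ t ∈ (∅ : Set ℂ))
  have hnorm : ∀ z ∈ V, z ∈ frontier Ω → ‖Z z‖ = 1 := by
    intro z hz hzΩ
    obtain ⟨t, rfl⟩ := hOΩ ⟨hVO hz, hzΩ⟩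
    rw [h.apply, norm_exp_ofReal_mul_I]
  have key : ∀ S ⊆ V, IsPreconnected S → (∀ z ∈ S, ‖Z z‖ ≠ 1) → (∃ z ∈ S, z ∈ Ω) → S ⊆ Ω := by
    intro S hSV hS hS1 hne
    refine hS.subset_left_of_subset_union hΩo isClosed_closure.isOpen_compl
      (Set.disjoint_left.2 fun z hz hz' => hz' (subset_closure hz)) (fun z hz => ?_) hne
    by_contra hcon
    rw [mem_union, not_or, mem_compl_iff, not_not] at hcon
    refine hS1 z hz (hnorm z (hSV hz) ?_)
    rw [hΩo.frontier_eq]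
    exact ⟨hcon.2, hcon.1⟩
  have hΩ1 : ∀ z ∈ V ∩ Ω, ‖Z z‖ ≠ 1 := by
    intro z hz hz1
    obtain ⟨B, hB0, hB⟩ := h.dist
    have h1 := hB z hz.1
    rw [hz1, Real.log_one, abs_zero, mul_zero] at h1
    have hK : IsClosed (range γ) := by
      rw [← hp.image_Icc (by positivity) 0]
      exact (isCompact_Icc.image hγ.continuous).isClosed
    obtain ⟨t, rfl⟩ : z ∈ range γ := hK.closure_eq ▸
      (mem_closure_iff_infDist_zero (range_nonempty γ)).2 (le_antisymm h1 infDist_nonneg)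
    exact hγΩ' t hz.2
  by_cases hout : ∃ z ∈ {z ∈ V | 1 < ‖Z z‖}, z ∈ Ω
  · by_cases hin : ∃ z ∈ {z ∈ V | ‖Z z‖ < 1}, z ∈ Ω
    · exact (h.not_both_sides hγ.continuous hp hΩo hΩ hγΩ'
        (key _ (fun z hz => hz.1) hpm (fun z hz => hz.2.ne) hin)
        (key _ (fun z hz => hz.1) hpp (fun z hz => hz.2.ne') hout) (hcl 0)).elim
    · push Not at hin
      refine ⟨fun t => γ (-t), V, fun z => (Z z)⁻¹, hγ.comp contDiff_neg, fun t => ?_,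
        (Equiv.neg ℝ).surjective.range_comp γ, h.inv, hVO, fun z hz => ?_⟩
      · show γ (-(t + 2 * Real.pi)) = γ (-t)
        rw [neg_add, ← sub_eq_add_neg, hp.sub_eq]
      · rw [norm_inv]
        refine inv_lt_one_of_one_lt₀ (lt_of_le_of_ne (not_lt.1 fun h' => ?_) (hΩ1 z hz).symm)
        exact hin z ⟨hz.1, h'⟩ hz.2
  · push Not at hout
    refine ⟨γ, V, Z, hγ, hp, rfl, h, hVO, fun z hz => ?_⟩
    exact lt_of_le_of_ne (not_lt.1 fun h' => hout z ⟨hz.1, h'⟩ hz.2) (hΩ1 z hz)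

end OneSided

section Collars

/-- Pairwise disjoint inner collars for all boundary curves of a bounded domain, with cutoffs. -/
structure Collars (Ω : Set ℂ) {N : ℕ} (γ : Fin N → ℝ → ℂ) (V : Fin N → Set ℂ)
    (Z χ : Fin N → ℂ → ℂ) : Prop where
  isOpen : IsOpen Ω
  connected : IsConnected Ω
  bounded : Bornology.IsBounded Ω
  smooth : ∀ i, ContDiff ℝ (⊤ : ℕ∞) (γ i)
  periodic : ∀ i, Function.Periodic (γ i) (2 * Real.pi)
  collar : ∀ i, Collar (γ i) (V i) (Z i)
  disjoint : Pairwise fun i j => Disjoint (V i) (V j)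
  frontier_eq : frontier Ω = ⋃ i, range (γ i)
  inner : ∀ i, ∀ z ∈ V i ∩ Ω, ‖Z i z‖ < 1
  adm : ∀ i, Adm (V i) ∅ (χ i)
  eq_one : ∀ i t, ∀ᶠ w in nhds (γ i t), χ i w = 1

theorem isCompact_range_of_periodic {γ : ℝ → ℂ} (hγ : Continuous γ)
    (hp : Function.Periodic γ (2 * Real.pi)) : IsCompact (range γ) := by
  rw [← hp.image_Icc (by positivity) 0]
  exact isCompact_Icc.image hγ

theorem exists_collars {Ω : Set ℂ} (hΩo : IsOpen Ω) (hΩ : IsConnected Ω)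
    (hs : HasSmoothBoundary Ω) : ∃ (N : ℕ) (γ : Fin N → ℝ → ℂ) (V : Fin N → Set ℂ)
      (Z χ : Fin N → ℂ → ℂ), Collars Ω γ V Z χ := by
  obtain ⟨hb, N, γ, hγ, hp, hinj, hder, hdisj, hfr⟩ := hs
  have hK : ∀ i, IsCompact (range (γ i)) := fun i =>
    isCompact_range_of_periodic (hγ i).continuous (hp i)
  set O : Fin N → Set ℂ := fun i => ⋂ j, {z | j ≠ i → infDist z (range (γ i)) < infDist z (range (γ j))}
    with hOdef
  have hOo : ∀ i, IsOpen (O i) := fun i => isOpen_iInter_of_finite fun j => by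
    by_cases hj : j = i
    · simp [hj]
    · simp only [ne_eq, hj, not_false_eq_true, forall_const]
      exact isOpen_lt (continuous_infDist_pt _) (continuous_infDist_pt _)
  have hOd : Pairwise fun i j => Disjoint (O i) (O j) := by
    intro i j hij
    rw [Set.disjoint_left]
    intro z hi hj
    have h1 := mem_iInter.1 hi j hij.symm
    have h2 := mem_iInter.1 hj i hij
    exact absurd (h1.trans h2) (lt_irrefl _)
  have hγO : ∀ i t, γ i t ∈ O i := by
    intro i t
    refine mem_iInter.2 fun j hj => ?_
    rw [infDist_zero_of_mem (mem_range_self t)]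
    exact ((hK j).isClosed.notMem_iff_infDist_pos (range_nonempty _)).1
      (Set.disjoint_left.1 (hdisj hj.symm) ⟨t, rfl⟩)
  have hOΩ : ∀ i, O i ∩ frontier Ω ⊆ range (γ i) := by
    rintro i z ⟨hz, hzΩ⟩
    rw [hfr] at hzΩ
    obtain ⟨j, t, rfl⟩ := mem_iUnion.1 hzΩ
    by_cases hj : j = i
    · exact hj ▸ ⟨t, rfl⟩
    · exact absurd hz (Set.disjoint_left.1 (hOd hj) (hγO j t))
  have hγΩ : ∀ i, range (γ i) ⊆ frontier Ω := fun i => hfr ▸ subset_iUnion (fun i => range (γ i)) i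
  choose γ' V Z hγ' hp' hr hc hVO hin using fun i => exists_inner_collar hΩo hΩ.isPreconnected
    (hγ i) (hp i) (hinj i) (hder i) (hOo i) (hγO i) (hOΩ i) (hγΩ i)
  choose χ hχ hχ1 hχ2 using fun i => exists_bump (isCompact_range_of_periodic (hγ' i).continuous (hp' i))
    (hc i).isOpen (range_subset_iff.2 (hc i).mem)
  exact ⟨N, γ', V, Z, χ, hΩo, hΩ, hb, hγ', hp', hc,
    fun i j hij => (hOd hij).mono (hVO i) (hVO j), by simp only [hfr, hr], hin, hχ,
    fun i t => hχ1 i _ ⟨t, rfl⟩⟩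

end Collars

section CollarFunctions

theorem Adm.mul {V S : Set ℂ} (hV : IsOpen V) {φ g : ℂ → ℂ} (h : Adm V S φ)
    (hg : ContDiffOn ℝ (⊤ : ℕ∞) g V) : Adm V S fun z => φ z * g z :=
  h.bilinear hV (ContinuousLinearMap.mul ℝ ℂ) hg

theorem Adm.add {V S : Set ℂ} {φ ψ : ℂ → ℂ} (h : Adm V S φ) (h' : Adm V S ψ) :
    Adm V S fun z => φ z + ψ z where
  contDiff := h.contDiff.add h'.contDiff
  compact := h.compact.add h'.compact
  subset := (tsupport_add φ ψ).trans (union_subset h.subset h'.subset)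
  flat z hz := (h.flat z hz).add h.contDiff.contDiffAt h'.contDiff.contDiffAt (h'.flat z hz)

theorem Adm.dbar {V S : Set ℂ} {φ : ℂ → ℂ} (h : Adm V S φ) : Adm V S (dbar φ) where
  contDiff := h.contDiff.dbar
  compact := h.compact.dbar
  subset := by
    rw [dbar_eq_comp]
    exact (tsupport_comp_subset (map_zero _) _).trans ((tsupport_fderiv_subset ℝ).trans h.subset)
  flat z hz := by
    rw [dbar_eq_comp]
    exact (h.fderiv.flat z hz).clm_comp dbarL h.fderiv.contDiff.contDiffAt

theorem contDiffOn_zpow {V : Set ℂ} {Z : ℂ → ℂ} (hZ : ContDiffOn ℝ (⊤ : ℕ∞) Z V)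
    (hZ0 : ∀ z ∈ V, Z z ≠ 0) (n : ℤ) : ContDiffOn ℝ (⊤ : ℕ∞) (fun z => Z z ^ n) V := by
  simpa using contDiffOn_tame_coeff hZ hZ0 (σ := fun _ => 0) contDiffOn_const
    (h := fun _ => 1) contDiff_const n

namespace Collars

variable {Ω : Set ℂ} {N : ℕ} {γ : Fin N → ℝ → ℂ} {V : Fin N → Set ℂ} {Z χ : Fin N → ℂ → ℂ}

theorem mem_frontier (h : Collars Ω γ V Z χ) (i : Fin N) (t : ℝ) : γ i t ∈ frontier Ω := by
  rw [h.frontier_eq]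
  exact mem_iUnion.2 ⟨i, t, rfl⟩

theorem eq_zero_of_notMem (h : Collars Ω γ V Z χ) {i : Fin N} {z : ℂ} (hz : z ∉ V i) : χ i z = 0 :=
  image_eq_zero_of_notMem_tsupport fun h' => hz ((h.adm i).subset h')

theorem notMem_of_ne (h : Collars Ω γ V Z χ) {i j : Fin N} (hij : j ≠ i) (t : ℝ) : γ j t ∉ V i :=
  Set.disjoint_left.1 (h.disjoint hij) ((h.collar j).mem t)

theorem flat_of (h : Collars Ω γ V Z χ) {i : Fin N} {f : ℂ → ℂ} (hf : tsupport f ⊆ V i)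
    (hi : ∀ t, FlatAt f (γ i t)) : ∀ z ∈ frontier Ω, FlatAt f z := by
  intro z hz
  rw [h.frontier_eq] at hz
  obtain ⟨j, t, rfl⟩ := mem_iUnion.1 hz
  by_cases hj : j = i
  · exact hj ▸ hi t
  · exact flatAt_of_notMem_tsupport fun h' => h.notMem_of_ne hj t (hf h')

theorem adm_mul_zpow (h : Collars Ω γ V Z χ) (i : Fin N) (n : ℤ) :
    Adm (V i) ∅ fun z => χ i z * Z i z ^ n :=
  (h.adm i).mul (h.collar i).isOpen (contDiffOn_zpow (h.collar i).smooth (h.collar i).ne_zero n)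

theorem adm_dbar_chi (h : Collars Ω γ V Z χ) (i : Fin N) : Adm (V i) (frontier Ω) (dbar (χ i)) where
  contDiff := (h.adm i).dbar.contDiff
  compact := (h.adm i).dbar.compact
  subset := (h.adm i).dbar.subset
  flat := h.flat_of (h.adm i).dbar.subset fun t => (flatAt_zero _).congr <| by
    filter_upwards [(h.eq_one i t).eventually_nhds] with z hz
    rw [dbar_congr (g := fun _ => 1) hz]
    exact dbar_eq_zero_of_differentiableAt (differentiableAt_const _)

theorem adm_inv_mul_dbar (h : Collars Ω γ V Z χ) (i : Fin N) :
    Adm (V i) (frontier Ω) fun z => χ i z * ((Z i z)⁻¹ * dbar (Z i) z) := by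
  have hc := h.collar i
  have hs : ContDiffOn ℝ (⊤ : ℕ∞) (fun z => (Z i z)⁻¹ * dbar (Z i) z) (V i) :=
    (hc.smooth.inv hc.ne_zero).mul (ContDiffOn.dbar hc.isOpen hc.smooth)
  have h1 := (h.adm i).mul hc.isOpen hs
  refine ⟨h1.contDiff, h1.compact, h1.subset, h.flat_of h1.subset fun t => ?_⟩
  refine (FlatAt.bilinear (ContinuousLinearMap.mul ℝ ℂ) hc.isOpen (hc.mem t)
    (ContDiffOn.dbar hc.isOpen hc.smooth)
    ((h.adm i).contDiff.contDiffOn.mul (hc.smooth.inv hc.ne_zero)) (hc.flat t)).congr ?_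
  filter_upwards with z
  simp only [ContinuousLinearMap.mul_apply', Pi.inv_apply]
  ring

theorem dbar_mul_zpow (h : Collars Ω γ V Z χ) (i : Fin N) (n : ℤ) (z : ℂ) :
    dbar (fun z => χ i z * Z i z ^ n) z =
      (dbar (χ i) z + χ i z * ((Z i z)⁻¹ * dbar (Z i) z) * n) * Z i z ^ n := by
  have hc := h.collar i
  by_cases hz : z ∈ V i
  · have h0 := hc.ne_zero z hz
    have hd : DifferentiableAt ℝ (Z i) z :=
      (hc.smooth.contDiffAt (hc.isOpen.mem_nhds hz)).differentiableAt (by simp)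
    have hp : DifferentiableAt ℝ (fun z => Z i z ^ n) z :=
      ((contDiffOn_zpow hc.smooth hc.ne_zero n).contDiffAt (hc.isOpen.mem_nhds hz)).differentiableAt
        (by simp)
    rw [dbar_mul ((h.adm i).contDiff.differentiable (by simp) z) hp,
      dbar_comp_holomorphic (f := fun w => w ^ n) (differentiableAt_zpow.2 (Or.inl h0)) hd, deriv_zpow,
      zpow_sub_one₀ h0]
    ring
  · have h1 : χ i =ᶠ[nhds z] 0 :=
      notMem_tsupport_iff_eventuallyEq.1 fun h' => hz ((h.adm i).subset h')
    have h2 : (fun z => χ i z * Z i z ^ n) =ᶠ[nhds z] fun _ => 0 := by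
      filter_upwards [h1] with y hy
      rw [hy, Pi.zero_apply, zero_mul]
    have h3 : dbar (χ i) z = 0 :=
      image_eq_zero_of_notMem_tsupport fun h' => hz ((h.adm i).dbar.subset h')
    rw [dbar_congr h2, h3, h1.eq_of_nhds,
      dbar_eq_zero_of_differentiableAt (differentiableAt_const _)]
    simp

theorem adm_dbar_mul_zpow (h : Collars Ω γ V Z χ) (i : Fin N) (n : ℤ) :
    Adm (V i) (frontier Ω) (dbar fun z => χ i z * Z i z ^ n) := by
  have hc := h.collar i
  have : (dbar fun z => χ i z * Z i z ^ n) = fun z =>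
      (dbar (χ i) z + χ i z * ((Z i z)⁻¹ * dbar (Z i) z) * n) * Z i z ^ n :=
    funext (h.dbar_mul_zpow i n)
  rw [this]
  exact ((h.adm_dbar_chi i).add ((h.adm_inv_mul_dbar i).mul hc.isOpen contDiffOn_const)).mul
    hc.isOpen (contDiffOn_zpow hc.smooth hc.ne_zero n)

theorem chi_mul_zpow_apply (h : Collars Ω γ V Z χ) (i j : Fin N) (n : ℤ) (t : ℝ) :
    χ i (γ j t) * Z i (γ j t) ^ n = if j = i then exp (n * t * I) else 0 := by
  split_ifs with hj
  · subst hj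
    rw [(h.eq_one j t).self_of_nhds, (h.collar j).apply, one_mul, ← exp_int_mul]
    ring_nf
  · rw [h.eq_zero_of_notMem (h.notMem_of_ne hj t), zero_mul]

theorem infDist_le (h : Collars Ω γ V Z χ) (i : Fin N) : ∃ B : ℝ, 0 ≤ B ∧ ∀ z ∈ V i ∩ Ω,
    infDist z (frontier Ω) ≤ B * -Real.log ‖Z i z‖ := by
  obtain ⟨B, hB0, hB⟩ := (h.collar i).dist
  refine ⟨B, hB0, fun z hz => ?_⟩
  rw [← abs_of_nonpos (Real.log_nonpos (norm_nonneg _) (h.inner i z hz).le)]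
  refine le_trans (infDist_le_infDist_of_subset ?_ (range_nonempty _)) (hB z hz.1)
  rintro _ ⟨t, rfl⟩
  exact h.mem_frontier i t

theorem contDiffOn_arg (h : Collars Ω γ V Z χ) (i : Fin N) :
    ContDiffOn ℝ (⊤ : ℕ∞) (fun z => Z i z / (‖Z i z‖ : ℂ)) (V i) :=
  contDiffOn_div_norm.comp (h.collar i).smooth fun z hz => (h.collar i).ne_zero z hz

theorem norm_arg (h : Collars Ω γ V Z χ) (i : Fin N) : ∀ z ∈ V i, ‖Z i z / (‖Z i z‖ : ℂ)‖ = 1 := by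
  intro z hz
  rw [norm_div, norm_real, norm_norm, div_self (norm_ne_zero_iff.2 ((h.collar i).ne_zero z hz))]

theorem contDiffOn_neg_log (h : Collars Ω γ V Z χ) (i : Fin N) :
    ContDiffOn ℝ (⊤ : ℕ∞) (fun z => -Real.log ‖Z i z‖) (V i) :=
  contDiffOn_neg_log_norm.comp (h.collar i).smooth fun z hz => (h.collar i).ne_zero z hz

theorem tame_eq (h : Collars Ω γ V Z χ) (i : Fin N) {n : ℤ} (hn : 0 ≤ n) {φ : ℂ → ℂ}
    (hφ : tsupport φ ⊆ V i) {z : ℂ} (hz : z ∈ Ω ∨ ∃ j t, γ j t = z) :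
    tame (fun z => Z i z / (‖Z i z‖ : ℂ)) (fun z => -Real.log ‖Z i z‖) profile n φ z =
      Z i z ^ n * φ z := by
  by_cases hzV : z ∈ V i
  · have hZ : ‖Z i z‖ ≤ 1 := by
      rcases hz with hz | ⟨j, t, rfl⟩
      · exact (h.inner i z ⟨hzV, hz⟩).le
      · obtain rfl : i = j := by
          by_contra hj
          exact h.notMem_of_ne (Ne.symm hj) t hzV
        rw [(h.collar i).apply, norm_exp_ofReal_mul_I]
    refine tame_profile_eq (X := fun z => Z i z / (‖Z i z‖ : ℂ))
      (σ := fun z => -Real.log ‖Z i z‖) (w := z) (Z := Z i z) ((h.collar i).ne_zero z hzV) rfl rfl ?_ φ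
    have h1 := Real.log_nonpos (norm_nonneg _) hZ
    have : (0 : ℝ) ≤ n * -Real.log ‖Z i z‖ :=
      mul_nonneg (by exact_mod_cast hn) (by linarith)
    linarith
  · have : φ z = 0 := image_eq_zero_of_notMem_tsupport fun h' => hzV (hφ h')
    rw [tame_eq_zero this, this, mul_zero]

end Collars

end CollarFunctions

section Modes

namespace Collars

variable {Ω : Set ℂ} {N : ℕ} {γ : Fin N → ℝ → ℂ} {V : Fin N → Set ℂ} {Z χ : Fin N → ℂ → ℂ}

theorem exists_norm_iteratedFDeriv_error_le (h : Collars Ω γ V Z χ) (i : Fin N) (k l : ℕ) :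
    ∃ C : ℝ, 0 ≤ C ∧ ∀ n : ℤ, 0 ≤ n → ∀ z,
      ‖iteratedFDeriv ℝ k (cauchyT (Ω.indicator (dbar fun z => χ i z * Z i z ^ n))) z‖ ≤
        C * ((1 + |(n : ℝ)|) ^ l)⁻¹ := by
  have hc := h.collar i
  obtain ⟨B, hB0, hB⟩ := h.infDist_le i
  have hne : (frontier Ω).Nonempty := ⟨γ i 0, h.mem_frontier i 0⟩
  have hσ0 : ∀ z ∈ V i ∩ Ω, 0 ≤ -Real.log ‖Z i z‖ := fun z hz => by
    have := Real.log_nonpos (norm_nonneg _) (h.inner i z hz).le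
    linarith
  obtain ⟨C1, hC1, h1⟩ := exists_norm_iteratedFDeriv_tame_profile_le_of_flat hc.isOpen
    (h.contDiffOn_arg i) (h.norm_arg i) (h.contDiffOn_neg_log i) isClosed_frontier hne hσ0 hB0 hB
    (h.adm_dbar_chi i) k l
  obtain ⟨C2, hC2, h2⟩ := exists_norm_iteratedFDeriv_tame_profile_le_of_flat hc.isOpen
    (h.contDiffOn_arg i) (h.norm_arg i) (h.contDiffOn_neg_log i) isClosed_frontier hne hσ0 hB0 hB
    (h.adm_inv_mul_dbar i) k (l + 1)
  have hX0 : ∀ z ∈ V i, Z i z / (‖Z i z‖ : ℂ) ≠ 0 := fun z hz h0 => by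
    simpa [h0] using h.norm_arg i z hz
  obtain ⟨R, hR⟩ := h.bounded.subset_closedBall 0
  obtain ⟨C3, hC3, h3⟩ := norm_iteratedFDeriv_cauchyT_le R
  refine ⟨C3 * (C1 + C2), by positivity, fun n hn z => ?_⟩
  have hΦ := h.adm_dbar_mul_zpow i n
  rw [mul_assoc]
  refine h3 k _ _ (contDiff_indicator_of_flat hΦ.contDiff hΦ.flat) ?_ (fun z => ?_) z
  · exact closure_minimal ((support_indicator_subset).trans hR) isClosed_closedBall
  have hpos : 0 ≤ (C1 + C2) * ((1 + |(n : ℝ)|) ^ l)⁻¹ := by positivity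
  rw [norm_iteratedFDeriv_indicator_of_flat k hΦ.contDiff hΦ.flat]
  by_cases hz : z ∈ Ω
  swap
  · rwa [indicator_of_notMem hz]
  rw [indicator_of_mem hz]
  set T1 := tame (fun z => Z i z / (‖Z i z‖ : ℂ)) (fun z => -Real.log ‖Z i z‖) profile n
    (dbar (χ i)) with hT1
  set T2 := tame (fun z => Z i z / (‖Z i z‖ : ℂ)) (fun z => -Real.log ‖Z i z‖) profile n
    (fun z => χ i z * ((Z i z)⁻¹ * dbar (Z i) z)) with hT2
  have hs0 : ContDiff ℝ (⊤ : ℕ∞) profile := contDiff_iterate_deriv_profile 0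
  have hs1 : ContDiff ℝ (⊤ : ℕ∞) T1 := ((h.adm_dbar_chi i).tame hc.isOpen (h.contDiffOn_arg i) hX0
    (h.contDiffOn_neg_log i) hs0 n).contDiff
  have hs2 : ContDiff ℝ (⊤ : ℕ∞) T2 := ((h.adm_inv_mul_dbar i).tame hc.isOpen (h.contDiffOn_arg i)
    hX0 (h.contDiffOn_neg_log i) hs0 n).contDiff
  have heq : (dbar fun z => χ i z * Z i z ^ n) =ᶠ[nhds z] T1 + (n : ℂ) • T2 := by
    filter_upwards [h.isOpen.mem_nhds hz] with y hy
    rw [h.dbar_mul_zpow, Pi.add_apply, Pi.smul_apply, hT1, hT2,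
      h.tame_eq i hn (h.adm_dbar_chi i).subset (Or.inl hy),
      h.tame_eq i hn (h.adm_inv_mul_dbar i).subset (Or.inl hy), smul_eq_mul]
    ring
  rw [(heq.iteratedFDeriv ℝ k).eq_of_nhds]
  have hk : (k : WithTop ℕ∞) ≤ ((⊤ : ℕ∞) : WithTop ℕ∞) := by exact_mod_cast le_top
  have hs2' : ContDiff ℝ (⊤ : ℕ∞) ((n : ℂ) • T2) := contDiff_const.smul hs2
  rw [iteratedFDeriv_add_apply (hs1.contDiffAt.of_le hk) (hs2'.contDiffAt.of_le hk),
    iteratedFDeriv_const_smul_apply (hs2.contDiffAt.of_le hk)]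
  refine (norm_add_le _ _).trans ?_
  rw [norm_smul, norm_intCast]
  have hn1 : 0 < 1 + |(n : ℝ)| := by positivity
  calc _ ≤ C1 * ((1 + |(n : ℝ)|) ^ l)⁻¹ + (1 + |(n : ℝ)|) * (C2 * ((1 + |(n : ℝ)|) ^ (l + 1))⁻¹) := by
        gcongr
        · exact h1 n hn z hz
        · linarith
        · exact h2 n hn z hz
    _ = (C1 + C2) * ((1 + |(n : ℝ)|) ^ l)⁻¹ := by
        rw [pow_succ]
        field_simp

/-- Holomorphic functions on the domain whose boundary values are close to the nonnegative Fourier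
modes of one boundary curve. -/
theorem exists_modes (h : Collars Ω γ V Z χ) (i : Fin N) : ∃ A : ℤ → ℂ → ℂ,
    (∀ n, 0 ≤ n → ContDiff ℝ (⊤ : ℕ∞) (A n)) ∧ (∀ n, 0 ≤ n → DifferentiableOn ℂ (A n) Ω) ∧
    (∀ k, ∃ C : ℝ, 0 ≤ C ∧ ∀ n, 0 ≤ n → ∀ z,
      ‖iteratedFDeriv ℝ k (A n) z‖ ≤ C * (1 + |(n : ℝ)|) ^ k) ∧
    ∀ l, ∃ C : ℝ, 0 ≤ C ∧ ∀ n, 0 ≤ n → ∀ j n',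
      ‖fc (fun t => A n (γ j t)) n' - (if j = i ∧ n' = n then 1 else 0)‖ ≤
        C * ((1 + |(n : ℝ)|) ^ l)⁻¹ * ((1 + |(n' : ℝ)|) ^ l)⁻¹ := by
  have hc := h.collar i
  have hX0 : ∀ z ∈ V i, Z i z / (‖Z i z‖ : ℂ) ≠ 0 := fun z hz h0 => by
    simpa [h0] using h.norm_arg i z hz
  have hs0 : ContDiff ℝ (⊤ : ℕ∞) profile := contDiff_iterate_deriv_profile 0
  set E : ℤ → ℂ → ℂ := fun n => tame (fun z => Z i z / (‖Z i z‖ : ℂ))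
    (fun z => -Real.log ‖Z i z‖) profile n (χ i) with hE
  set κ : ℤ → ℂ → ℂ := fun n => cauchyT (Ω.indicator (dbar fun z => χ i z * Z i z ^ n)) with hκ
  have hEa : ∀ n, Adm (V i) ∅ (E n) := fun n =>
    (h.adm i).tame hc.isOpen (h.contDiffOn_arg i) hX0 (h.contDiffOn_neg_log i) hs0 n
  have hΦ := h.adm_dbar_mul_zpow i
  have hΦs : ∀ n : ℤ, ContDiff ℝ (⊤ : ℕ∞) (Ω.indicator (dbar fun z => χ i z * Z i z ^ n)) := fun n =>
    contDiff_indicator_of_flat (hΦ n).contDiff (hΦ n).flat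
  have hΦc : ∀ n : ℤ, HasCompactSupport (Ω.indicator (dbar fun z => χ i z * Z i z ^ n)) := fun n =>
    (hΦ n).compact.mono (support_indicator.trans_subset inter_subset_right)
  have hκs : ∀ n, ContDiff ℝ (⊤ : ℕ∞) (κ n) := fun n => contDiff_cauchyT (hΦs n) (hΦc n)
  refine ⟨fun n z => E n z - κ n z, fun n hn => (hEa n).contDiff.sub (hκs n), fun n hn z hz => ?_,
    fun k => ?_, fun l => ?_⟩
  · have hEd := (hEa n).contDiff.differentiable (by simp) z
    have hκd := (hκs n).differentiable (by simp) z
    refine (differentiableAt_of_dbar_eq_zero (hEd.sub hκd) ?_).differentiableWithinAt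
    have h1 : E n =ᶠ[nhds z] fun z => χ i z * Z i z ^ n := by
      filter_upwards [h.isOpen.mem_nhds hz] with y hy
      rw [hE]
      simp only [h.tame_eq i hn (h.adm i).subset (Or.inl hy), mul_comm]
    refine (dbar_sub hEd hκd).trans ?_
    rw [dbar_congr h1, hκ]
    simp only
    rw [dbar_cauchyT ((hΦs n).of_le (by simp)) (hΦc n), indicator_of_mem hz, sub_self]
  · obtain ⟨C1, hC1, h1⟩ := exists_norm_iteratedFDeriv_tame_profile_le hc.isOpen
      (h.contDiffOn_arg i) (h.norm_arg i) (h.contDiffOn_neg_log i) (h.adm i) k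
    obtain ⟨C2, hC2, h2⟩ := h.exists_norm_iteratedFDeriv_error_le i k 0
    refine ⟨C1 + C2, by positivity, fun n hn z => ?_⟩
    have hk : (k : WithTop ℕ∞) ≤ ((⊤ : ℕ∞) : WithTop ℕ∞) := by exact_mod_cast le_top
    have : iteratedFDeriv ℝ k (fun z => E n z - κ n z) z =
        iteratedFDeriv ℝ k (E n) z - iteratedFDeriv ℝ k (κ n) z :=
      iteratedFDeriv_sub_apply ((hEa n).contDiff.contDiffAt.of_le hk) ((hκs n).contDiffAt.of_le hk)
    rw [this, add_mul]
    refine (norm_sub_le _ _).trans (add_le_add (h1 n z) ((h2 n hn z).trans ?_))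
    rw [pow_zero, inv_one]
    gcongr
    exact one_le_pow₀ (by linarith [abs_nonneg (n : ℝ)])
  · choose C1 hC1 h1 using fun k => h.exists_norm_iteratedFDeriv_error_le i k l
    choose C2 hC2 h2 using fun j => exists_norm_fc_comp_le (h.smooth j) (h.periodic j) l
    have hC1s : 0 ≤ ∑ k ∈ Finset.range (l + 1), C1 k := Finset.sum_nonneg fun k _ => hC1 k
    refine ⟨(∑ j, C2 j) * ∑ k ∈ Finset.range (l + 1), C1 k,
      mul_nonneg (Finset.sum_nonneg fun j _ => hC2 j) hC1s, fun n hn j n' => ?_⟩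
    have e1 : fc (fun t => E n (γ j t)) n' = if j = i ∧ n' = n then 1 else 0 := by
      have : ∀ t, E n (γ j t) = if j = i then exp (n * t * I) else 0 := fun t => by
        rw [hE]
        simp only [h.tame_eq i hn (h.adm i).subset (Or.inr ⟨j, t, rfl⟩)]
        rw [mul_comm, h.chi_mul_zpow_apply]
      rw [fc_congr this]
      by_cases hj : j = i
      · simp [hj, fc_exp]
      · simp [hj, fc]
    have e2 : Continuous fun t => E n (γ j t) := (hEa n).contDiff.continuous.comp (h.smooth j).continuous
    have e3 : Continuous fun t => κ n (γ j t) := (hκs n).continuous.comp (h.smooth j).continuous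
    simp only
    rw [fc_sub e2 e3, e1, sub_sub_cancel_left, norm_neg]
    refine (h2 j (κ n) ((∑ k ∈ Finset.range (l + 1), C1 k) * ((1 + |(n : ℝ)|) ^ l)⁻¹) (hκs n)
      (fun k hk z => (h1 k n hn z).trans ?_) n').trans ?_
    · gcongr
      exact Finset.single_le_sum (f := C1) (fun k _ => hC1 k) (Finset.mem_range.2 (by omega))
    · rw [mul_assoc (∑ j, C2 j)]
      gcongr
      exact Finset.single_le_sum (f := C2) (fun j _ => hC2 j) (Finset.mem_univ j)

end Collars

end Modes

theorem exists_clm_eq_zero_of_notMem_closure {Y : Type*} [NormedAddCommGroup Y] [NormedSpace ℂ Y]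
    (S : Submodule ℂ Y) {y : Y} (hy : y ∉ closure (S : Set Y)) :
    ∃ f : Y →L[ℂ] ℂ, f y ≠ 0 ∧ ∀ s ∈ S, f s = 0 := by
  let : NormedSpace ℝ Y := NormedSpace.restrictScalars ℝ ℂ Y
  have hconv : Convex ℝ (closure (S : Set Y)) :=
    Convex.closure (S.restrictScalars ℝ).convex
  obtain ⟨f, u, hu, hf⟩ := RCLike.geometric_hahn_banach_point_closed (𝕜 := ℂ) hconv
    isClosed_closure hy
  have hu0 : u < 0 := by simpa using hf 0 (subset_closure S.zero_mem)
  refine ⟨f, fun h => ?_, fun s hs => ?_⟩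
  · rw [h] at hu
    simp only [map_zero] at hu
    linarith
  · by_contra h0
    have := hf ((((u - 1 : ℝ) : ℂ) * (f s)⁻¹) • s) (subset_closure (S.smul_mem _ hs))
    rw [map_smul, smul_eq_mul, mul_assoc, inv_mul_cancel₀ h0, mul_one] at this
    simp only [RCLike.re_to_complex, ofReal_re] at this
    linarith

theorem differentiableOn_fc_cauchy {γ : ℝ → ℂ} (hγ : Continuous γ)
    (hp : Function.Periodic γ (2 * Real.pi)) (n : ℤ) :
    DifferentiableOn ℂ (fun ζ => fc (fun t => (γ t - ζ)⁻¹) n) (range γ)ᶜ := by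
  intro ζ hζ
  refine DifferentiableAt.differentiableWithinAt ?_
  have hpos := infDist_range_pos hγ hp hζ
  set d := infDist ζ (range γ) with hd
  have hfar : ∀ x ∈ ball ζ (d / 2), ∀ t, d / 2 ≤ ‖γ t - x‖ := by
    intro x hx t
    have h1 : d ≤ dist ζ (γ t) := infDist_le_dist_of_mem ⟨t, rfl⟩
    have h2 := dist_triangle ζ x (γ t)
    rw [mem_ball, dist_comm] at hx
    rw [← dist_eq_norm, dist_comm]
    linarith
  have hne : ∀ x ∈ ball ζ (d / 2), ∀ t, γ t - x ≠ 0 := fun x hx t => by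
    rw [← norm_pos_iff]
    linarith [hfar x hx t]
  have hmem : ζ ∈ ball ζ (d / 2) := mem_ball_self (by positivity)
  have hcont : ∀ x ∈ ball ζ (d / 2), Continuous fun t => (γ t - x)⁻¹ * exp (-(n * t * I)) :=
    fun x hx => ((hγ.sub continuous_const).inv₀ (hne x hx)).mul (continuous_exp_neg_int_mul_I n)
  have := intervalIntegral.hasDerivAt_integral_of_dominated_loc_of_deriv_le (𝕜 := ℂ) (μ := volume)
    (a := 0) (b := 2 * Real.pi) (F := fun x t => (γ t - x)⁻¹ * exp (-(n * t * I)))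
    (F' := fun x t => ((γ t - x)⁻¹) ^ 2 * exp (-(n * t * I))) (x₀ := ζ)
    (bound := fun _ => ((d / 2)⁻¹) ^ 2) (s := ball ζ (d / 2)) (ball_mem_nhds _ (by positivity))
    ?_ ?_ ?_ ?_ ?_ ?_
  · exact (this.2.const_mul _).differentiableAt
  · filter_upwards [ball_mem_nhds ζ (show 0 < d / 2 by positivity)] with x hx
    exact (hcont x hx).aestronglyMeasurable
  · exact (hcont ζ hmem).intervalIntegrable _ _
  · exact ((((hγ.sub continuous_const).inv₀ (hne ζ hmem)).pow 2).mul
      (continuous_exp_neg_int_mul_I n)).aestronglyMeasurable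
  · refine Filter.Eventually.of_forall fun t _ x hx => ?_
    rw [norm_mul, norm_exp_neg_int_mul_I, mul_one, norm_pow, norm_inv]
    gcongr
    exact hfar x hx t
  · exact intervalIntegrable_const
  · refine Filter.Eventually.of_forall fun t _ x hx => ?_
    have h1 : HasDerivAt (fun x => γ t - x) (-1) x := by
      simpa using (hasDerivAt_id x).const_sub (γ t)
    have h2 := (h1.inv (hne x hx t)).mul_const (exp (-(n * t * I)))
    rwa [neg_neg, one_div, ← inv_pow] at h2

/-- Functions which agree on the boundary of `Ω` with a function smooth on `ℂ` and holomorphic on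
`Ω`, up to finitely many simple poles in `D`. -/
def bmero (Ω D : Set ℂ) : Submodule ℂ (ℂ → ℂ) where
  carrier := {v | ∃ (h : ℂ → ℂ) (c : ℂ →₀ ℂ), ContDiff ℝ (⊤ : ℕ∞) h ∧ DifferentiableOn ℂ h Ω ∧
    (c.support : Set ℂ) ⊆ D ∧ ∀ z ∈ frontier Ω, v z = h z + c.sum fun ζ a => a * (z - ζ)⁻¹}
  zero_mem' := ⟨0, 0, contDiff_const, differentiableOn_const _, by simp, by simp⟩
  add_mem' := by
    rintro v w ⟨h, c, h1, h2, h3, h4⟩ ⟨h', c', h1', h2', h3', h4'⟩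
    refine ⟨h + h', c + c', h1.add h1', h2.add h2', fun ζ hζ => ?_, fun z hz => ?_⟩
    · rcases Finset.mem_union.1 (Finsupp.support_add hζ) with h5 | h5
      · exact h3 h5
      · exact h3' h5
    · rw [Pi.add_apply, h4 z hz, h4' z hz, Finsupp.sum_add_index' (by simp)
        (fun _ _ _ => by ring), Pi.add_apply]
      ring
  smul_mem' := by
    rintro a v ⟨h, c, h1, h2, h3, h4⟩
    refine ⟨a • h, a • c, contDiff_const.smul h1, h2.const_smul a, fun ζ hζ => h3
      (Finsupp.support_smul hζ), fun z hz => ?_⟩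
    rw [Pi.smul_apply, h4 z hz, Finsupp.sum_smul_index (by simp), Pi.smul_apply, smul_eq_mul,
      smul_eq_mul, mul_add, Finsupp.sum, Finsupp.sum, Finset.mul_sum]
    simp only [mul_assoc]

theorem mem_bmero_of_contDiff {Ω D : Set ℂ} {h : ℂ → ℂ} (h1 : ContDiff ℝ (⊤ : ℕ∞) h)
    (h2 : DifferentiableOn ℂ h Ω) : h ∈ bmero Ω D :=
  ⟨h, 0, h1, h2, by simp, by simp⟩

theorem inv_sub_mem_bmero {Ω D : Set ℂ} {ζ : ℂ} (hζ : ζ ∈ D) : (fun z => (z - ζ)⁻¹) ∈ bmero Ω D := by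
  classical
  refine ⟨0, Finsupp.single ζ 1, contDiff_const, differentiableOn_const _, ?_, fun z _ => ?_⟩
  · intro x hx
    have := Finsupp.support_single_subset hx
    simp only [Finset.mem_singleton] at this
    rwa [this]
  · rw [Finsupp.sum_single_index (by simp)]
    simp

/-- Weighted Fourier coefficients along a family of closed curves. -/
def coeffs {N : ℕ} (γ : Fin N → ℝ → ℂ) (M : ℕ) (v : ℂ → ℂ) (j : Fin N × ℤ) : ℂ :=
  (((1 + |(j.2 : ℝ)|) ^ M : ℝ) : ℂ) * fc (fun t => v (γ j.1 t)) j.2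

theorem summable_prod_inv (N : ℕ) :
    Summable fun j : Fin N × ℤ => ((1 + |(j.2 : ℝ)|) ^ 2)⁻¹ := by
  rw [summable_prod_of_nonneg (fun _ => by positivity)]
  exact ⟨fun _ => summable_inv_one_add_abs_sq, Summable.of_finite⟩

theorem weight_mul_inv_le (M : ℕ) (n : ℤ) :
    (1 + |(n : ℝ)|) ^ M * ((1 + |(n : ℝ)|) ^ (M + 2))⁻¹ = ((1 + |(n : ℝ)|) ^ 2)⁻¹ := by
  have : (1 + |(n : ℝ)|) ≠ 0 := by positivity
  field_simp
  ring

theorem norm_weight (M : ℕ) (n : ℤ) :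
    ‖(((1 + |(n : ℝ)|) ^ M : ℝ) : ℂ)‖ = (1 + |(n : ℝ)|) ^ M := by
  rw [norm_real, Real.norm_of_nonneg (by positivity)]

theorem weight_ne_zero (M : ℕ) (n : ℤ) : (((1 + |(n : ℝ)|) ^ M : ℝ) : ℂ) ≠ 0 := by
  rw [← norm_pos_iff, norm_weight]
  positivity

theorem norm_coeffs {N : ℕ} (γ : Fin N → ℝ → ℂ) (M : ℕ) (v : ℂ → ℂ) (j : Fin N × ℤ) :
    ‖coeffs γ M v j‖ = (1 + |(j.2 : ℝ)|) ^ M * ‖fc (fun t => v (γ j.1 t)) j.2‖ := by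
  rw [coeffs, norm_mul, norm_weight]

theorem summable_norm_of_fc_le {N : ℕ} {γ : Fin N → ℝ → ℂ} {M : ℕ} {v : ℂ → ℂ} {C : ℝ}
    (h : ∀ i n, ‖fc (fun t => v (γ i t)) n‖ ≤ C * ((1 + |(n : ℝ)|) ^ (M + 2))⁻¹) :
    Summable fun j => ‖coeffs γ M v j‖ := by
  refine Summable.of_nonneg_of_le (fun _ => norm_nonneg _) (fun j => ?_)
    ((summable_prod_inv N).mul_left C)
  rw [norm_coeffs, ← weight_mul_inv_le M]
  calc _ ≤ (1 + |(j.2 : ℝ)|) ^ M * (C * ((1 + |(j.2 : ℝ)|) ^ (M + 2))⁻¹) := by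
        gcongr
        exact h _ _
    _ = _ := by ring

theorem exists_fc_le_of_smooth {N : ℕ} {γ : Fin N → ℝ → ℂ} {v : ℂ → ℂ}
    (hγ : ∀ i, Function.Periodic (γ i) (2 * Real.pi))
    (hv : ∀ i, ContDiff ℝ (⊤ : ℕ∞) fun t => v (γ i t)) (L : ℕ) :
    ∃ C : ℝ, 0 ≤ C ∧ ∀ i n, ‖fc (fun t => v (γ i t)) n‖ ≤ C * ((1 + |(n : ℝ)|) ^ L)⁻¹ := by
  have hp : ∀ i, Function.Periodic (fun t => v (γ i t)) (2 * Real.pi) := fun i t => by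
    simp only [hγ i t]
  choose C hC0 hC using fun i => exists_norm_fc_le (hv i) (hp i) L
  refine ⟨∑ i, C i, Finset.sum_nonneg fun i _ => hC0 i, fun i n => (hC i n).trans ?_⟩
  gcongr
  exact Finset.single_le_sum (fun i _ => hC0 i) (Finset.mem_univ i)

theorem summable_norm_coeffs {N : ℕ} {γ : Fin N → ℝ → ℂ} {v : ℂ → ℂ}
    (hγ : ∀ i, Function.Periodic (γ i) (2 * Real.pi))
    (hv : ∀ i, ContDiff ℝ (⊤ : ℕ∞) fun t => v (γ i t)) (M : ℕ) :
    Summable fun j => ‖coeffs γ M v j‖ := by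
  obtain ⟨C, -, hC⟩ := exists_fc_le_of_smooth hγ hv (M + 2)
  exact summable_norm_of_fc_le hC

namespace Collars

variable {Ω : Set ℂ} {N : ℕ} {γ : Fin N → ℝ → ℂ} {V : Fin N → Set ℂ} {Z χ : Fin N → ℂ → ℂ}

theorem notMem (h : Collars Ω γ V Z χ) (i : Fin N) (t : ℝ) : γ i t ∉ Ω := fun hm => by
  have := h.mem_frontier i t
  rw [h.isOpen.frontier_eq] at this
  exact this.2 hm

theorem smooth_of_mem_bmero (h : Collars Ω γ V Z χ) {D : Set ℂ} (hD : D ⊆ Ω) {v : ℂ → ℂ}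
    (hv : v ∈ bmero Ω D) (i : Fin N) : ContDiff ℝ (⊤ : ℕ∞) fun t => v (γ i t) := by
  obtain ⟨u, c, h1, -, h3, h4⟩ := hv
  simp only [fun t => h4 _ (h.mem_frontier i t)]
  refine (h1.comp (h.smooth i)).add (ContDiff.sum fun ζ hζ => ?_)
  refine contDiff_const.mul (((h.smooth i).sub contDiff_const).inv fun t ht => ?_)
  exact h.notMem i t (by rw [sub_eq_zero.1 ht]; exact hD (h3 hζ))

theorem exists_norm_fc_resolvent_le (h : Collars Ω γ V Z χ) (L : ℕ) : ∃ C : ℝ, 0 ≤ C ∧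
    ∀ ζ ∈ Ω, ∀ j n, ‖fc (fun t => (γ j t - ζ)⁻¹) n‖ ≤
      C * (infDist ζ (frontier Ω))⁻¹ ^ (1 + L) * ((1 + |(n : ℝ)|) ^ L)⁻¹ := by
  have hR : ∀ j, ∃ R : ℝ, 0 ≤ R ∧ ∀ ζ ∈ Ω, infDist ζ (range (γ j)) ≤ R := by
    intro j
    obtain ⟨R, hR⟩ := h.bounded.subset_closedBall (γ j 0)
    refine ⟨max R 0, le_max_right _ _, fun ζ hζ => ?_⟩
    exact (infDist_le_dist_of_mem (mem_range_self 0)).trans ((mem_closedBall.1 (hR hζ)).trans (le_max_left _ _))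
  choose R hR0 hR using hR
  choose C hC0 hC using fun j => exists_norm_fc_cauchy_le (h.smooth j) (h.periodic j) (hR0 j) L
  refine ⟨∑ j, C j, Finset.sum_nonneg fun i _ => hC0 i, fun ζ hζ j n => ?_⟩
  have hζj : ζ ∉ range (γ j) := by
    rintro ⟨t, rfl⟩
    exact h.notMem j t hζ
  have hne : (frontier Ω).Nonempty := ⟨_, h.mem_frontier j 0⟩
  have hpos : 0 < infDist ζ (frontier Ω) := by
    rw [← isClosed_frontier.notMem_iff_infDist_pos hne, h.isOpen.frontier_eq]
    exact fun hm => hm.2 hζ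
  have hle : infDist ζ (frontier Ω) ≤ infDist ζ (range (γ j)) :=
    infDist_le_infDist_of_subset (range_subset_iff.2 fun t => h.mem_frontier j t) ⟨_, 0, rfl⟩
  refine (hC j ζ hζj (hR j ζ hζ) n).trans ?_
  have hC1 : 0 ≤ ∑ j, C j := Finset.sum_nonneg fun i _ => hC0 i
  have hd : 0 ≤ (infDist ζ (range (γ j)))⁻¹ := inv_nonneg.2 infDist_nonneg
  gcongr
  · exact Finset.single_le_sum (fun i _ => hC0 i) (Finset.mem_univ j)

theorem infDist_frontier_pos (h : Collars Ω γ V Z χ) (i : Fin N) {ζ : ℂ} (hζ : ζ ∈ Ω) :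
    0 < infDist ζ (frontier Ω) := by
  rw [← isClosed_frontier.notMem_iff_infDist_pos ⟨_, h.mem_frontier i 0⟩, h.isOpen.frontier_eq]
  exact fun hm => hm.2 hζ

theorem exists_norm_le_infDist_pow (h : Collars Ω γ V Z χ) (i : Fin N) {Φ : ℂ → ℂ} {U : Set ℂ}
    (hΦ : Adm U (frontier Ω) Φ) (L : ℕ) :
    ∃ C : ℝ, 0 ≤ C ∧ ∀ z, ‖Φ z‖ ≤ C * infDist z (frontier Ω) ^ L := by
  obtain ⟨C, hC⟩ := (hΦ.compact.iteratedFDeriv (𝕜 := ℝ) (n := L)).exists_bound_of_continuous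
    (hΦ.contDiff.continuous_iteratedFDeriv (by exact_mod_cast le_top))
  exact ⟨C, (norm_nonneg _).trans (hC 0), norm_le_infDist_pow_of_flat L isClosed_frontier
    ⟨_, h.mem_frontier i 0⟩ hΦ.contDiff hΦ.flat hC⟩

theorem fc_cauchyT_indicator (h : Collars Ω γ V Z χ) {Φ : ℂ → ℂ} {U : Set ℂ}
    (hΦ : Adm U (frontier Ω) Φ) (j : Fin N) (n : ℤ) :
    fc (fun t => cauchyT (Ω.indicator Φ) (γ j t)) n =
      (1 / (Real.pi : ℂ)) * ∫ ζ in Ω, Φ ζ * fc (fun t => (γ j t - ζ)⁻¹) n := by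
  obtain ⟨C, hC0, hC⟩ := h.exists_norm_le_infDist_pow j hΦ 1
  have hfin : volume Ω < ⊤ := h.bounded.measure_lt_top
  have : IsFiniteMeasure (volume.restrict Ω) := ⟨by simpa using hfin⟩
  have : IsFiniteMeasure (volume.restrict (uIoc 0 (2 * Real.pi))) := ⟨by
    rw [Measure.restrict_apply_univ, uIoc]
    exact measure_Ioc_lt_top⟩
  have hinteg : Integrable (Function.uncurry fun (t : ℝ) (ζ : ℂ) =>
      (γ j t - ζ)⁻¹ * Φ ζ * exp (-(n * t * I)))
      ((volume.restrict (uIoc 0 (2 * Real.pi))).prod (volume.restrict Ω)) := by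
    refine Integrable.of_bound (C := C) ?_ ?_
    · refine Measurable.aestronglyMeasurable ?_
      refine Measurable.mul (Measurable.mul (Measurable.inv ?_) ?_) ?_
      · exact (((h.smooth j).continuous.comp continuous_fst).sub continuous_snd).measurable
      · exact (hΦ.contDiff.continuous.comp continuous_snd).measurable
      · exact ((continuous_exp_neg_int_mul_I n).comp continuous_fst).measurable
    · rw [Measure.prod_restrict]
      refine (ae_restrict_iff' (measurableSet_uIoc.prod h.isOpen.measurableSet)).2
        (Filter.Eventually.of_forall fun p hp => ?_)
      have hd := h.infDist_frontier_pos j hp.2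
      rw [Function.uncurry, norm_mul, norm_exp_neg_int_mul_I, mul_one, norm_mul, norm_inv]
      have h1 : infDist p.2 (frontier Ω) ≤ ‖γ j p.1 - p.2‖ := by
        rw [← dist_eq_norm, dist_comm]
        exact infDist_le_dist_of_mem (h.mem_frontier j _)
      calc _ ≤ (infDist p.2 (frontier Ω))⁻¹ * (C * infDist p.2 (frontier Ω) ^ 1) := by
            gcongr
            exact hC _
        _ = C := by field_simp
  have key := intervalIntegral_integral_swap hinteg
  have h1 : ∀ t : ℝ, cauchyT (Ω.indicator Φ) (γ j t) * exp (-(n * t * I)) =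
      (1 / (Real.pi : ℂ)) * ∫ ζ in Ω, (γ j t - ζ)⁻¹ * Φ ζ * exp (-(n * t * I)) := by
    intro t
    rw [cauchyT_eq, integral_mul_const, ← integral_indicator h.isOpen.measurableSet, smul_eq_mul,
      mul_assoc]
    congr 3 with ζ
    by_cases hζ : ζ ∈ Ω <;> simp [hζ]
  rw [fc]
  simp only [h1]
  rw [intervalIntegral.integral_const_mul, key, mul_left_comm, ← integral_const_mul (1 / (2 * _))]
  congr 2 with ζ
  rw [fc, mul_left_comm, ← intervalIntegral.integral_const_mul (Φ ζ)]
  congr 2 with t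
  ring

end Collars

/-- The space of weighted coefficient sequences. -/
abbrev CoeffSpace (N : ℕ) := lp (fun _ : Fin N × ℤ => ℂ) 1

theorem memℓp_one_of_summable {N : ℕ} {c : Fin N × ℤ → ℂ} (hc : Summable fun j => ‖c j‖) :
    Memℓp c 1 :=
  memℓp_gen (by simpa using hc)

theorem norm_coeffSpace {N : ℕ} (y : CoeffSpace N) : ‖y‖ = ∑' j, ‖y j‖ := by
  rw [lp.norm_eq_tsum_rpow (by simp)]
  simp

theorem summable_norm_coeffSpace {N : ℕ} (y : CoeffSpace N) : Summable fun j => ‖y j‖ := by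
  have := (lp.memℓp y).summable (by simp)
  simpa using this

theorem hasSum_clm_coeffSpace {N : ℕ} (f : CoeffSpace N →L[ℂ] ℂ) (y : CoeffSpace N) :
    HasSum (fun j => y j * f (lp.single 1 j 1)) (f y) := by
  have := (lp.hasSum_single (p := 1) (by simp) y).map f f.continuous
  convert this using 2 with j
  have h1 : (lp.single 1 j (y j) : CoeffSpace N) = y j • lp.single 1 j (1 : ℂ) := by
    rw [← lp.single_smul]
    simp
  rw [Function.comp, h1, map_smul, smul_eq_mul]

theorem norm_clm_single_le {N : ℕ} (f : CoeffSpace N →L[ℂ] ℂ) (j : Fin N × ℤ) :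
    ‖f (lp.single 1 j 1)‖ ≤ ‖f‖ := by
  have := f.le_opNorm (lp.single 1 j 1)
  rwa [lp.norm_single (by simp), norm_one, mul_one] at this

namespace Collars

variable {Ω : Set ℂ} {N : ℕ} {γ : Fin N → ℝ → ℂ} {V : Fin N → Set ℂ} {Z χ : Fin N → ℂ → ℂ}

/-- A bounded sequence annihilating the Cauchy kernels with poles in an open subset annihilates the
Cauchy kernels with poles in all of `Ω`. -/
theorem tsum_resolvent_eq_zero (h : Collars Ω γ V Z χ) {D : Set ℂ} (hDo : IsOpen D)
    (hDne : D.Nonempty) (hD : D ⊆ Ω) (M : ℕ) {b : Fin N × ℤ → ℂ} {K : ℝ} (hb : ∀ j, ‖b j‖ ≤ K)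
    (h0 : ∀ ζ ∈ D, ∑' j, coeffs γ M (fun z => (z - ζ)⁻¹) j * b j = 0) :
    ∀ ζ ∈ Ω, ∑' j, coeffs γ M (fun z => (z - ζ)⁻¹) j * b j = 0 := by
  rcases isEmpty_or_nonempty (Fin N) with hN | ⟨⟨i⟩⟩
  · intro ζ _
    simp
  have hdiff : DifferentiableOn ℂ
      (fun ζ => ∑' j, coeffs γ M (fun z => (z - ζ)⁻¹) j * b j) Ω := by
    intro ζ hζ
    have hpos := h.infDist_frontier_pos i hζ
    set d := infDist ζ (frontier Ω) with hd
    obtain ⟨C, hC0, hC⟩ := h.exists_norm_fc_resolvent_le (M + 2)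
    have hsub : Ω ∩ ball ζ (d / 2) ∈ nhds ζ :=
      Filter.inter_mem (h.isOpen.mem_nhds hζ) (ball_mem_nhds _ (by positivity))
    have hb0 : 0 ≤ K := (norm_nonneg _).trans (hb (i, 0))
    refine DifferentiableAt.differentiableWithinAt ?_
    refine DifferentiableOn.differentiableAt ?_ hsub
    refine differentiableOn_tsum_of_summable_norm
      (u := fun j => (C * ((d / 2)⁻¹) ^ (1 + (M + 2)) * K) * ((1 + |(j.2 : ℝ)|) ^ 2)⁻¹)
      ((summable_prod_inv N).mul_left _) (fun j => ?_) (h.isOpen.inter isOpen_ball)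
      (fun j x hx => ?_)
    · refine DifferentiableOn.mul_const (DifferentiableOn.const_mul ?_ _) _
      refine (differentiableOn_fc_cauchy (h.smooth j.1).continuous (h.periodic j.1) j.2).mono ?_
      rintro x ⟨hx, -⟩ ⟨t, rfl⟩
      exact h.notMem _ _ hx
    · have h0 : 0 ≤ (infDist x (frontier Ω))⁻¹ := inv_nonneg.2 infDist_nonneg
      have h1 : d / 2 ≤ infDist x (frontier Ω) := by
        have := infDist_le_infDist_add_dist (s := frontier Ω) (x := ζ) (y := x)
        have h2 := hx.2
        rw [mem_ball, dist_comm] at h2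
        linarith
      have h2 := hC x hx.1 j.1 j.2
      rw [norm_mul, norm_coeffs, ← weight_mul_inv_le M]
      calc _ ≤ (1 + |(j.2 : ℝ)|) ^ M * (C * ((d / 2)⁻¹) ^ (1 + (M + 2)) *
            ((1 + |(j.2 : ℝ)|) ^ (M + 2))⁻¹) * K := by
            gcongr ?_ * ?_ * ?_
            · refine h2.trans ?_
              gcongr
            · exact hb j
        _ = _ := by ring
  obtain ⟨z₀, hz₀⟩ := hDne
  exact (hdiff.analyticOnNhd h.isOpen).eqOn_zero_of_preconnected_of_eventuallyEq_zero
    h.connected.isPreconnected (hD hz₀) (Filter.eventuallyEq_of_mem (hDo.mem_nhds hz₀) h0)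

theorem smooth_cauchyT_indicator (h : Collars Ω γ V Z χ) {Φ : ℂ → ℂ} {U : Set ℂ}
    (hΦ : Adm U (frontier Ω) Φ) (j : Fin N) :
    ContDiff ℝ (⊤ : ℕ∞) fun t => cauchyT (Ω.indicator Φ) (γ j t) :=
  (contDiff_cauchyT (contDiff_indicator_of_flat hΦ.contDiff hΦ.flat)
    (hΦ.compact.mono (by simp))).comp (h.smooth j)

theorem tsum_cauchyT_indicator_eq_zero (h : Collars Ω γ V Z χ) (M : ℕ) {b : Fin N × ℤ → ℂ} {K : ℝ}
    (hb : ∀ j, ‖b j‖ ≤ K)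
    (h0 : ∀ ζ ∈ Ω, ∑' j, coeffs γ M (fun z => (z - ζ)⁻¹) j * b j = 0) {Φ : ℂ → ℂ} {U : Set ℂ}
    (hΦ : Adm U (frontier Ω) Φ) :
    ∑' j, coeffs γ M (cauchyT (Ω.indicator Φ)) j * b j = 0 := by
  rcases isEmpty_or_nonempty (Fin N) with hN | ⟨⟨i⟩⟩
  · simp
  have hK : 0 ≤ K := (norm_nonneg _).trans (hb (i, 0))
  obtain ⟨C, hC0, hC⟩ := h.exists_norm_fc_resolvent_le (M + 2)
  obtain ⟨C', hC'0, hC'⟩ := h.exists_norm_le_infDist_pow i hΦ (1 + (M + 2))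
  have hfin : volume Ω < ⊤ := h.bounded.measure_lt_top
  have : IsFiniteMeasure (volume.restrict Ω) := ⟨by simpa using hfin⟩
  have hbd : ∀ j : Fin N × ℤ, ∀ ζ ∈ Ω,
      ‖Φ ζ * (coeffs γ M (fun z => (z - ζ)⁻¹) j * b j)‖ ≤
        C' * C * K * ((1 + |(j.2 : ℝ)|) ^ 2)⁻¹ := by
    intro j ζ hζ
    have hd := h.infDist_frontier_pos i hζ
    rw [norm_mul, norm_mul, norm_coeffs, ← weight_mul_inv_le M]
    calc _ ≤ (C' * infDist ζ (frontier Ω) ^ (1 + (M + 2))) * ((1 + |(j.2 : ℝ)|) ^ M *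
          (C * (infDist ζ (frontier Ω))⁻¹ ^ (1 + (M + 2)) * ((1 + |(j.2 : ℝ)|) ^ (M + 2))⁻¹) * K) := by
          gcongr ?_ * (_ * ?_ * ?_)
          · exact hC' ζ
          · exact hC ζ hζ j.1 j.2
          · exact hb j
      _ = C' * C * K * ((1 + |(j.2 : ℝ)|) ^ M * ((1 + |(j.2 : ℝ)|) ^ (M + 2))⁻¹) *
          ((infDist ζ (frontier Ω)) ^ (1 + (M + 2)) * (infDist ζ (frontier Ω))⁻¹ ^ (1 + (M + 2))) := by
          ring
      _ = _ := by
          rw [← mul_pow, mul_inv_cancel₀ hd.ne', one_pow, mul_one]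
  have hmeas : ∀ j : Fin N × ℤ, AEStronglyMeasurable
      (fun ζ => Φ ζ * (coeffs γ M (fun z => (z - ζ)⁻¹) j * b j)) (volume.restrict Ω) := by
    intro j
    refine ContinuousOn.aestronglyMeasurable ?_ h.isOpen.measurableSet
    refine hΦ.contDiff.continuous.continuousOn.mul (ContinuousOn.mul (continuousOn_const.mul ?_)
      continuousOn_const)
    refine (differentiableOn_fc_cauchy (h.smooth j.1).continuous
      (h.periodic j.1) j.2).continuousOn.mono ?_
    rintro x hx ⟨t, rfl⟩
    exact h.notMem _ _ hx
  have hinteg : ∀ j : Fin N × ℤ, Integrable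
      (fun ζ => Φ ζ * (coeffs γ M (fun z => (z - ζ)⁻¹) j * b j)) (volume.restrict Ω) := fun j =>
    Integrable.of_bound (hmeas j) _ ((ae_restrict_iff' h.isOpen.measurableSet).2
      (Filter.Eventually.of_forall (hbd j)))
  have hsum := hasSum_integral_of_summable_integral_norm hinteg (by
    refine Summable.of_nonneg_of_le (fun j => integral_nonneg fun _ => norm_nonneg _) (fun j => ?_)
      ((summable_prod_inv N).mul_left (C' * C * K * volume.real Ω))
    have := norm_setIntegral_le_of_norm_le_const (f := fun ζ =>
      ‖Φ ζ * (coeffs γ M (fun z => (z - ζ)⁻¹) j * b j)‖) hfin (fun ζ hζ => by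
        rw [norm_norm]; exact hbd j ζ hζ)
    refine (le_abs_self _).trans (this.trans (le_of_eq ?_))
    ring)
  have hz : ∫ ζ in Ω, ∑' j, Φ ζ * (coeffs γ M (fun z => (z - ζ)⁻¹) j * b j) = 0 := by
    refine setIntegral_eq_zero_of_forall_eq_zero fun ζ hζ => ?_
    rw [tsum_mul_left, h0 ζ hζ, mul_zero]
  rw [hz] at hsum
  have := (hsum.mul_left (1 / (Real.pi : ℂ))).tsum_eq
  rw [mul_zero] at this
  rw [← this]
  congr 1 with j
  rw [coeffs, h.fc_cauchyT_indicator hΦ, mul_left_comm, ← integral_const_mul, mul_assoc,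
    ← integral_mul_const]
  congr 2 with ζ
  rw [coeffs]
  ring

theorem fc_chi_mul_zpow (h : Collars Ω γ V Z χ) (j i : Fin N × ℤ) :
    fc (fun t => χ j.1 (γ i.1 t) * Z j.1 (γ i.1 t) ^ j.2) i.2 = if i = j then 1 else 0 := by
  simp only [h.chi_mul_zpow_apply, Prod.ext_iff]
  by_cases hj : i.1 = j.1
  · simp only [hj, if_true, fc_exp, true_and]
  · simp [hj, fc]

/-- Density of the boundary values of meromorphic functions with poles in a small set. -/
theorem exists_mem_bmero_near (h : Collars Ω γ V Z χ) {D : Set ℂ} (hDo : IsOpen D)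
    (hDne : D.Nonempty) (hD : D ⊆ Ω) (M : ℕ) {v : ℂ → ℂ}
    (hv : ∀ i, ContDiff ℝ (⊤ : ℕ∞) fun t => v (γ i t)) {η : ℝ} (hη : 0 < η) :
    ∃ p ∈ bmero Ω D, ∑' j, ‖coeffs γ M (fun z => v z - p z) j‖ ≤ η := by
  classical
  have hadd : ∀ u w : ℂ → ℂ, (∀ i, ContDiff ℝ (⊤ : ℕ∞) fun t => u (γ i t)) →
      (∀ i, ContDiff ℝ (⊤ : ℕ∞) fun t => w (γ i t)) → ∀ j,
      coeffs γ M (fun z => u z + w z) j = coeffs γ M u j + coeffs γ M w j := by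
    intro u w hu hw j
    rw [coeffs, fc_add (p := fun t => u (γ j.1 t)) (q := fun t => w (γ j.1 t))
      (hu j.1).continuous (hw j.1).continuous, mul_add, coeffs, coeffs]
  have hsmul : ∀ (a : ℂ) (u : ℂ → ℂ) j, coeffs γ M (fun z => a * u z) j = a * coeffs γ M u j := by
    intro a u j
    rw [coeffs, fc_const_mul a (fun t => u (γ j.1 t)), coeffs]
    ring
  let S : Submodule ℂ (CoeffSpace N) :=
    { carrier := {y | ∃ p ∈ bmero Ω D, ∀ j, y j = coeffs γ M p j}
      zero_mem' := ⟨0, Submodule.zero_mem _, fun j => by simp [coeffs, fc]⟩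
      add_mem' := by
        rintro y y' ⟨p, hp, hy⟩ ⟨p', hp', hy'⟩
        refine ⟨p + p', Submodule.add_mem _ hp hp', fun j => ?_⟩
        rw [lp.coeFn_add, Pi.add_apply, hy, hy']
        exact (hadd p p' (h.smooth_of_mem_bmero hD hp) (h.smooth_of_mem_bmero hD hp') j).symm
      smul_mem' := by
        rintro a y ⟨p, hp, hy⟩
        refine ⟨a • p, Submodule.smul_mem _ a hp, fun j => ?_⟩
        rw [lp.coeFn_smul, Pi.smul_apply, hy]
        exact (hsmul a p j).symm }
  let vec : ∀ u : ℂ → ℂ, (∀ i, ContDiff ℝ (⊤ : ℕ∞) fun t => u (γ i t)) → CoeffSpace N :=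
    fun u hu => ⟨coeffs γ M u, memℓp_one_of_summable (summable_norm_coeffs h.periodic hu M)⟩
  have hmem : vec v hv ∈ closure (S : Set (CoeffSpace N)) := by
    by_contra hcon
    obtain ⟨f, hf, hfS⟩ := exists_clm_eq_zero_of_notMem_closure S hcon
    refine hf ?_
    set b : Fin N × ℤ → ℂ := fun j => f (lp.single 1 j 1) with hbdef
    have hb : ∀ j, ‖b j‖ ≤ ‖f‖ := norm_clm_single_le f
    have hfv : ∀ u hu, ∑' j, coeffs γ M u j * b j = f (vec u hu) := fun u hu =>
      (hasSum_clm_coeffSpace f (vec u hu)).tsum_eq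
    have hres := h.tsum_resolvent_eq_zero hDo hDne hD M hb fun ζ hζ => by
      rw [hfv _ (h.smooth_of_mem_bmero hD (inv_sub_mem_bmero hζ))]
      exact hfS _ ⟨_, inv_sub_mem_bmero hζ, fun _ => rfl⟩
    have hb0 : ∀ i n, b (i, n) = 0 := by
      intro i n
      have hP := h.adm_mul_zpow i n
      have hΦ := h.adm_dbar_mul_zpow i n
      set P : ℂ → ℂ := fun z => χ i z * Z i z ^ n with hPdef
      set Φ := dbar P with hΦdef
      have hflat' : ∀ z ∈ frontier Ωᶜ, FlatAt Φ z := by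
        rw [frontier_compl]
        exact hΦ.flat
      have hs1 := contDiff_indicator_of_flat hΦ.contDiff hΦ.flat
      have hs2 := contDiff_indicator_of_flat hΦ.contDiff hflat'
      have hc1 : HasCompactSupport (Ω.indicator Φ) := hΦ.compact.mono (by simp)
      have hc2 : HasCompactSupport (Ωᶜ.indicator Φ) := hΦ.compact.mono (by simp)
      have hk1 := contDiff_cauchyT hs1 hc1
      have hk2 := contDiff_cauchyT hs2 hc2
      have hsplit : ∀ z, P z = cauchyT (Ω.indicator Φ) z + cauchyT (Ωᶜ.indicator Φ) z := by
        intro z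
        rw [← cauchyT_dbar (hP.contDiff.of_le (by simp)) hP.compact z, cauchyT_eq, cauchyT_eq,
          cauchyT_eq, ← smul_add, ← integral_add]
        · congr 2 with ζ
          rw [← smul_add, ← Pi.add_apply (Ω.indicator Φ), indicator_self_add_compl]
        · simpa using (integrable_inv_smul hs1.continuous hc1 z).comp_sub_left z
        · simpa using (integrable_inv_smul hs2.continuous hc2 z).comp_sub_left z
      have hmem2 : cauchyT (Ωᶜ.indicator Φ) ∈ bmero Ω D := by
        refine mem_bmero_of_contDiff hk2 fun z hz => ?_
        refine (differentiableAt_of_dbar_eq_zero (hk2.differentiable (by simp) z)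
          ?_).differentiableWithinAt
        rw [dbar_cauchyT (hs2.of_le (by simp)) hc2]
        simp [hz]
      have e1 := h.tsum_cauchyT_indicator_eq_zero M hb hres hΦ
      rw [hfv _ (h.smooth_cauchyT_indicator hΦ)] at e1
      have e2 : f (vec _ (h.smooth_of_mem_bmero hD hmem2)) = 0 :=
        hfS _ ⟨_, hmem2, fun _ => rfl⟩
      have e3 : f (vec P fun j => hP.contDiff.comp (h.smooth j)) = 0 := by
        have : vec P (fun j => hP.contDiff.comp (h.smooth j)) =
            vec _ (h.smooth_cauchyT_indicator hΦ) + vec _ (h.smooth_of_mem_bmero hD hmem2) := by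
          ext j
          rw [lp.coeFn_add, Pi.add_apply]
          refine Eq.trans ?_ (hadd _ _ (h.smooth_cauchyT_indicator hΦ)
            (h.smooth_of_mem_bmero hD hmem2) j)
          exact congrArg (fun u => coeffs γ M u j) (funext hsplit)
        rw [this, map_add, e1, e2, add_zero]
      rw [← hfv P fun j => hP.contDiff.comp (h.smooth j)] at e3
      have hco : ∀ j, coeffs γ M P j = if j = (i, n) then
          (((1 + |(n : ℝ)|) ^ M : ℝ) : ℂ) else 0 := by
        intro j
        rw [coeffs, h.fc_chi_mul_zpow (i, n) j]
        split_ifs with hj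
        · rw [hj, mul_one]
        · rw [mul_zero]
      simp only [hco, ite_mul, zero_mul, tsum_ite_eq] at e3
      exact (mul_eq_zero.1 e3).resolve_left (weight_ne_zero M n)
    rw [← hfv v hv]
    have : ∀ j, b j = 0 := fun j => hb0 j.1 j.2
    simp [this]
  obtain ⟨y, ⟨p, hp, hy⟩, hdist⟩ := Metric.mem_closure_iff.1 hmem η hη
  refine ⟨p, hp, ?_⟩
  rw [dist_eq_norm, norm_coeffSpace] at hdist
  refine le_trans (le_of_eq ?_) hdist.le
  congr 1 with j
  rw [lp.coeFn_sub, Pi.sub_apply, hy, coeffs,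
    fc_sub (p := fun t => v (γ j.1 t)) (q := fun t => p (γ j.1 t))
      (hv j.1).continuous (h.smooth_of_mem_bmero hD hp j.1).continuous, mul_sub]
  rfl

end Collars

theorem fc_conj (q : ℝ → ℂ) (n : ℤ) : fc (fun t => conj (q t)) n = conj (fc q (-n)) := by
  rw [fc, fc, map_mul, ← intervalIntegral.intervalIntegral_conj]
  congr 1
  · simp [Complex.conj_ofNat]
  · congr 1 with t
    rw [map_mul, ← exp_conj]
    congr 2
    simp

theorem exists_coeffSpace_solution {N : ℕ} {k : Fin N × ℤ → CoeffSpace N} (hk : ∀ j, ‖k j‖ ≤ 1 / 2)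
    (e : CoeffSpace N) : ∃ y : CoeffSpace N, ‖y‖ ≤ 2 * ‖e‖ ∧
      ∀ i, HasSum (fun j => y j * k j i) (e i - y i) := by
  have hle : ∀ (y : CoeffSpace N) j, ‖y j • k j‖ ≤ ‖y j‖ * (1 / 2) := fun y j => by
    rw [norm_smul]
    gcongr
    exact hk j
  have hs : ∀ y : CoeffSpace N, Summable fun j => y j • k j := fun y =>
    Summable.of_norm_bounded ((summable_norm_coeffSpace y).mul_right _) (hle y)
  have hb : ∀ y : CoeffSpace N, ‖∑' j, y j • k j‖ ≤ 1 / 2 * ‖y‖ := by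
    intro y
    rw [norm_coeffSpace y, ← tsum_mul_left]
    refine tsum_of_norm_bounded ((summable_norm_coeffSpace y).mul_left _).hasSum fun j => ?_
    rw [mul_comm]
    exact hle y j
  have hsub : ∀ y y' : CoeffSpace N,
      (∑' j, y j • k j) - ∑' j, y' j • k j = ∑' j, (y - y' : CoeffSpace N) j • k j := by
    intro y y'
    rw [← (hs y).tsum_sub (hs y')]
    congr 1 with j : 1
    rw [lp.coeFn_sub, Pi.sub_apply, sub_smul]
  have hT : ContractingWith (1 / 2) fun y : CoeffSpace N => e - ∑' j, y j • k j := by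
    refine ⟨by rw [← NNReal.coe_lt_coe]; norm_num, LipschitzWith.of_dist_le_mul fun y y' => ?_⟩
    rw [dist_eq_norm, sub_sub_sub_cancel_left, hsub, dist_comm y y', dist_eq_norm]
    simpa using hb (y' - y)
  have hfix := hT.fixedPoint_isFixedPt
  set y := ContractingWith.fixedPoint _ hT
  have hy : e - ∑' j, y j • k j = y := hfix
  refine ⟨y, ?_, fun i => ?_⟩
  · have h1 := norm_sub_le e (∑' j, y j • k j)
    rw [hy] at h1
    linarith [hb y]
  · have h2 : e i - y i = (∑' j, y j • k j : CoeffSpace N) i := by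
      conv_lhs => rw [← hy]
      rw [lp.coeFn_sub, Pi.sub_apply]
      ring
    rw [h2]
    have := (hs y).hasSum.map (lp.evalCLM ℂ (fun _ : Fin N × ℤ => ℂ) 1 i)
      (lp.evalCLM ℂ (fun _ : Fin N × ℤ => ℂ) 1 i).continuous
    exact this

section Synthesis

variable {N : ℕ} {F : Fin N × ℤ → ℂ → ℂ} {u : Fin N × ℤ → ℂ}

theorem summable_mul_pow_of_rapid (hu : ∀ l : ℕ, ∃ C : ℝ, ∀ j, ‖u j‖ ≤ C * ((1 + |(j.2 : ℝ)|) ^ l)⁻¹)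
    (C : ℝ) (k : ℕ) : Summable fun j => ‖u j‖ * (C * (1 + |(j.2 : ℝ)|) ^ k) := by
  obtain ⟨K, hK⟩ := hu (k + 2)
  suffices Summable fun j => ‖u j‖ * (1 + |(j.2 : ℝ)|) ^ k by
    simpa only [mul_left_comm] using this.mul_left C
  refine Summable.of_nonneg_of_le (fun _ => by positivity) (fun j => ?_)
    ((summable_prod_inv N).mul_left K)
  rw [← weight_mul_inv_le k]
  calc _ ≤ (K * ((1 + |(j.2 : ℝ)|) ^ (k + 2))⁻¹) * (1 + |(j.2 : ℝ)|) ^ k := by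
        gcongr
        exact hK j
    _ = _ := by ring

theorem norm_iteratedFDeriv_const_mul_apply_le {f : ℂ → ℂ} (hf : ContDiff ℝ (⊤ : ℕ∞) f) (c : ℂ) (k : ℕ) (z : ℂ) :
    ‖iteratedFDeriv ℝ k (fun z => c * f z) z‖ ≤ ‖c‖ * ‖iteratedFDeriv ℝ k f z‖ := by
  have : iteratedFDeriv ℝ k (c • f) z = c • iteratedFDeriv ℝ k f z :=
    iteratedFDeriv_const_smul_apply (hf.contDiffAt.of_le (by exact_mod_cast le_top))
  change ‖iteratedFDeriv ℝ k (c • f) z‖ ≤ _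
  rw [this, norm_smul]

theorem contDiff_tsum_rapid (hF : ∀ j, ContDiff ℝ (⊤ : ℕ∞) (F j))
    (hb : ∀ k : ℕ, ∃ C : ℝ, ∀ j z, ‖iteratedFDeriv ℝ k (F j) z‖ ≤ C * (1 + |(j.2 : ℝ)|) ^ k)
    (hu : ∀ l : ℕ, ∃ C : ℝ, ∀ j, ‖u j‖ ≤ C * ((1 + |(j.2 : ℝ)|) ^ l)⁻¹) :
    ContDiff ℝ (⊤ : ℕ∞) fun z => ∑' j, u j * F j z := by
  choose C hC using hb
  refine contDiff_tsum (N := (⊤ : ℕ∞)) (v := fun k j => ‖u j‖ * (C k * (1 + |(j.2 : ℝ)|) ^ k))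
    (fun j => contDiff_const.mul (hF j)) (fun k _ => summable_mul_pow_of_rapid hu _ _) ?_
  intro k j z _
  exact (norm_iteratedFDeriv_const_mul_apply_le (hF j) _ _ _).trans (by gcongr; exact hC k j z)

theorem norm_iteratedFDeriv_tsum_rapid_le (hF : ∀ j, ContDiff ℝ (⊤ : ℕ∞) (F j))
    (hb : ∀ k : ℕ, ∃ C : ℝ, ∀ j z, ‖iteratedFDeriv ℝ k (F j) z‖ ≤ C * (1 + |(j.2 : ℝ)|) ^ k)
    (hu : ∀ l : ℕ, ∃ C : ℝ, ∀ j, ‖u j‖ ≤ C * ((1 + |(j.2 : ℝ)|) ^ l)⁻¹) (k : ℕ) {C : ℝ}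
    (hC : ∀ j z, ‖iteratedFDeriv ℝ k (F j) z‖ ≤ C * (1 + |(j.2 : ℝ)|) ^ k) (z : ℂ) :
    ‖iteratedFDeriv ℝ k (fun z => ∑' j, u j * F j z) z‖ ≤
      ∑' j, ‖u j‖ * (C * (1 + |(j.2 : ℝ)|) ^ k) := by
  choose C' hC' using hb
  rw [iteratedFDeriv_tsum (N := (⊤ : ℕ∞))
    (v := fun k j => ‖u j‖ * (C' k * (1 + |(j.2 : ℝ)|) ^ k))
    (fun j => contDiff_const.mul (hF j)) (fun k _ => summable_mul_pow_of_rapid hu _ _) ?_ le_top]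
  · refine tsum_of_norm_bounded (summable_mul_pow_of_rapid hu C k).hasSum fun j => ?_
    exact (norm_iteratedFDeriv_const_mul_apply_le (hF j) _ _ _).trans (by gcongr; exact hC j z)
  · intro k j z _
    exact (norm_iteratedFDeriv_const_mul_apply_le (hF j) _ _ _).trans (by gcongr; exact hC' k j z)

theorem differentiableOn_tsum_rapid {Ω : Set ℂ} (hΩ : IsOpen Ω)
    (hF : ∀ j, DifferentiableOn ℂ (F j) Ω)
    (hb : ∀ k : ℕ, ∃ C : ℝ, ∀ j z, ‖iteratedFDeriv ℝ k (F j) z‖ ≤ C * (1 + |(j.2 : ℝ)|) ^ k)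
    (hu : ∀ l : ℕ, ∃ C : ℝ, ∀ j, ‖u j‖ ≤ C * ((1 + |(j.2 : ℝ)|) ^ l)⁻¹) :
    DifferentiableOn ℂ (fun z => ∑' j, u j * F j z) Ω := by
  obtain ⟨C, hC⟩ := hb 0
  refine differentiableOn_tsum_of_summable_norm (summable_mul_pow_of_rapid hu C 0)
    (fun j => (hF j).const_mul _) hΩ fun j z _ => ?_
  rw [norm_mul]
  gcongr
  simpa using hC j z

end Synthesis

namespace Collars

variable {Ω : Set ℂ} {N : ℕ} {γ : Fin N → ℝ → ℂ} {V : Fin N → Set ℂ} {Z χ : Fin N → ℂ → ℂ}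

theorem exists_mode_family (h : Collars Ω γ V Z χ) : ∃ P Q : Fin N × ℤ → ℂ → ℂ,
    (∀ j, ContDiff ℝ (⊤ : ℕ∞) (P j)) ∧ (∀ j, ContDiff ℝ (⊤ : ℕ∞) (Q j)) ∧
    (∀ j, DifferentiableOn ℂ (P j) Ω) ∧ (∀ j, DifferentiableOn ℂ (Q j) Ω) ∧
    (∀ k : ℕ, ∃ C : ℝ, 0 ≤ C ∧ ∀ j z, ‖iteratedFDeriv ℝ k (P j) z‖ ≤ C * (1 + |(j.2 : ℝ)|) ^ k) ∧
    (∀ k : ℕ, ∃ C : ℝ, 0 ≤ C ∧ ∀ j z, ‖iteratedFDeriv ℝ k (Q j) z‖ ≤ C * (1 + |(j.2 : ℝ)|) ^ k) ∧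
    ∀ l : ℕ, ∃ C : ℝ, 0 ≤ C ∧ ∀ j i : Fin N × ℤ,
      ‖fc (fun t => conj (P j (γ i.1 t)) + Q j (γ i.1 t)) i.2 - (if i = j then 1 else 0)‖ ≤
        C * ((1 + |(j.2 : ℝ)|) ^ l)⁻¹ * ((1 + |(i.2 : ℝ)|) ^ l)⁻¹ := by
  choose A hA1 hA2 hA3 hA4 using h.exists_modes
  have hzero : ∀ k z, ‖iteratedFDeriv ℝ k (fun _ : ℂ => (0 : ℂ)) z‖ = 0 := fun k z => by
    rw [iteratedFDeriv_fun_zero]; simp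
  refine ⟨fun j => if j.2 < 0 then A j.1 (-j.2) else fun _ => 0,
    fun j => if 0 ≤ j.2 then A j.1 j.2 else fun _ => 0, fun j => ?_, fun j => ?_, fun j => ?_,
    fun j => ?_, fun k => ?_, fun k => ?_, fun l => ?_⟩
  · dsimp only
    split_ifs with hj
    · exact hA1 _ _ (by omega)
    · exact contDiff_const
  · dsimp only
    split_ifs with hj
    · exact hA1 _ _ hj
    · exact contDiff_const
  · dsimp only
    split_ifs with hj
    · exact hA2 _ _ (by omega)
    · exact differentiableOn_const _
  · dsimp only
    split_ifs with hj
    · exact hA2 _ _ hj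
    · exact differentiableOn_const _
  · choose C hC0 hC using fun i => hA3 i k
    refine ⟨∑ i, C i, Finset.sum_nonneg fun i _ => hC0 i, fun j z => ?_⟩
    have hle : C j.1 ≤ ∑ i, C i := Finset.single_le_sum (fun i _ => hC0 i) (Finset.mem_univ _)
    have h0 := (hC0 j.1).trans hle
    dsimp only
    split_ifs with hj
    · refine (hC j.1 _ (by omega) z).trans ?_
      push_cast
      rw [abs_neg]
      gcongr
    · rw [hzero]
      positivity
  · choose C hC0 hC using fun i => hA3 i k
    refine ⟨∑ i, C i, Finset.sum_nonneg fun i _ => hC0 i, fun j z => ?_⟩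
    have hle : C j.1 ≤ ∑ i, C i := Finset.single_le_sum (fun i _ => hC0 i) (Finset.mem_univ _)
    have h0 := (hC0 j.1).trans hle
    dsimp only
    split_ifs with hj
    · refine (hC j.1 _ hj z).trans ?_
      gcongr
    · rw [hzero]
      positivity
  · choose C hC0 hC using fun i => hA4 i l
    refine ⟨∑ i, C i, Finset.sum_nonneg fun i _ => hC0 i, fun j i => ?_⟩
    have hle : C j.1 ≤ ∑ i, C i := Finset.single_le_sum (fun i _ => hC0 i) (Finset.mem_univ _)
    have h0 := (hC0 j.1).trans hle
    rcases lt_or_ge j.2 0 with hj | hj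
    · have h1 := hC j.1 (-j.2) (by omega) i.1 (-i.2)
      push_cast at h1
      rw [abs_neg, abs_neg] at h1
      simp only [hj, if_true, not_le.2 hj, if_false, add_zero]
      rw [fc_conj (fun t => A j.1 (-j.2) (γ i.1 t)), ← norm_conj]
      refine le_trans (le_of_eq ?_) (h1.trans (by gcongr))
      rw [map_sub, conj_conj]
      congr 2
      simp only [neg_inj, Prod.ext_iff]
      split_ifs <;> simp
    · have h1 := hC j.1 j.2 hj i.1 i.2
      simp only [hj, if_true, not_lt.2 hj, if_false, map_zero, zero_add]
      refine le_trans (le_of_eq ?_) (h1.trans (by gcongr))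
      simp only [Prod.ext_iff]

end Collars

theorem fc_finset_sum {ι : Type*} (s : Finset ι) {q : ι → ℝ → ℂ} (hq : ∀ i ∈ s, Continuous (q i))
    (n : ℤ) : fc (fun t => ∑ i ∈ s, q i t) n = ∑ i ∈ s, fc (q i) n := by
  simp only [fc, Finset.sum_mul, ← Finset.mul_sum]
  rw [intervalIntegral.integral_finsetSum (f := fun i t => q i t * exp (-(n * t * I))) fun i hi =>
    ((hq i hi).mul (continuous_exp_neg_int_mul_I n)).intervalIntegrable _ _]

theorem bmero_congr {Ω D : Set ℂ} {v w : ℂ → ℂ} (hv : v ∈ bmero Ω D)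
    (hvw : ∀ z ∈ frontier Ω, w z = v z) : w ∈ bmero Ω D := by
  obtain ⟨h, c, h1, h2, h3, h4⟩ := hv
  exact ⟨h, c, h1, h2, h3, fun z hz => (hvw z hz).trans (h4 z hz)⟩

theorem eq_zero_of_fc_eq_zero {q : ℝ → ℂ} (hq : Continuous q)
    (hp : Function.Periodic q (2 * Real.pi)) (h : ∀ n, fc q n = 0) (t : ℝ) : q t = 0 := by
  have h1 := hasSum_fc_mul_exp hq hp (by rw [show fc q = fun _ => 0 from funext h]; exact summable_zero) t
  simp only [h, zero_mul] at h1
  exact h1.unique hasSum_zero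

namespace Collars

variable {Ω : Set ℂ} {N : ℕ} {γ : Fin N → ℝ → ℂ} {V : Fin N → Set ℂ} {Z χ : Fin N → ℂ → ℂ}

/-- The identity can be corrected by a small holomorphic function so that its conjugate agrees on
the boundary with a meromorphic function having only simple poles, located in a given open set. -/
theorem exists_small_correction (h : Collars Ω γ V Z χ) {D : Set ℂ} (hDo : IsOpen D)
    (hDne : D.Nonempty) (hD : D ⊆ Ω) (m : ℕ) {δ : ℝ} (hδ : 0 < δ) :
    ∃ a : ℂ → ℂ, ContDiff ℝ (⊤ : ℕ∞) a ∧ DifferentiableOn ℂ a Ω ∧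
      (∀ k ≤ m, ∀ z, ‖iteratedFDeriv ℝ k a z‖ ≤ δ) ∧
      (fun z => conj (z - a z)) ∈ bmero Ω D := by
  classical
  obtain ⟨P, Q, hP, hQ, hPΩ, hQΩ, hPb, hQb, hPQ⟩ := h.exists_mode_family
  set B : Fin N × ℤ → ℂ → ℂ := fun j z => conj (P j z) + Q j z with hB
  set E : Fin N × ℤ → ℂ → ℂ := fun j z => χ j.1 z * Z j.1 z ^ j.2 with hE
  set W : Fin N × ℤ → ℝ := fun j => (1 + |(j.2 : ℝ)|) ^ m with hW
  have hW1 : ∀ j, 1 ≤ W j := fun j => one_le_pow₀ (by linarith [abs_nonneg (j.2 : ℝ)])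
  have hW0 : ∀ j, (W j : ℂ) ≠ 0 := fun j => weight_ne_zero m j.2
  have hBs : ∀ j, ContDiff ℝ (⊤ : ℕ∞) (B j) := fun j =>
    (conjCLE.contDiff.comp (hP j)).add (hQ j)
  have hEs : ∀ j, ContDiff ℝ (⊤ : ℕ∞) (E j) := fun j => (h.adm_mul_zpow j.1 j.2).contDiff
  obtain ⟨C₁, hC₁0, hC₁⟩ := hPQ (m + 2)
  set S : ℝ := ∑' j : Fin N × ℤ, ((1 + |(j.2 : ℝ)|) ^ 2)⁻¹ with hS
  have hS0 : 0 ≤ S := tsum_nonneg fun _ => by positivity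
  obtain ⟨n₀, hn₀⟩ := exists_nat_ge (2 * C₁ * S)
  have hfcBE : ∀ j i : Fin N × ℤ, fc (fun t => B j (γ i.1 t) - E j (γ i.1 t)) i.2 =
      fc (fun t => B j (γ i.1 t)) i.2 - if i = j then 1 else 0 := by
    intro j i
    rw [← h.fc_chi_mul_zpow j i]
    exact fc_sub ((hBs j).continuous.comp (h.smooth i.1).continuous)
      ((hEs j).continuous.comp (h.smooth i.1).continuous) _
  have hp : ∀ j : Fin N × ℤ, ∃ p ∈ bmero Ω D, ((n₀ : ℝ) ≤ |(j.2 : ℝ)| → p = 0) ∧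
      ∑' i, ‖coeffs γ m (fun z => (B j z - E j z) - p z) i‖ ≤ W j / 2 := by
    intro j
    rcases le_or_gt (n₀ : ℝ) |(j.2 : ℝ)| with hj | hj
    · refine ⟨0, Submodule.zero_mem _, fun _ => rfl, ?_⟩
      have hle : ∀ i, ‖coeffs γ m (fun z => (B j z - E j z) - (0 : ℂ → ℂ) z) i‖ ≤
          C₁ * ((1 + |(j.2 : ℝ)|) ^ (m + 2))⁻¹ * ((1 + |(i.2 : ℝ)|) ^ 2)⁻¹ := by
        intro i
        rw [norm_coeffs, ← weight_mul_inv_le m]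
        simp only [Pi.zero_apply, sub_zero]
        rw [hfcBE]
        calc _ ≤ (1 + |(i.2 : ℝ)|) ^ m * (C₁ * ((1 + |(j.2 : ℝ)|) ^ (m + 2))⁻¹ *
              ((1 + |(i.2 : ℝ)|) ^ (m + 2))⁻¹) := by
              gcongr
              exact hC₁ j i
          _ = _ := by ring
      refine (tsum_of_norm_bounded (f := fun i => ‖_‖) ((summable_prod_inv N).mul_left
        (C₁ * ((1 + |(j.2 : ℝ)|) ^ (m + 2))⁻¹)).hasSum
        (fun i => by rw [norm_norm]; exact hle i) |> (le_abs_self _).trans).trans ?_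
      rw [tsum_mul_left, ← hS]
      have h1 : 2 * C₁ * S ≤ (1 + |(j.2 : ℝ)|) ^ (m + 2) := by
        have h2 : (1 + |(j.2 : ℝ)|) ^ 1 ≤ (1 + |(j.2 : ℝ)|) ^ (m + 2) :=
          pow_le_pow_right₀ (by linarith [abs_nonneg (j.2 : ℝ)]) (by omega)
        linarith
      have h3 : 0 < (1 + |(j.2 : ℝ)|) ^ (m + 2) := by positivity
      calc C₁ * ((1 + |(j.2 : ℝ)|) ^ (m + 2))⁻¹ * S
          = (2 * C₁ * S) * ((1 + |(j.2 : ℝ)|) ^ (m + 2))⁻¹ / 2 := by ring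
        _ ≤ 1 / 2 := by
            gcongr
            rwa [← div_eq_mul_inv, div_le_one h3]
        _ ≤ W j / 2 := by
            gcongr
            exact hW1 j
    · obtain ⟨p, hp, hp'⟩ := h.exists_mem_bmero_near hDo hDne hD m
        (v := fun z => B j z - E j z)
        (fun i => ((hBs j).sub (hEs j)).comp (h.smooth i)) (η := W j / 2)
        (by linarith [hW1 j])
      exact ⟨p, hp, fun hj' => absurd hj' (not_le.2 hj), hp'⟩
  choose p hpm hp0 hpn using hp
  set R : Fin N × ℤ → ℂ → ℂ := fun j z => (B j z - E j z) - p j z with hR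
  have hps := fun j => h.smooth_of_mem_bmero hD (hpm j)
  have hRs : ∀ j i, ContDiff ℝ (⊤ : ℕ∞) fun t => R j (γ i t) := fun j i =>
    (((hBs j).sub (hEs j)).comp (h.smooth i)).sub (hps j i)
  have hRb : ∀ l : ℕ, ∃ C : ℝ, 0 ≤ C ∧ ∀ j i : Fin N × ℤ,
      ‖fc (fun t => R j (γ i.1 t)) i.2‖ ≤ C * ((1 + |(i.2 : ℝ)|) ^ l)⁻¹ := by
    intro l
    obtain ⟨C, hC0, hC⟩ := hPQ l
    choose C' hC'0 hC' using fun j => exists_fc_le_of_smooth h.periodic (hRs j) l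
    set J : Finset (Fin N × ℤ) := Finset.univ ×ˢ Finset.Icc (-(n₀ : ℤ)) n₀ with hJ
    have hs0 : 0 ≤ ∑ j ∈ J, C' j := Finset.sum_nonneg fun j _ => hC'0 j
    refine ⟨C + ∑ j ∈ J, C' j, by positivity, fun j i => ?_⟩
    rcases le_or_gt (n₀ : ℝ) |(j.2 : ℝ)| with hj | hj
    · have h1 : fc (fun t => R j (γ i.1 t)) i.2 = fc (fun t => B j (γ i.1 t)) i.2 -
          if i = j then 1 else 0 := by
        rw [← hfcBE]
        simp only [hR, hp0 j hj, Pi.zero_apply, sub_zero]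
      rw [h1]
      refine (hC j i).trans ?_
      have h2 : ((1 + |(j.2 : ℝ)|) ^ l)⁻¹ ≤ 1 :=
        inv_le_one_of_one_le₀ (one_le_pow₀ (by linarith [abs_nonneg (j.2 : ℝ)]))
      gcongr
      nlinarith
    · refine (hC' j i.1 i.2).trans ?_
      have hmem : j ∈ J := by
        simp only [hJ, Finset.mem_product, Finset.mem_univ, true_and, Finset.mem_Icc]
        have h3 := abs_lt.1 hj
        have h4 : ((-(n₀ : ℤ) : ℤ) : ℝ) < j.2 := by push_cast; exact h3.1
        have h5 : (j.2 : ℝ) < ((n₀ : ℤ) : ℝ) := by push_cast; exact h3.2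
        exact ⟨(Int.cast_lt.1 h4).le, (Int.cast_lt.1 h5).le⟩
      gcongr
      have := Finset.single_le_sum (fun j _ => hC'0 j) hmem
      linarith
  choose Cp hCp0 hCp using hPb
  set C₂ : ℝ := ∑ k ∈ Finset.range (m + 1), Cp k with hC₂
  have hC₂0 : 0 ≤ C₂ := Finset.sum_nonneg fun k _ => hCp0 k
  obtain ⟨p₀, hp₀, hp₀n⟩ := h.exists_mem_bmero_near hDo hDne hD m (v := fun z => conj z)
    (fun i => conjCLE.contDiff.comp (h.smooth i)) (η := δ / (2 * (C₂ + 1))) (by positivity)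
  set e₀ : ℂ → ℂ := fun z => conj z - p₀ z with he₀
  have he₀s : ∀ i, ContDiff ℝ (⊤ : ℕ∞) fun t => e₀ (γ i t) := fun i =>
    (conjCLE.contDiff.comp (h.smooth i)).sub (h.smooth_of_mem_bmero hD hp₀ i)
  let vec : ∀ u : ℂ → ℂ, (∀ i, ContDiff ℝ (⊤ : ℕ∞) fun t => u (γ i t)) → CoeffSpace N :=
    fun u hu => ⟨coeffs γ m u, memℓp_one_of_summable (summable_norm_coeffs h.periodic hu m)⟩
  obtain ⟨y, hyn, hy⟩ := exists_coeffSpace_solution (k := fun j => (W j : ℂ)⁻¹ • vec (R j) (hRs j))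
    (fun j => by
      rw [norm_smul, norm_inv, norm_weight, norm_coeffSpace]
      calc _ ≤ (W j)⁻¹ * (W j / 2) := by
            gcongr
            exact hpn j
        _ = 1 / 2 := by
            have := hW1 j
            field_simp) (vec e₀ he₀s)
  have hvec : ‖vec e₀ he₀s‖ ≤ δ / (2 * (C₂ + 1)) := by
    rw [norm_coeffSpace]
    exact hp₀n
  set u : Fin N × ℤ → ℂ := fun j => (W j : ℂ)⁻¹ * y j with hu
  have hsolve : ∀ i, HasSum (fun j => u j * fc (fun t => R j (γ i.1 t)) i.2)
      (fc (fun t => e₀ (γ i.1 t)) i.2 - u i) := by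
    intro i
    have h1 := (hy i).mul_left (W i : ℂ)⁻¹
    have h2 : (W i : ℂ)⁻¹ * (vec e₀ he₀s i - y i) = fc (fun t => e₀ (γ i.1 t)) i.2 - u i := by
      rw [mul_sub]
      congr 1
      exact inv_mul_cancel_left₀ (hW0 i) _
    rw [h2] at h1
    refine (congrArg (HasSum · _) (funext fun j => ?_)).mpr h1
    have h3 : (W i : ℂ)⁻¹ * vec (R j) (hRs j) i = fc (fun t => R j (γ i.1 t)) i.2 :=
      inv_mul_cancel_left₀ (hW0 i) _
    rw [← h3, lp.coeFn_smul, Pi.smul_apply, smul_eq_mul, hu]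
    ring
  have hule : ∀ j, ‖u j‖ ≤ ‖y j‖ := by
    intro j
    rw [hu, norm_mul, norm_inv, norm_weight]
    exact mul_le_of_le_one_left (norm_nonneg _) (inv_le_one_of_one_le₀ (hW1 j))
  have hrapid : ∀ l : ℕ, ∃ C : ℝ, ∀ j, ‖u j‖ ≤ C * ((1 + |(j.2 : ℝ)|) ^ l)⁻¹ := by
    intro l
    obtain ⟨C, hC0, hC⟩ := hRb l
    obtain ⟨C', hC'0, hC'⟩ := exists_fc_le_of_smooth h.periodic he₀s l
    refine ⟨C' + ‖y‖ * C, fun i => ?_⟩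
    have h1 : ‖fc (fun t => e₀ (γ i.1 t)) i.2 - u i‖ ≤
        ‖y‖ * (C * ((1 + |(i.2 : ℝ)|) ^ l)⁻¹) := by
      rw [← (hsolve i).tsum_eq, norm_coeffSpace y, ← tsum_mul_right]
      refine tsum_of_norm_bounded ((summable_norm_coeffSpace y).mul_right _).hasSum fun j => ?_
      rw [norm_mul]
      gcongr
      · exact hule j
      · exact hC j i
    have h2 := norm_sub_norm_le (u i) (fc (fun t => e₀ (γ i.1 t)) i.2)
    rw [norm_sub_rev] at h2
    have h3 := hC' i.1 i.2
    rw [add_mul]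
    linarith
  have hrapid' : ∀ l : ℕ, ∃ C : ℝ, ∀ j, ‖conj (u j)‖ ≤ C * ((1 + |(j.2 : ℝ)|) ^ l)⁻¹ := by
    simpa only [RCLike.norm_conj] using hrapid
  have hPb' : ∀ k : ℕ, ∃ C : ℝ, ∀ j z, ‖iteratedFDeriv ℝ k (P j) z‖ ≤ C * (1 + |(j.2 : ℝ)|) ^ k :=
    fun k => ⟨Cp k, hCp k⟩
  have hQb' : ∀ k : ℕ, ∃ C : ℝ, ∀ j z, ‖iteratedFDeriv ℝ k (Q j) z‖ ≤ C * (1 + |(j.2 : ℝ)|) ^ k :=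
    fun k => (hQb k).imp fun _ h => h.2
  set a : ℂ → ℂ := fun z => ∑' j, conj (u j) * P j z with ha
  set H : ℂ → ℂ := fun z => ∑' j, u j * Q j z with hH
  have has : ContDiff ℝ (⊤ : ℕ∞) a := contDiff_tsum_rapid hP hPb' hrapid'
  have hHs : ContDiff ℝ (⊤ : ℕ∞) H := contDiff_tsum_rapid hQ hQb' hrapid
  set J : Finset (Fin N × ℤ) := Finset.univ ×ˢ Finset.Icc (-(n₀ : ℤ)) n₀ with hJ
  have hpJ : ∀ j ∉ J, p j = 0 := by
    intro j hj
    refine hp0 j ?_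
    by_contra hlt
    rw [not_le, abs_lt] at hlt
    refine hj ?_
    simp only [hJ, Finset.mem_product, Finset.mem_univ, true_and, Finset.mem_Icc]
    have h4 : ((-(n₀ : ℤ) : ℤ) : ℝ) < j.2 := by push_cast; exact hlt.1
    have h5 : (j.2 : ℝ) < ((n₀ : ℤ) : ℝ) := by push_cast; exact hlt.2
    exact ⟨(Int.cast_lt.1 h4).le, (Int.cast_lt.1 h5).le⟩
  set p' : ℂ → ℂ := fun z => ∑ j ∈ J, u j * p j z with hp'
  have hp'm : p' ∈ bmero Ω D := by
    have : p' = ∑ j ∈ J, u j • p j := by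
      ext z
      simp [hp']
    rw [this]
    exact Submodule.sum_mem _ fun j _ => Submodule.smul_mem _ _ (hpm j)
  have hPbd : ∀ j z, ‖P j z‖ ≤ Cp 0 := fun j z => by simpa using hCp 0 j z
  obtain ⟨CQ, hCQ0, hCQ⟩ := hQb 0
  have hQbd : ∀ j z, ‖Q j z‖ ≤ CQ := fun j z => by simpa using hCQ j z
  have hBbd : ∀ j z, ‖B j z‖ ≤ Cp 0 + CQ := fun j z =>
    (norm_add_le _ _).trans (add_le_add ((RCLike.norm_conj _).trans_le (hPbd j z)) (hQbd j z))
  have hsum : ∀ C : ℝ, Summable fun j => ‖u j‖ * C := fun C => by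
    simpa using summable_mul_pow_of_rapid hrapid C 0
  have hmaj : ∀ {G : Fin N × ℤ → ℂ → ℂ} {C : ℝ}, (∀ j z, ‖G j z‖ ≤ C) → ∀ j z,
      ‖u j * G j z‖ ≤ ‖u j‖ * C := fun hG j z => by
    rw [norm_mul]
    exact mul_le_mul_of_nonneg_left (hG j z) (norm_nonneg _)
  have hT : ∀ z, ∑' j, u j * B j z = conj (a z) + H z := by
    intro z
    rw [ha, hH, Complex.conj_tsum, ← Summable.tsum_add]
    · refine tsum_congr fun j => ?_
      simp only [hB, map_mul, Complex.conj_conj]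
      ring
    · refine Summable.of_norm_bounded (hsum (Cp 0)) fun j => ?_
      rw [RCLike.norm_conj, norm_mul, RCLike.norm_conj]
      exact mul_le_mul_of_nonneg_left (hPbd j z) (norm_nonneg _)
    · exact Summable.of_norm_bounded (hsum CQ) fun j => hmaj hQbd j z
  have hfc : ∀ i : Fin N × ℤ, fc (fun t => ∑' j, u j * B j (γ i.1 t)) i.2 =
      fc (fun t => e₀ (γ i.1 t)) i.2 + fc (fun t => p' (γ i.1 t)) i.2 := by
    intro i
    have hγc := (h.smooth i.1).continuous
    have h1 := hasSum_fc (q := fun j t => u j * B j (γ i.1 t))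
      (fun j => continuous_const.mul ((hBs j).continuous.comp hγc)) (hsum (Cp 0 + CQ))
      (fun j t => hmaj hBbd j _) i.2
    have h2 : HasSum (fun j => u j * fc (fun t => p j (γ i.1 t)) i.2)
        (fc (fun t => p' (γ i.1 t)) i.2) := by
      have h3 : fc (fun t => p' (γ i.1 t)) i.2 = ∑ j ∈ J, u j * fc (fun t => p j (γ i.1 t)) i.2 := by
        simp only [hp']
        rw [fc_finset_sum (q := fun j t => u j * p j (γ i.1 t)) J (fun j _ => continuous_const.mul (hps j i.1).continuous)]
        exact Finset.sum_congr rfl fun j _ => fc_const_mul _ _ _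
      rw [h3]
      refine hasSum_sum_of_ne_finset_zero fun j hj => ?_
      simp [hpJ j hj, fc]
    have h4 := (hsolve i).add ((hasSum_ite_eq i (u i)).add h2)
    have h5 : ∀ j, fc (fun t => u j * B j (γ i.1 t)) i.2 =
        u j * fc (fun t => R j (γ i.1 t)) i.2 + ((if j = i then u i else 0) +
          u j * fc (fun t => p j (γ i.1 t)) i.2) := by
      intro j
      have h6 : fc (fun t => R j (γ i.1 t)) i.2 =
          fc (fun t => B j (γ i.1 t) - E j (γ i.1 t)) i.2 - fc (fun t => p j (γ i.1 t)) i.2 :=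
        fc_sub (((hBs j).sub (hEs j)).continuous.comp hγc) (hps j i.1).continuous _
      rw [fc_const_mul, h6, hfcBE]
      rcases eq_or_ne i j with rfl | hij
      · simp
        ring
      · simp only [hij, hij.symm, if_false]
        ring
    simp only [← h5] at h4
    rw [h1.unique h4]
    ring
  have hTs : ∀ i, Continuous fun t => conj (a (γ i t)) + H (γ i t) := fun i =>
    (continuous_conj.comp (has.continuous.comp (h.smooth i).continuous)).add
      (hHs.continuous.comp (h.smooth i).continuous)
  have hfr : ∀ z ∈ frontier Ω, conj z - p₀ z = conj (a z) + H z - p' z := by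
    intro z hz
    rw [h.frontier_eq] at hz
    obtain ⟨i, t, rfl⟩ := mem_iUnion.1 hz
    have hp's := (h.smooth_of_mem_bmero hD hp'm i).continuous
    have h1 := eq_zero_of_fc_eq_zero (q := fun t => (conj (a (γ i t)) + H (γ i t)) -
      (e₀ (γ i t) + p' (γ i t))) ((hTs i).sub ((he₀s i).continuous.add hp's))
      (fun t => by simp only [h.periodic i t]) (fun n => by
        rw [fc_sub (q := fun t => e₀ (γ i t) + p' (γ i t)) (hTs i)
          ((he₀s i).continuous.add hp's), fc_add (he₀s i).continuous hp's,
          ← hfc (i, n)]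
        simp only [hT, sub_self]) t
    simp only [he₀] at h1
    linear_combination -h1
  refine ⟨a, has, differentiableOn_tsum_rapid h.isOpen hPΩ hPb' hrapid', fun k hk z => ?_, ?_⟩
  · refine (norm_iteratedFDeriv_tsum_rapid_le hP hPb' hrapid' k (hCp k) z).trans ?_
    have h1 : ∀ j, ‖conj (u j)‖ * (Cp k * (1 + |(j.2 : ℝ)|) ^ k) ≤ C₂ * ‖y j‖ := by
      intro j
      have h2 : Cp k ≤ C₂ := Finset.single_le_sum (fun k _ => hCp0 k)
        (Finset.mem_range.2 (Nat.lt_succ_of_le hk))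
      have h3 : ‖u j‖ * W j = ‖y j‖ := by
        rw [hu, norm_mul, norm_inv, norm_weight, inv_mul_eq_div]
        exact div_mul_cancel₀ _ (zero_lt_one.trans_le (hW1 j)).ne'
      rw [RCLike.norm_conj, ← h3]
      calc _ ≤ ‖u j‖ * (C₂ * W j) := by
            gcongr
            exact pow_le_pow_right₀ (by linarith [abs_nonneg (j.2 : ℝ)]) hk
        _ = _ := by ring
    have h4 := Summable.tsum_le_tsum h1 (summable_mul_pow_of_rapid hrapid' (Cp k) k)
      ((summable_norm_coeffSpace y).mul_left C₂)
    rw [tsum_mul_left, ← norm_coeffSpace] at h4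
    calc _ ≤ C₂ * ‖y‖ := h4
      _ ≤ C₂ * (2 * (δ / (2 * (C₂ + 1)))) := by
          gcongr
          linarith
      _ = C₂ / (C₂ + 1) * δ := by field_simp
      _ ≤ 1 * δ := by
          gcongr
          rw [div_le_one (by linarith)]
          linarith
      _ = δ := one_mul δ
  · refine bmero_congr (Submodule.sub_mem _ (Submodule.add_mem _ hp₀ (mem_bmero_of_contDiff hHs
      (differentiableOn_tsum_rapid h.isOpen hQΩ hQb' hrapid))) hp'm) fun z hz => ?_
    simp only [map_sub, Pi.add_apply, Pi.sub_apply]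
    linear_combination hfr z hz

end Collars

theorem norm_dbar_le (f : ℂ → ℂ) (z : ℂ) : ‖dbar f z‖ ≤ ‖fderiv ℝ f z‖ := by
  rw [dbar_def, norm_smul]
  have h1 := (fderiv ℝ f z).le_opNorm 1
  have h2 := (fderiv ℝ f z).le_opNorm I
  have h3 : ‖I • fderiv ℝ f z I‖ = ‖fderiv ℝ f z I‖ := by rw [norm_smul, norm_I, one_mul]
  have h4 := norm_add_le (fderiv ℝ f z 1) (I • fderiv ℝ f z I)
  rw [norm_one, mul_one] at h1
  rw [norm_I, mul_one] at h2
  rw [norm_div, norm_one, Complex.norm_ofNat]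
  linarith

theorem continuous_dbar {f : ℂ → ℂ} (hf : ContDiff ℝ 1 f) : Continuous (dbar f) :=
  dbarL.continuous.comp (hf.continuous_fderiv one_ne_zero)

theorem dbar_const (c z : ℂ) : dbar (fun _ => c) z = 0 :=
  dbar_eq_zero_of_differentiableAt (differentiableAt_const c)

theorem dbar_conj {g : ℂ → ℂ} {z : ℂ} (hg : DifferentiableAt ℂ g z) :
    dbar (fun z => conj (g z)) z = conj (deriv g z) := by
  have h : HasFDerivAt (fun z => conj (g z))
      ((conjCLE : ℂ →L[ℝ] ℂ).comp (deriv g z • (1 : ℂ →L[ℝ] ℂ))) z :=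
    (conjCLE : ℂ →L[ℝ] ℂ).hasFDerivAt.comp z hg.hasDerivAt.complexToReal_fderiv
  rw [dbar_def, h.fderiv]
  simp
  linear_combination (-(1 / 2 : ℂ) * conj (deriv g z)) * I_sq

theorem exists_abs_deriv_smoothTransition_le :
    ∃ C : ℝ, 0 ≤ C ∧ ∀ x, -1 ≤ x → |deriv Real.smoothTransition x| ≤ C ∧
      (1 < x → deriv Real.smoothTransition x = 0) := by
  have hd : Continuous (deriv Real.smoothTransition) :=
    (Real.smoothTransition.contDiff (n := 1)).continuous_deriv le_rfl
  obtain ⟨C, hC⟩ := (isCompact_Icc (a := (-1 : ℝ)) (b := 1)).exists_bound_of_continuousOn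
    hd.continuousOn
  have h0 : ∀ x : ℝ, 1 < x → deriv Real.smoothTransition x = 0 := by
    intro x hx
    have : Real.smoothTransition =ᶠ[nhds x] fun _ => 1 := by
      filter_upwards [Ioi_mem_nhds hx] with y hy
      exact Real.smoothTransition.one_of_one_le (le_of_lt hy)
    rw [this.deriv_eq, deriv_const]
  have hC0 : 0 ≤ C := (norm_nonneg _).trans (hC 0 (by simp))
  refine ⟨C, hC0, fun x hx => ⟨?_, h0 x⟩⟩
  rcases le_or_gt x 1 with h1 | h1
  · exact hC x ⟨hx, h1⟩
  · rw [h0 x h1, abs_zero]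
    exact hC0

/-- Cutoff functions exhausting `Ω` and adapted to a function vanishing on the boundary. -/
theorem exists_cutoff {Ω : Set ℂ} (hΩ : IsOpen Ω) (hb : Bornology.IsBounded Ω) {w : ℂ → ℂ}
    (hw : ContDiff ℝ 1 w) (hw0 : ∀ z ∈ frontier Ω, w z = 0) :
    ∃ (ψ : ℕ → ℂ → ℂ) (C : ℝ), (∀ n, ContDiff ℝ 1 (ψ n)) ∧
      (∀ n, ∃ K, IsCompact K ∧ K ⊆ Ω ∧ ∀ z ∈ Ω \ K, ψ n z = 0) ∧ (∀ n z, ‖ψ n z‖ ≤ 1) ∧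
      (∀ n, ∀ z ∈ Ω, ‖w z * dbar (ψ n) z‖ ≤ C) ∧
      ∀ z ∈ Ω, ∀ᶠ n in Filter.atTop, ψ n =ᶠ[nhds z] fun _ => 1 := by
  obtain ⟨v, hvs, hv, -⟩ := hΩ.exists_contDiff_support_eq (n := 1)
  replace hv : ContDiff ℝ 1 v := hv
  have hK := hb.isCompact_closure
  have hv0 : ∀ z ∈ frontier Ω, v z = 0 := fun z hz =>
    Function.notMem_support.1 (hvs ▸ (hΩ.frontier_eq ▸ hz).2)
  obtain ⟨M₁, hM₁⟩ := hK.exists_bound_of_continuousOn (hw.continuous_fderiv one_ne_zero).continuousOn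
  obtain ⟨M₂, hM₂⟩ := hK.exists_bound_of_continuousOn (hv.continuous_fderiv one_ne_zero).continuousOn
  obtain ⟨C, hC0, hC⟩ := exists_abs_deriv_smoothTransition_le
  set q : ℂ → ℝ := fun z => ‖w z‖ ^ 2 + ‖v z‖ ^ 2 with hq
  have hqs : ContDiff ℝ 1 q := (hw.norm_sq ℝ).add (hv.norm_sq ℝ)
  have hq0 : ∀ z, 0 ≤ q z := fun z => by positivity
  set M : ℝ := max M₁ M₂ with hM
  have hψs : ∀ n : ℕ, ContDiff ℝ 1 fun z => Real.smoothTransition (n * q z - 1) := fun n =>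
    Real.smoothTransition.contDiff.comp ((contDiff_const.mul hqs).sub contDiff_const)
  refine ⟨fun n z => (Real.smoothTransition (n * q z - 1) : ℂ), C * (8 * M), fun n =>
    ofRealCLM.contDiff.comp (hψs n), fun n => ?_, fun n z => ?_, fun n z hz => ?_, fun z hz => ?_⟩
  · refine ⟨closure Ω ∩ {z | 1 ≤ n * q z}, hK.inter_right (isClosed_le continuous_const
      (continuous_const.mul hqs.continuous)), fun z hz => ?_, fun z hz => ?_⟩
    · by_contra hzΩ
      have hzf : z ∈ frontier Ω := hΩ.frontier_eq ▸ ⟨hz.1, hzΩ⟩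
      have h1 : q z = 0 := by simp [hq, hw0 z hzf, hv0 z hzf]
      have h2 : 1 ≤ n * q z := hz.2
      rw [h1] at h2
      linarith
    · have h1 : ¬ 1 ≤ n * q z := fun h => hz.2 ⟨subset_closure hz.1, h⟩
      simp only [Real.smoothTransition.zero_of_nonpos (x := n * q z - 1) (by linarith),
        ofReal_zero]
  · rw [norm_real, Real.norm_of_nonneg (Real.smoothTransition.nonneg _)]
    exact Real.smoothTransition.le_one _
  · have hn0 : (0 : ℝ) ≤ n := n.cast_nonneg
    have hM₁' : ‖fderiv ℝ w z‖ ≤ M := (hM₁ z (subset_closure hz)).trans (le_max_left _ _)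
    have hM₂' : ‖fderiv ℝ v z‖ ≤ M := (hM₂ z (subset_closure hz)).trans (le_max_right _ _)
    have hM0 : 0 ≤ M := (norm_nonneg _).trans hM₁'
    set q' : ℂ →L[ℝ] ℝ := fderiv ℝ q z with hq'
    have hq'n : ‖q'‖ ≤ 2 * M * (‖w z‖ + ‖v z‖) := by
      have h1 := ((hw.differentiable one_ne_zero z).hasFDerivAt.norm_sq).add
        ((hv.differentiable one_ne_zero z).hasFDerivAt.norm_sq)
      have h2 : q' = _ := h1.fderiv
      rw [h2]
      refine (norm_add_le _ _).trans ?_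
      have h3 : ∀ {F : Type} [NormedAddCommGroup F] [InnerProductSpace ℝ F] (x : F) (L : ℂ →L[ℝ] F),
          ‖L‖ ≤ M → ‖2 • (innerSL ℝ x) ∘SL L‖ ≤ 2 * M * ‖x‖ := by
        intro F _ _ x L hL
        refine (norm_nsmul_le).trans ?_
        have h4 := (innerSL ℝ x).opNorm_comp_le L
        rw [innerSL_apply_norm] at h4
        have h5 : ‖x‖ * ‖L‖ ≤ ‖x‖ * M := by gcongr
        simp only [Nat.cast_ofNat]
        linarith
      have h4 := h3 (w z) _ hM₁'
      have h5 := h3 (v z) _ hM₂'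
      linarith
    have hT : HasDerivAt Real.smoothTransition (deriv Real.smoothTransition (n * q z - 1))
        (n * q z - 1) := (Real.smoothTransition.contDiff.differentiable (n := 1) one_ne_zero
          _).hasDerivAt
    have hTq := hT.comp_hasFDerivAt z
      (((hqs.differentiable one_ne_zero z).hasFDerivAt.const_mul (n : ℝ)).sub_const 1)
    have hψ' : HasFDerivAt (fun z => (Real.smoothTransition (n * q z - 1) : ℂ))
        (ofRealCLM.comp (deriv Real.smoothTransition (n * q z - 1) • ((n : ℝ) • q'))) z :=
      ofRealCLM.hasFDerivAt.comp z hTq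
    have h1 : ‖dbar (fun z => (Real.smoothTransition (n * q z - 1) : ℂ)) z‖ ≤
        |deriv Real.smoothTransition (n * q z - 1)| * (n * ‖q'‖) := by
      refine (norm_dbar_le _ _).trans ?_
      rw [hψ'.fderiv]
      refine (ContinuousLinearMap.opNorm_comp_le _ _).trans ?_
      rw [ofRealCLM_norm, one_mul, norm_smul, norm_smul, Real.norm_eq_abs, Real.norm_eq_abs,
        Nat.abs_cast]
    have hx : -1 ≤ n * q z - 1 := by
      have := mul_nonneg hn0 (hq0 z)
      linarith
    obtain ⟨h2, h3⟩ := hC _ hx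
    rw [norm_mul]
    rcases lt_or_ge 1 (n * q z - 1) with h4 | h4
    · rw [h3 h4, abs_zero, zero_mul] at h1
      calc _ ≤ ‖w z‖ * 0 := by gcongr
        _ ≤ _ := by
          rw [mul_zero]
          positivity
    · calc _ ≤ ‖w z‖ * (C * (n * (2 * M * (‖w z‖ + ‖v z‖)))) := by
            refine mul_le_mul_of_nonneg_left (h1.trans ?_) (norm_nonneg _)
            gcongr
        _ = C * (2 * M) * (n * (‖w z‖ * (‖w z‖ + ‖v z‖))) := by ring
        _ ≤ C * (2 * M) * (n * (2 * q z)) := by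
            have h5 : ‖w z‖ * (‖w z‖ + ‖v z‖) ≤ 2 * q z := by
              simp only [hq]
              nlinarith [sq_nonneg (‖w z‖ - ‖v z‖), sq_nonneg (‖v z‖)]
            exact mul_le_mul_of_nonneg_left (mul_le_mul_of_nonneg_left h5 hn0) (by positivity)
        _ = C * (2 * M) * (2 * (n * q z)) := by ring
        _ ≤ C * (2 * M) * (2 * 2) := by
            gcongr
            linarith
        _ = _ := by ring
  · have hqz : 0 < q z := by
      have h1 : v z ≠ 0 := Function.mem_support.1 (hvs ▸ hz)
      have h2 : 0 < ‖v z‖ ^ 2 := by positivity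
      simp only [hq]
      positivity
    filter_upwards [Filter.tendsto_atTop.1 (tendsto_natCast_atTop_atTop (R := ℝ)) (4 / q z)]
      with n hn
    have h1 : 2 < n * q z := by
      have := (div_le_iff₀ hqz).1 hn
      linarith
    filter_upwards [(continuous_const.mul hqs.continuous).continuousAt.eventually
      (lt_mem_nhds h1)] with y hy
    replace hy : 2 < n * q y := hy
    rw [Real.smoothTransition.one_of_one_le (by linarith), ofReal_one]

theorem indicator_eventuallyEq_zero {Ω K : Set ℂ} (hK : IsCompact K) (hKΩ : K ⊆ Ω) {f : ℂ → ℂ}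
    (hf : ∀ z ∈ Ω \ K, f z = 0) {z : ℂ} (hz : z ∉ Ω) : Ω.indicator f =ᶠ[nhds z] fun _ => 0 := by
  filter_upwards [hK.isClosed.isOpen_compl.mem_nhds fun h => hz (hKΩ h)] with y hy
  by_cases hyΩ : y ∈ Ω
  · rw [indicator_of_mem hyΩ, hf y ⟨hyΩ, hy⟩]
  · rw [indicator_of_notMem hyΩ]

theorem indicator_eventuallyEq_self {Ω : Set ℂ} (hΩ : IsOpen Ω) {f : ℂ → ℂ} {z : ℂ}
    (hz : z ∈ Ω) : Ω.indicator f =ᶠ[nhds z] f := by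
  filter_upwards [hΩ.mem_nhds hz] with y hy
  rw [indicator_of_mem hy]

theorem contDiff_one_indicator {Ω K : Set ℂ} (hΩ : IsOpen Ω) (hK : IsCompact K) (hKΩ : K ⊆ Ω)
    {f : ℂ → ℂ} (hfs : ContDiffOn ℝ 1 f Ω) (hf : ∀ z ∈ Ω \ K, f z = 0) :
    ContDiff ℝ 1 (Ω.indicator f) := by
  refine contDiff_iff_contDiffAt.2 fun z => ?_
  by_cases hz : z ∈ Ω
  · exact (hfs.contDiffAt (hΩ.mem_nhds hz)).congr_of_eventuallyEq (indicator_eventuallyEq_self hΩ hz)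
  · exact contDiffAt_const.congr_of_eventuallyEq (indicator_eventuallyEq_zero hK hKΩ hf hz)

theorem hasCompactSupport_indicator {Ω K : Set ℂ} (hK : IsCompact K)
    {f : ℂ → ℂ} (hf : ∀ z ∈ Ω \ K, f z = 0) : HasCompactSupport (Ω.indicator f) := by
  refine HasCompactSupport.intro hK fun z hz => ?_
  by_cases hzΩ : z ∈ Ω
  · rw [indicator_of_mem hzΩ, hf z ⟨hzΩ, hz⟩]
  · rw [indicator_of_notMem hzΩ]

theorem dbar_indicator {Ω K : Set ℂ} (hΩ : IsOpen Ω) (hK : IsCompact K) (hKΩ : K ⊆ Ω)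
    {f : ℂ → ℂ} (hf : ∀ z ∈ Ω \ K, f z = 0) :
    dbar (Ω.indicator f) = Ω.indicator (dbar f) := by
  funext z
  by_cases hz : z ∈ Ω
  · rw [dbar_congr (indicator_eventuallyEq_self hΩ hz), indicator_of_mem hz]
  · rw [dbar_congr (indicator_eventuallyEq_zero hK hKΩ hf hz), dbar_const, indicator_of_notMem hz]

theorem contDiffOn_real_of_differentiableOn {Ω : Set ℂ} (hΩ : IsOpen Ω) {F : ℂ → ℂ}
    (hF : DifferentiableOn ℂ F Ω) : ContDiffOn ℝ 1 F Ω :=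
  (hF.contDiffOn (n := 1) hΩ).restrict_scalars ℝ

/-- A form of Green's theorem for integrable holomorphic functions: no boundary term appears
against a function vanishing on the boundary. -/
theorem setIntegral_mul_dbar_eq_zero {Ω : Set ℂ} (hΩ : IsOpen Ω) (hb : Bornology.IsBounded Ω)
    {w : ℂ → ℂ} (hw : ContDiff ℝ 1 w) (hw0 : ∀ z ∈ frontier Ω, w z = 0) {F : ℂ → ℂ}
    (hF : DifferentiableOn ℂ F Ω) (hFi : IntegrableOn F Ω) :
    ∫ z in Ω, F z * dbar w z = 0 := by
  obtain ⟨ψ, C, hψ, hψK, hψ1, hψC, hψe⟩ := exists_cutoff hΩ hb hw hw0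
  obtain ⟨M, hM⟩ := hb.isCompact_closure.exists_bound_of_continuousOn (continuous_dbar hw).continuousOn
  have hd : ∀ n, ∀ z ∈ Ω, dbar (fun z => F z * (ψ n z * w z)) z =
      F z * (ψ n z * dbar w z + w z * dbar (ψ n) z) := by
    intro n z hz
    have hFz := hF.differentiableAt (hΩ.mem_nhds hz)
    have h1 := (hψ n).differentiable one_ne_zero z
    have h2 := hw.differentiable one_ne_zero z
    rw [dbar_mul (g := fun z => ψ n z * w z) (hFz.restrictScalars ℝ) (h1.mul h2), dbar_mul h1 h2,
      dbar_eq_zero_of_differentiableAt hFz]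
    ring
  have hzero : ∀ n, ∫ z in Ω, F z * (ψ n z * dbar w z + w z * dbar (ψ n) z) = 0 := by
    intro n
    obtain ⟨K, hK, hKΩ, hψ0⟩ := hψK n
    have h0 : ∀ z ∈ Ω \ K, F z * (ψ n z * w z) = 0 := fun z hz => by
      rw [hψ0 z hz, zero_mul, mul_zero]
    have h1 := integral_dbar (contDiff_one_indicator hΩ hK hKΩ
      ((contDiffOn_real_of_differentiableOn hΩ hF).mul ((hψ n).mul hw).contDiffOn) h0)
      (hasCompactSupport_indicator hK h0)
    rw [dbar_indicator hΩ hK hKΩ h0, integral_indicator hΩ.measurableSet] at h1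
    rw [← h1]
    exact setIntegral_congr_fun hΩ.measurableSet fun z hz => (hd n z hz).symm
  have hlim := tendsto_integral_of_dominated_convergence (μ := volume.restrict Ω)
    (F := fun n z => F z * (ψ n z * dbar w z + w z * dbar (ψ n) z))
    (f := fun z => F z * dbar w z) (fun z => ‖F z‖ * (M + C))
    (fun n => hFi.aestronglyMeasurable.mul (((hψ n).continuous.mul (continuous_dbar hw)).add
      (hw.continuous.mul (continuous_dbar (hψ n)))).aestronglyMeasurable)
    (hFi.norm.mul_const _)
    (fun n => (ae_restrict_iff' hΩ.measurableSet).2 (.of_forall fun z hz => by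
      rw [norm_mul]
      refine mul_le_mul_of_nonneg_left ((norm_add_le _ _).trans (add_le_add ?_ (hψC n z hz)))
        (norm_nonneg _)
      rw [norm_mul]
      exact (mul_le_of_le_one_left (norm_nonneg _) (hψ1 n z)).trans (hM z (subset_closure hz))))
    ((ae_restrict_iff' hΩ.measurableSet).2 (.of_forall fun z hz => by
      refine tendsto_const_nhds.congr' ?_
      filter_upwards [hψe z hz] with n hn
      rw [dbar_congr hn, dbar_const, hn.eq_of_nhds]
      ring))
  simp only [hzero] at hlim
  exact (tendsto_nhds_unique tendsto_const_nhds hlim).symm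

/-- A smooth function equal to `(z - ζ)⁻¹` wherever `χ` vanishes. -/
def cutInv (χ : ℂ → ℂ) (ζ z : ℂ) : ℂ := (1 - χ z) * (z - ζ)⁻¹

theorem cutInv_eventuallyEq_zero {χ : ℂ → ℂ} {ζ : ℂ} (h : ∀ᶠ w in nhds ζ, χ w = 1) :
    cutInv χ ζ =ᶠ[nhds ζ] fun _ => 0 := by
  filter_upwards [h] with w hw
  rw [cutInv, hw, sub_self, zero_mul]

theorem contDiff_cutInv {χ : ℂ → ℂ} (hχ : ContDiff ℝ (⊤ : ℕ∞) χ) {ζ : ℂ}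
    (h : ∀ᶠ w in nhds ζ, χ w = 1) : ContDiff ℝ 1 (cutInv χ ζ) := by
  refine contDiff_iff_contDiffAt.2 fun z => ?_
  rcases eq_or_ne z ζ with rfl | hz
  · exact contDiffAt_const.congr_of_eventuallyEq (cutInv_eventuallyEq_zero h)
  · exact (contDiffAt_const.sub (hχ.contDiffAt.of_le (by exact_mod_cast le_top))).mul
      ((contDiffAt_id.sub contDiffAt_const).inv (sub_ne_zero.2 hz))

theorem dbar_cutInv {χ : ℂ → ℂ} (hχ : ContDiff ℝ (⊤ : ℕ∞) χ) {ζ : ℂ}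
    (h : ∀ᶠ w in nhds ζ, χ w = 1) (z : ℂ) :
    dbar (cutInv χ ζ) z = (ζ - z)⁻¹ * dbar χ z := by
  rcases eq_or_ne z ζ with rfl | hz
  · rw [dbar_congr (cutInv_eventuallyEq_zero h), dbar_const, sub_self, inv_zero, zero_mul]
  · have h1 : DifferentiableAt ℂ (fun z => (z - ζ)⁻¹) z :=
      (differentiableAt_id.sub_const ζ).inv (sub_ne_zero.2 hz)
    have hχd : DifferentiableAt ℝ χ z := hχ.differentiable (by simp) z
    have h2 : dbar (cutInv χ ζ) z = _ :=
      dbar_mul (f := fun z => 1 - χ z) (hχd.const_sub 1) (h1.restrictScalars ℝ)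
    rw [h2, dbar_eq_zero_of_differentiableAt h1, dbar_sub (differentiableAt_const _) hχd, dbar_const,
      ← neg_sub z ζ, inv_neg]
    ring

theorem setIntegral_mul_dbar_cutInv {Ω : Set ℂ} (hΩ : IsOpen Ω) {F : ℂ → ℂ}
    (hF : DifferentiableOn ℂ F Ω) {χ : ℂ → ℂ} (hχ : Adm Ω ∅ χ) {ζ : ℂ} (hζ : ζ ∈ Ω)
    (h : ∀ᶠ w in nhds ζ, χ w = 1) :
    ∫ z in Ω, F z * dbar (cutInv χ ζ) z = Real.pi * F ζ := by
  have hχ0 : ∀ z ∈ Ω \ tsupport χ, χ z * F z = 0 := fun z hz => by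
    rw [image_eq_zero_of_notMem_tsupport hz.2, zero_mul]
  have hχ1 : ContDiff ℝ 1 χ := hχ.contDiff.of_le (by exact_mod_cast le_top)
  have h1 := cauchyT_dbar (contDiff_one_indicator hΩ hχ.compact hχ.subset
    (hχ1.contDiffOn.mul (contDiffOn_real_of_differentiableOn hΩ hF)) hχ0)
    (hasCompactSupport_indicator hχ.compact hχ0) ζ
  rw [indicator_of_mem hζ, h.self_of_nhds, one_mul, cauchyT_eq,
    dbar_indicator hΩ hχ.compact hχ.subset hχ0] at h1
  have h2 : (fun z => (ζ - z)⁻¹ • Ω.indicator (dbar fun z => χ z * F z) z) =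
      Ω.indicator fun z => F z * dbar (cutInv χ ζ) z := by
    funext z
    by_cases hz : z ∈ Ω
    · have hFz := hF.differentiableAt (hΩ.mem_nhds hz)
      rw [indicator_of_mem hz, indicator_of_mem hz, dbar_cutInv hχ.contDiff h,
        dbar_mul (hχ1.differentiable one_ne_zero z) (hFz.restrictScalars ℝ),
        dbar_eq_zero_of_differentiableAt hFz, smul_eq_mul]
      ring
    · rw [indicator_of_notMem hz, indicator_of_notMem hz, smul_zero]
  rw [h2, integral_indicator hΩ.measurableSet] at h1
  rw [← h1, smul_eq_mul, ← mul_assoc, mul_one_div_cancel (ofReal_ne_zero.2 Real.pi_ne_zero), one_mul]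

theorem integrableOn_mul_of_bounded {Ω : Set ℂ} (hb : Bornology.IsBounded Ω) {F u : ℂ → ℂ}
    (hΩ : MeasurableSet Ω) (hF : IntegrableOn F Ω) (hu : Continuous u) :
    IntegrableOn (fun z => F z * u z) Ω := by
  obtain ⟨M, hM⟩ := hb.isCompact_closure.exists_bound_of_continuousOn hu.continuousOn
  exact hF.mul_bdd (c := M) hu.aestronglyMeasurable
    ((ae_restrict_iff' hΩ).2 (.of_forall fun z hz => hM z (subset_closure hz)))

/-- Integration against the conjugate derivative of a map whose conjugate is meromorphic on the
boundary reduces to point evaluations. -/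
theorem exists_setIntegral_mul_conj_deriv {Ω D : Set ℂ} (hΩ : IsOpen Ω)
    (hb : Bornology.IsBounded Ω) (hD : D ⊆ Ω) {g : ℂ → ℂ} (hg : ContDiff ℝ (⊤ : ℕ∞) g)
    (hgΩ : DifferentiableOn ℂ g Ω) (hgm : (fun z => conj (g z)) ∈ bmero Ω D) :
    ∃ c : ℂ →₀ ℂ, (c.support : Set ℂ) ⊆ D ∧ ∀ F : ℂ → ℂ, DifferentiableOn ℂ F Ω →
      IntegrableOn F Ω →
      ∫ z in Ω, F z * conj (deriv g z) = ∑ ζ ∈ c.support, c ζ * (Real.pi * F ζ) := by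
  obtain ⟨h, c, hh, hhΩ, hc, hgc⟩ := hgm
  obtain ⟨χ, hχ, hχ1, -⟩ := exists_bump c.support.finite_toSet.isCompact hΩ (hc.trans hD)
  set s : ℂ → ℂ := fun z => ∑ ζ ∈ c.support, c ζ * cutInv χ ζ z with hs
  set w : ℂ → ℂ := fun z => conj (g z) - h z - s z with hw
  have hcut : ∀ ζ ∈ c.support, ContDiff ℝ 1 (cutInv χ ζ) := fun ζ hζ =>
    contDiff_cutInv hχ.contDiff (hχ1 ζ hζ)
  have hss : ContDiff ℝ 1 s := ContDiff.sum fun ζ hζ => contDiff_const.mul (hcut ζ hζ)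
  have hg1 : ContDiff ℝ 1 fun z => conj (g z) :=
    (conjCLE.contDiff.comp hg).of_le (by exact_mod_cast le_top)
  have hh1 : ContDiff ℝ 1 h := hh.of_le (by exact_mod_cast le_top)
  have hws : ContDiff ℝ 1 w := (hg1.sub hh1).sub hss
  have hw0 : ∀ z ∈ frontier Ω, w z = 0 := by
    intro z hz
    have hχz : χ z = 0 := image_eq_zero_of_notMem_tsupport fun hz' =>
      (hΩ.frontier_eq ▸ hz).2 (hχ.subset hz')
    simp only [hw, hs, hgc z hz, cutInv, hχz, sub_zero, one_mul, Finsupp.sum]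
    ring
  refine ⟨c, hc, fun F hF hFi => ?_⟩
  have hdb : ∀ z ∈ Ω, F z * conj (deriv g z) =
      F z * dbar w z + ∑ ζ ∈ c.support, c ζ * (F z * dbar (cutInv χ ζ) z) := by
    intro z hz
    have h1 := hg1.differentiable one_ne_zero z
    have h2 := hh1.differentiable one_ne_zero z
    have h3 := hss.differentiable one_ne_zero z
    have h4 : dbar s z = ∑ ζ ∈ c.support, c ζ * dbar (cutInv χ ζ) z := by
      have h5 : HasFDerivAt s (∑ ζ ∈ c.support, c ζ • fderiv ℝ (cutInv χ ζ) z) z :=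
        HasFDerivAt.fun_sum fun ζ hζ =>
          ((hcut ζ hζ).differentiable one_ne_zero z).hasFDerivAt.const_mul (c ζ)
      rw [dbar_eq_comp, Function.comp_apply, h5.fderiv, map_sum]
      refine Finset.sum_congr rfl fun ζ _ => ?_
      rw [dbar_def, dbarL_apply]
      simp only [FunLike.coe_smul, Pi.smul_apply, smul_eq_mul]
      ring
    have h6 : dbar w z = conj (deriv g z) - dbar h z - dbar s z := by
      rw [← dbar_conj (hgΩ.differentiableAt (hΩ.mem_nhds hz)), ← dbar_sub h1 h2]
      exact dbar_sub (h1.sub h2) h3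
    rw [h6, dbar_eq_zero_of_differentiableAt (hhΩ.differentiableAt (hΩ.mem_nhds hz)), h4, mul_sub,
      Finset.mul_sum]
    simp only [mul_left_comm (F z)]
    ring
  rw [setIntegral_congr_fun hΩ.measurableSet hdb, integral_add
    (integrableOn_mul_of_bounded hb hΩ.measurableSet hFi (continuous_dbar hws))
    (integrable_finsetSum _ fun ζ hζ => (integrableOn_mul_of_bounded hb hΩ.measurableSet hFi
      (continuous_dbar (hcut ζ hζ))).const_mul _),
    setIntegral_mul_dbar_eq_zero hΩ hb hws hw0 hF hFi, zero_add, integral_finsetSum _ fun ζ hζ =>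
      (integrableOn_mul_of_bounded hb hΩ.measurableSet hFi
      (continuous_dbar (hcut ζ hζ))).const_mul _]
  refine Finset.sum_congr rfl fun ζ hζ => ?_
  rw [integral_const_mul, setIntegral_mul_dbar_cutInv hΩ hF hχ (hD (hc hζ)) (hχ1 ζ hζ)]

theorem abs_det_smul_one (a : ℂ) :
    |(a • (1 : ℂ →L[ℝ] ℂ)).det| = ‖a‖ ^ 2 := by
  rw [← Complex.normSq_eq_norm_sq]
  have h : ((a • (1 : ℂ →L[ℝ] ℂ) : ℂ →L[ℝ] ℂ) : ℂ →ₗ[ℝ] ℂ) = LinearMap.mul ℝ ℂ a := by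
    ext
    simp
  rw [ContinuousLinearMap.det, h]
  have h2 := Algebra.norm_complex_apply a
  rw [Algebra.norm_apply] at h2
  rw [← h2, abs_of_nonneg]
  · rfl
  · change 0 ≤ LinearMap.det (Algebra.lmul ℝ ℂ a)
    rw [h2]; exact normSq_nonneg a

/-- Pulling back an integral by an injective holomorphic map. -/
theorem setIntegral_image_eq {Ω : Set ℂ} (hΩ : IsOpen Ω) {g : ℂ → ℂ}
    (hg : DifferentiableOn ℂ g Ω) (hinj : InjOn g Ω) (f : ℂ → ℂ) :
    ∫ z in g '' Ω, f z = ∫ z in Ω, f (g z) * deriv g z * conj (deriv g z) := by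
  rw [integral_image_eq_integral_abs_det_fderiv_smul volume hΩ.measurableSet
    (fun z hz => ((hg.differentiableAt (hΩ.mem_nhds hz)).hasDerivAt.complexToReal_fderiv).hasFDerivWithinAt)
    hinj f]
  refine setIntegral_congr_fun hΩ.measurableSet fun z _ => ?_
  simp only [abs_det_smul_one]
  rw [mul_assoc, mul_conj, normSq_eq_norm_sq, real_smul]
  ring

theorem integrableOn_comp_mul_deriv {Ω : Set ℂ} (hΩ : IsOpen Ω) (hb : Bornology.IsBounded Ω)
    {g : ℂ → ℂ} (hg : DifferentiableOn ℂ g Ω) (hinj : InjOn g Ω) {f : ℂ → ℂ}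
    (hf : DifferentiableOn ℂ f (g '' Ω)) (hi : IntegrableOn (fun z => ‖f z‖ ^ 2) (g '' Ω)) :
    DifferentiableOn ℂ (fun z => f (g z) * deriv g z) Ω ∧
      IntegrableOn (fun z => f (g z) * deriv g z) Ω := by
  have hd : DifferentiableOn ℂ (fun z => f (g z) * deriv g z) Ω :=
    (hf.comp hg (mapsTo_image g Ω)).mul (hg.deriv hΩ)
  refine ⟨hd, ?_⟩
  rw [integrableOn_image_iff_integrableOn_abs_det_fderiv_smul volume hΩ.measurableSet
    (fun z hz => ((hg.differentiableAt (hΩ.mem_nhds hz)).hasDerivAt.complexToReal_fderiv).hasFDerivWithinAt)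
    hinj] at hi
  have h1 : IntegrableOn (fun _ => (1 : ℝ)) Ω :=
    integrableOn_const hb.measure_lt_top.ne
  refine Integrable.mono' (h1.add hi) (hd.continuousOn.aestronglyMeasurable hΩ.measurableSet)
    (.of_forall fun z => ?_)
  simp only [Pi.add_apply, abs_det_smul_one, smul_eq_mul, norm_mul]
  nlinarith [sq_nonneg (‖f (g z)‖ * ‖deriv g z‖ - 1), sq_nonneg (‖f (g z)‖ * ‖deriv g z‖)]

theorem exists_fin_sum_eq (s : Finset ℂ) (hs : s.Nonempty) :
    ∃ N : ℕ, 0 < N ∧ ∃ v : Fin N → ℂ, (∀ j, v j ∈ s) ∧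
      ∀ F : ℂ → ℂ, ∑ ζ ∈ s, F ζ = ∑ j, F (v j) := by
  refine ⟨s.card, hs.card_pos, fun j => s.equivFin.symm j, fun j => (s.equivFin.symm j).2,
    fun F => ?_⟩
  rw [← Finset.sum_coe_sort s]
  exact (Equiv.sum_comp s.equivFin.symm fun x : s => F x).symm

theorem lipschitzWith_half_of_iteratedFDeriv {a : ℂ → ℂ} (ha : ContDiff ℝ (⊤ : ℕ∞) a)
    (h : ∀ z, ‖iteratedFDeriv ℝ 1 a z‖ ≤ 1 / 2) (z w : ℂ) : ‖a z - a w‖ ≤ 1 / 2 * ‖z - w‖ := by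
  refine Convex.norm_image_sub_le_of_norm_fderiv_le (𝕜 := ℝ) (s := univ)
    (fun x _ => ha.differentiable (by simp) x) (fun x _ => ?_) convex_univ (mem_univ w) (mem_univ z)
  rw [← norm_iteratedFDeriv_one]
  exact h x

/-- every smoothly bounded domain admits, for each `m` and `δ > 0`, a
holomorphic map `g`, smooth and injective on the closure and `(m, δ)`-close to the identity,
such that `g(Ω)` is a quadrature domain whose quadrature identity uses only simple point
evaluations at points of a prescribed disc `B(w₀, ε)` compactly contained in `Ω`. -/
theorem stmt_12 (Ω : Set ℂ) (hΩo : IsOpen Ω) (hΩc : IsConnected Ω)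
    (hsm : HasSmoothBoundary Ω)
    (w₀ : ℂ) (ε : ℝ) (hε : 0 < ε) (hD : closure (ball w₀ ε) ⊆ Ω)
    (m : ℕ) (δ : ℝ) (hδ : 0 < δ) :
    ∃ g : ℂ → ℂ,
      (∃ U : Set ℂ, IsOpen U ∧ closure Ω ⊆ U ∧ ContDiffOn ℝ (⊤ : ℕ∞) g U) ∧
      DifferentiableOn ℂ g Ω ∧ InjOn g (closure Ω) ∧ CloseToId Ω m δ g ∧
      ∃ N : ℕ, 0 < N ∧ ∃ (w : Fin N → ℂ) (c : Fin N → ℂ),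
        (∀ j, w j ∈ ball w₀ ε ∩ g '' Ω) ∧
        ∀ f : ℂ → ℂ, BergmanFun (g '' Ω) f →
          (∫ z in g '' Ω, f z) = ∑ j, c j * f (w j) := by

  have hΩb : Bornology.IsBounded Ω := hsm.1
  obtain ⟨N, γ, V, Z, χ, hC⟩ := exists_collars hΩo hΩc hsm
  have hε2 : 0 < ε / 2 := half_pos hε
  have hsub : ball w₀ (ε / 2) ⊆ Ω :=
    (ball_subset_ball (by linarith)).trans (subset_closure.trans hD)
  obtain ⟨a, ha, haΩ, hak, ham⟩ := hC.exists_small_correction isOpen_ball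
    (nonempty_ball.2 hε2) hsub (max m 1)
    (show 0 < min δ (min (ε / 4) (1 / 2)) from lt_min hδ (lt_min (by linarith) (by norm_num)))
  set g : ℂ → ℂ := fun z => z - a z with hgdef
  have hg : ContDiff ℝ (⊤ : ℕ∞) g := contDiff_id.sub ha
  have hgΩ : DifferentiableOn ℂ g Ω := differentiableOn_id.sub haΩ
  have hlip := lipschitzWith_half_of_iteratedFDeriv ha fun z =>
    (hak 1 (le_max_right _ _) z).trans ((min_le_right _ _).trans (min_le_right _ _))
  have hinj : Function.Injective g := by
    intro z w hzw
    have h1 : a z - a w = z - w := by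
      simp only [hgdef] at hzw
      linear_combination -hzw
    have h2 := hlip z w
    rw [h1] at h2
    have h3 : ‖z - w‖ = 0 := le_antisymm (by linarith) (norm_nonneg _)
    exact sub_eq_zero.1 (norm_eq_zero.1 h3)
  have hgball : ∀ ζ ∈ ball w₀ (ε / 2), g ζ ∈ ball w₀ ε := by
    intro ζ hζ
    have h0 := (hak 0 (Nat.zero_le _) ζ).trans ((min_le_right _ _).trans (min_le_left _ _))
    rw [norm_iteratedFDeriv_zero] at h0
    rw [mem_ball, dist_eq_norm] at hζ ⊢
    calc ‖g ζ - w₀‖ = ‖(ζ - w₀) - a ζ‖ := by simp only [hgdef]; ring_nf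
      _ ≤ ‖ζ - w₀‖ + ‖a ζ‖ := norm_sub_le _ _
      _ < ε := by linarith
  obtain ⟨c, hc, hquad⟩ := exists_setIntegral_mul_conj_deriv hΩo hΩb hsub hg hgΩ ham
  obtain ⟨M, hM, v, hv, hsum⟩ := exists_fin_sum_eq (insert w₀ c.support) (Finset.insert_nonempty _ _)
  have hvD : ∀ j, v j ∈ ball w₀ (ε / 2) := by
    intro j
    rcases Finset.mem_insert.1 (hv j) with h | h
    · rw [h]; exact mem_ball_self hε2
    · exact hc h
  refine ⟨g, ⟨univ, isOpen_univ, subset_univ _, hg.contDiffOn⟩, hgΩ, hinj.injOn, ?_, M, hM,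
    fun j => g (v j), fun j => c (v j) * (Real.pi * deriv g (v j)),
    fun j => ⟨hgball _ (hvD j), mem_image_of_mem g (hsub (hvD j))⟩, fun f hf => ?_⟩
  · intro k hk z _
    have h1 : (fun w => g w - w) = -a := by
      funext w
      simp [hgdef]
    rw [h1, iteratedFDeriv_neg, Pi.neg_apply, norm_neg]
    exact (hak k (hk.trans (le_max_left _ _)) z).trans (min_le_left _ _)
  · obtain ⟨hFd, hFi⟩ := integrableOn_comp_mul_deriv hΩo hΩb hgΩ hinj.injOn hf.1 hf.2
    rw [setIntegral_image_eq hΩo hgΩ hinj.injOn, hquad _ hFd hFi,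
      Finset.sum_subset (Finset.subset_insert w₀ c.support) fun ζ _ hζ => by
        rw [Finsupp.notMem_support_iff.1 hζ, zero_mul], hsum]
    refine Finset.sum_congr rfl fun j _ => ?_
    ring
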